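/- For every ε > 0 there exists C = C(ε) > 0 such that for every integer q ≥ 1 and every real B with 1 ≤ B ≤ q, one has ∑_{1 ≤ b₁,b₂,b₃,b₄ ≤ B, gcd(bᵢ,q)=1 for each i} |G_q(b₁,b₂,b₃,b₄)| ≤ C q^{ε} ( B⁴ q^{5/2} q̊^{−1/2} + B² q³ q̊ + B q^{7/2} q̊^{1/2} ). -/

import Mathlib

/-- `e_q(x) = exp(2πi x / q)`. -/
noncomputable def eInt (q : ℕ) (x : ℤ) : ℂ := Complex.exp (2 * Real.pi * Complex.I * x / q)

/-- A natural-number representative of the multiplicative inverse of `x` modulo `q`. -/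
noncomputable def invMod (q : ℕ) (x : ℤ) : ℕ := (((x : ZMod q))⁻¹).val

/-- The Kloosterman sum `S(a,b;q) = ∑_{x mod q, (x,q)=1} e_q(a x + b x̄)`. -/
noncomputable def Kloos (q : ℕ) (a b : ℤ) : ℂ :=
  ∑ x ∈ (Finset.range q).filter (fun x => Nat.Coprime x q), eInt q (a * x + b * invMod q x)

/-- `G_q(b₁,b₂,b₃,b₄) = ∑_{h mod q} S(h,b̄₁;q) S(h,b̄₂;q) S(h,b̄₃;q) S(h,b̄₄;q)`. -/
noncomputable def Gquad (q : ℕ) (b₁ b₂ b₃ b₄ : ℤ) : ℂ :=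
  ∑ h ∈ Finset.range q,
    Kloos q h (invMod q b₁) * Kloos q h (invMod q b₂) *
      Kloos q h (invMod q b₃) * Kloos q h (invMod q b₄)
/-- `q̊`: the product of the primes whose exponent in `q` is odd and at least `3`. -/
def qring (q : ℕ) : ℕ :=
  ∏ p ∈ q.primeFactors.filter (fun p => Odd (q.factorization p) ∧ 3 ≤ q.factorization p), p

/-- The integers `1 ≤ b ≤ B` coprime to `q`. -/
noncomputable def bRange (q : ℕ) (B : ℝ) : Finset ℕ :=
  (Finset.Icc 1 ⌊B⌋₊).filter (fun b => Nat.Coprime b q)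

namespace AQK

open Finset

/-- The complete sum `∑ ψ(∑ cᵢ / xᵢ)` over quadruples of units with vanishing sum. -/
noncomputable def Sig {R : Type*} [CommRing R] [Fintype R] [DecidableEq R] (ψ : AddChar R ℂ)
    (c : Fin 4 → R) : ℂ :=
  ∑ x : Fin 4 → Rˣ with ∑ i, (x i : R) = 0, ψ (∑ i, c i * ((x i)⁻¹ : Rˣ))

lemma norm_sum_addChar_le {R ι : Type*} [CommRing R] [Finite R] (ψ : AddChar R ℂ) (s : Finset ι)
    (g : ι → R) : ‖∑ i ∈ s, ψ (g i)‖ ≤ s.card := by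
  refine (norm_sum_le _ _).trans ?_
  simp [AddChar.norm_apply]

/-- Orthogonality for a primitive additive character. -/
lemma sum_primitive {R : Type*} [CommRing R] [Fintype R] [DecidableEq R] {ψ : AddChar R ℂ}
    (hψ : ψ.IsPrimitive) (b : R) : ∑ x, ψ (x * b) = if b = 0 then (Fintype.card R : ℂ) else 0 := by
  rw [AddChar.sum_mulShift b hψ]
  split_ifs <;> simp

lemma sum_primitive' {R : Type*} [CommRing R] [Fintype R] [DecidableEq R] {ψ : AddChar R ℂ}
    (hψ : ψ.IsPrimitive) (b : R) : ∑ x, ψ (b * x) = if b = 0 then (Fintype.card R : ℂ) else 0 := by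
  rw [← sum_primitive hψ b]
  exact sum_congr rfl fun x _ => by rw [mul_comm]

/-- `b₁ = b₂, b₃ = b₄` up to permutation. -/
def Paired {R : Type*} (c : Fin 4 → R) : Prop :=
  (c 0 = c 1 ∧ c 2 = c 3) ∨ (c 0 = c 2 ∧ c 1 = c 3) ∨ (c 0 = c 3 ∧ c 1 = c 2)

end AQK

namespace AQK

open Finset

section Shift

variable {R : Type*} [CommRing R]

/-- The unit `x + y` for nilpotent `y`. -/
noncomputable def unitShift (x : Rˣ) {y : R} (hy : IsNilpotent y) : Rˣ :=
  (hy.isUnit_add_left_of_commute x.isUnit (Commute.all _ _)).unit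

@[simp] lemma unitShift_val (x : Rˣ) {y : R} (hy : IsNilpotent y) :
    (unitShift x hy : R) = x + y := rfl

lemma unitShift_inv (x : Rˣ) {y : R} (hy : IsNilpotent y) (h3 : y ^ 3 = 0) :
    (((unitShift x hy)⁻¹ : Rˣ) : R) =
      (x⁻¹ : Rˣ) - y * ((x⁻¹ : Rˣ) : R) ^ 2 + y ^ 2 * ((x⁻¹ : Rˣ) : R) ^ 3 := by
  apply Units.inv_eq_of_mul_eq_one_right
  rw [unitShift_val]
  have hx : (x : R) * ((x⁻¹ : Rˣ) : R) = 1 := x.mul_inv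
  linear_combination (1 + -y * ((x⁻¹ : Rˣ) : R) + y ^ 2 * ((x⁻¹ : Rˣ) : R) ^ 2) * hx
    + ((x⁻¹ : Rˣ) : R) ^ 3 * h3

variable [Fintype R] [DecidableEq R]

/-- Quadruples with vanishing sum. -/
def zeroSum (R : Type*) [CommRing R] [Fintype R] [DecidableEq R] : Finset (Fin 4 → R) :=
  univ.filter (fun d => ∑ i, d i = 0)

/-- Quadruples of units with vanishing sum. -/
def unitZeroSum (R : Type*) [CommRing R] [Fintype R] [DecidableEq R] : Finset (Fin 4 → Rˣ) :=
  univ.filter (fun d => ∑ i, (d i : R) = 0)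

lemma mem_zeroSum {d : Fin 4 → R} : d ∈ zeroSum R ↔ ∑ i, d i = 0 := by simp [zeroSum]

lemma mem_unitZeroSum {d : Fin 4 → Rˣ} : d ∈ unitZeroSum R ↔ ∑ i, (d i : R) = 0 := by
  simp [unitZeroSum]

/-- The local quadratic exponential sum around `x` at scale `a`. -/
noncomputable def localSum (ψ : AddChar R ℂ) (c : Fin 4 → R) (a : R) (x : Fin 4 → Rˣ) : ℂ :=
  ∑ d ∈ zeroSum R, ψ (-(a * ∑ i, c i * (((x i)⁻¹ : Rˣ) : R) ^ 2 * d i) +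
    a ^ 2 * ∑ i, c i * (((x i)⁻¹ : Rˣ) : R) ^ 3 * d i ^ 2)

lemma Sig_eq_shift (ψ : AddChar R ℂ) (c : Fin 4 → R) {a : R} (ha : a ^ 3 = 0) {d : Fin 4 → R}
    (hd : d ∈ zeroSum R) : Sig ψ c = ∑ x ∈ unitZeroSum R,
      ψ (∑ i, c i * ((x i)⁻¹ : Rˣ)) * ψ (-(a * ∑ i, c i * (((x i)⁻¹ : Rˣ) : R) ^ 2 * d i) +
    a ^ 2 * ∑ i, c i * (((x i)⁻¹ : Rˣ) : R) ^ 3 * d i ^ 2) := by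
  have hn : ∀ y : R, IsNilpotent (a * y) := fun y => ⟨3, by rw [mul_pow, ha, zero_mul]⟩
  have hd0 := mem_zeroSum.1 hd
  symm
  refine sum_bij' (fun x _ i => unitShift (x i) (hn (d i)))
    (fun x _ i => unitShift (x i) (hn (-d i))) ?_ ?_ ?_ ?_ ?_
  · intro x hx
    have := mem_unitZeroSum.1 hx
    simp [sum_add_distrib, ← mul_sum, hd0, this]
  · intro x hx
    have := (mem_filter.1 hx).2
    simp [mem_unitZeroSum, sum_add_distrib, ← mul_sum, hd0, this]
  · intro x _
    ext i
    simp
  · intro x _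
    ext i
    simp
  · intro x _
    rw [← AddChar.map_add_eq_mul]
    congr 1
    rw [mul_sum, mul_sum, ← sum_neg_distrib, ← sum_add_distrib, ← sum_add_distrib]
    apply sum_congr rfl
    intro i _
    rw [unitShift_inv _ (hn _) (by rw [mul_pow, ha, zero_mul])]
    ring

lemma card_mul_Sig (ψ : AddChar R ℂ) (c : Fin 4 → R) {a : R} (ha : a ^ 3 = 0) :
    ((zeroSum R).card : ℂ) * Sig ψ c = ∑ x ∈ unitZeroSum R,
      ψ (∑ i, c i * ((x i)⁻¹ : Rˣ)) * localSum ψ c a x := by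
  have h : ((zeroSum R).card : ℂ) * Sig ψ c = ∑ d ∈ zeroSum R, Sig ψ c := by
    rw [sum_const, nsmul_eq_mul]
  rw [h, sum_congr rfl fun d hd => Sig_eq_shift ψ c ha hd, sum_comm]
  exact sum_congr rfl fun x _ => by rw [localSum, mul_sum]

lemma sum_zeroSum_add (g : (Fin 4 → R) → ℂ) {t : Fin 4 → R} (ht : t ∈ zeroSum R) :
    ∑ d ∈ zeroSum R, g (d + t) = ∑ d ∈ zeroSum R, g d := by
  have ht0 := mem_zeroSum.1 ht
  refine sum_nbij' (fun d => d + t) (fun d => d - t) ?_ ?_ ?_ ?_ ?_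
  · intro d hd
    rw [mem_zeroSum] at hd ⊢
    simp [sum_add_distrib, hd, ht0]
  · intro d hd
    rw [mem_zeroSum] at hd ⊢
    simp [sum_sub_distrib, hd, ht0]
  · intro d _; simp
  · intro d _; simp
  · intro d _; rfl

lemma localSum_shift (ψ : AddChar R ℂ) (c : Fin 4 → R) (a : R) (x : Fin 4 → Rˣ)
    {t : Fin 4 → R} (ht : t ∈ zeroSum R)
    (hrad : ∀ i, a ^ 2 * (2 * (c i * (((x i)⁻¹ : Rˣ) : R) ^ 3 * t i)) =
      a ^ 2 * (2 * (c 0 * (((x 0)⁻¹ : Rˣ) : R) ^ 3 * t 0))) :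
    localSum ψ c a x = ψ (-(a * ∑ i, c i * (((x i)⁻¹ : Rˣ) : R) ^ 2 * t i) +
    a ^ 2 * ∑ i, c i * (((x i)⁻¹ : Rˣ) : R) ^ 3 * t i ^ 2) * localSum ψ c a x := by
  conv_lhs => rw [localSum, ← sum_zeroSum_add _ ht]
  rw [localSum, mul_sum]
  apply sum_congr rfl
  intro d hd
  rw [← AddChar.map_add_eq_mul]
  congr 1
  have hd0 := mem_zeroSum.1 hd
  have hcross : a ^ 2 * ∑ i, 2 * (c i * (((x i)⁻¹ : Rˣ) : R) ^ 3 * t i) * d i = 0 := by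
    rw [mul_sum]
    have : ∀ i ∈ (univ : Finset (Fin 4)), a ^ 2 * (2 * (c i * (((x i)⁻¹ : Rˣ) : R) ^ 3 * t i) * d i) =
        a ^ 2 * (2 * (c 0 * (((x 0)⁻¹ : Rˣ) : R) ^ 3 * t 0)) * d i := by
      intro i _
      rw [← hrad i]; ring
    rw [sum_congr rfl this, ← mul_sum, hd0, mul_zero]
  rw [Fin.sum_univ_four] at hcross
  simp only [Fin.sum_univ_four, Pi.add_apply]
  linear_combination hcross

lemma norm_localSum_sq_le (ψ : AddChar R ℂ) (hψ : ψ.IsPrimitive) (c : Fin 4 → R) (a : R)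
    (x : Fin 4 → Rˣ) : ‖localSum ψ c a x‖ ^ 2 ≤ (zeroSum R).card *
      ((zeroSum R).filter (fun t => ∀ i, a ^ 2 * (2 * (c i * (((x i)⁻¹ : Rˣ) : R) ^ 3 * t i)) =
      a ^ 2 * (2 * (c 0 * (((x 0)⁻¹ : Rˣ) : R) ^ 3 * t 0)))).card := by
  set Q : (Fin 4 → R) → R := fun d => -(a * ∑ i, c i * (((x i)⁻¹ : Rˣ) : R) ^ 2 * d i) +
    a ^ 2 * ∑ i, c i * (((x i)⁻¹ : Rˣ) : R) ^ 3 * d i ^ 2 with hQ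
  set L : (Fin 4 → R) → (Fin 4 → R) → R := fun t d =>
    a ^ 2 * ∑ i, 2 * (c i * (((x i)⁻¹ : Rˣ) : R) ^ 3 * t i) * d i with hL
  set P : (Fin 4 → R) → Prop := fun t => ∀ i, a ^ 2 * (2 * (c i * (((x i)⁻¹ : Rˣ) : R) ^ 3 * t i)) =
      a ^ 2 * (2 * (c 0 * (((x 0)⁻¹ : Rˣ) : R) ^ 3 * t 0)) with hP
  have h1 : (‖localSum ψ c a x‖ ^ 2 : ℝ) =
      ((∑ t ∈ zeroSum R, ψ (Q t) * ∑ d ∈ zeroSum R, ψ (L t d) : ℂ)) := by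
    have e1 : ((‖localSum ψ c a x‖ ^ 2 : ℝ) : ℂ) =
        localSum ψ c a x * (starRingEnd ℂ) (localSum ψ c a x) := by
      rw [Complex.mul_conj, Complex.normSq_eq_norm_sq]
    rw [e1]
    have e2 : (starRingEnd ℂ) (localSum ψ c a x) = ∑ d ∈ zeroSum R, (starRingEnd ℂ) (ψ (Q d)) := by
      rw [localSum, map_sum]
    rw [e2, mul_sum]
    simp only [mul_sum]
    rw [sum_comm (s := zeroSum R)]
    apply sum_congr rfl
    intro d hd
    rw [localSum, ← sum_zeroSum_add _ hd, sum_mul]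
    apply sum_congr rfl
    intro t _
    rw [← AddChar.inv_apply_eq_conj, ← AddChar.map_neg_eq_inv, ← AddChar.map_add_eq_mul,
      ← AddChar.map_add_eq_mul]
    congr 1
    simp only [hQ, hL, Fin.sum_univ_four, Pi.add_apply]
    ring
  have h2 : ∀ t, ‖∑ d ∈ zeroSum R, ψ (L t d)‖ ≤ if P t then ((zeroSum R).card : ℝ) else 0 := by
    intro t
    split_ifs with h
    · exact norm_sum_addChar_le ψ _ _
    · rw [norm_le_zero_iff]
      by_contra hne
      apply h
      have htriv : ∀ s ∈ zeroSum R, ψ (L t s) = 1 := by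
        intro s hs
        have e := sum_zeroSum_add (fun d => ψ (L t d)) hs
        have e2 : ∀ d, ψ (L t (d + s)) = ψ (L t s) * ψ (L t d) := by
          intro d
          rw [← AddChar.map_add_eq_mul]
          congr 1
          simp only [hL, Fin.sum_univ_four, Pi.add_apply]
          ring
        simp only [e2, ← mul_sum] at e
        exact mul_right_cancel₀ hne (by rw [e, one_mul])
      intro i
      by_contra hi
      rw [← sub_eq_zero, ← ne_eq] at hi
      apply hψ hi
      ext s
      rw [AddChar.mulShift_apply, AddChar.one_apply]
      rw [← htriv (Pi.single i s - Pi.single 0 s) (by simp [mem_zeroSum, sum_sub_distrib])]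
      congr 1
      simp only [hL, Pi.sub_apply, mul_sub, sum_sub_distrib, Pi.single_apply, mul_ite, mul_zero,
        sum_ite_eq', mem_univ, if_true]
      ring
  have h3 : ‖localSum ψ c a x‖ ^ 2 = ‖((‖localSum ψ c a x‖ ^ 2 : ℝ) : ℂ)‖ := by
    rw [Complex.norm_real, Real.norm_eq_abs, abs_of_nonneg (by positivity)]
  rw [h3, h1]
  refine (norm_sum_le _ _).trans ?_
  calc ∑ t ∈ zeroSum R, ‖ψ (Q t) * ∑ d ∈ zeroSum R, ψ (L t d)‖
      ≤ ∑ t ∈ zeroSum R, if P t then ((zeroSum R).card : ℝ) else 0 := by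
        apply sum_le_sum
        intro t _
        rw [norm_mul, AddChar.norm_apply, one_mul]
        exact h2 t
    _ = _ := by
        rw [← sum_filter, sum_const, nsmul_eq_mul, mul_comm]

end Shift

end AQK

namespace AQK

open Finset

/-- Existence of units `xᵢ` with vanishing sum and all `bᵢ xᵢ²` equal. -/
def CondB {A : Type*} [CommRing A] (b : Fin 4 → A) : Prop :=
  ∃ x : Fin 4 → Aˣ, ∑ i, (x i : A) = 0 ∧ ∀ i, b i * (x i : A) ^ 2 = b 0 * (x 0 : A) ^ 2

section Linear

variable {R : Type*} [CommRing R]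

lemma eq_zero_of_linear {ψ : AddChar R ℂ} (hψ : ψ.IsPrimitive) {b : R}
    (h : ∀ s, ψ (b * s) = 1) : b = 0 := by
  by_contra hb
  apply hψ hb
  ext s
  rw [AddChar.mulShift_apply, AddChar.one_apply, h]

variable [Fintype R] [DecidableEq R]

lemma linear_of_localSum_ne_zero {ψ : AddChar R ℂ} (hψ : ψ.IsPrimitive) {c : Fin 4 → R} {a z : R}
    (haz : a ^ 2 * z = 0) {x : Fin 4 → Rˣ} (h : localSum ψ c a x ≠ 0) (i : Fin 4) :
    a * z * (c i * (((x i)⁻¹ : Rˣ) : R) ^ 2 - c 0 * (((x 0)⁻¹ : Rˣ) : R) ^ 2) = 0 := by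
  apply eq_zero_of_linear hψ
  intro s
  have hv : ∃ v : Fin 4 → R, ∑ j, v j = 0 ∧ ∀ w : Fin 4 → R, ∑ j, w j * v j = w 0 - w i := by
    refine ⟨Pi.single 0 1 - Pi.single i 1, by simp [sum_sub_distrib], fun w => ?_⟩
    simp [mul_sub, sum_sub_distrib, Pi.single_apply]
  obtain ⟨v, hv0, hv⟩ := hv
  have hz : ∀ w, a ^ 2 * (w * z) = 0 := fun w => by linear_combination w * haz
  have ht : (fun j => z * s * v j) ∈ zeroSum R := by
    rw [mem_zeroSum, ← mul_sum, hv0, mul_zero]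
  have := localSum_shift ψ c a x ht (fun m => by
    linear_combination 2 * (c m * (((x m)⁻¹ : Rˣ) : R) ^ 3 * s * v m -
      c 0 * (((x 0)⁻¹ : Rˣ) : R) ^ 3 * s * v 0) * haz)
  have h1 := mul_right_cancel₀ h ((one_mul _).trans this)
  rw [h1]
  congr 1
  have e1 : ∑ i, c i * (((x i)⁻¹ : Rˣ) : R) ^ 2 * (z * s * v i) =
      z * s * ∑ i, c i * (((x i)⁻¹ : Rˣ) : R) ^ 2 * v i := by
    rw [mul_sum]; exact sum_congr rfl fun _ _ => by ring
  have e2 : a ^ 2 * ∑ i, c i * (((x i)⁻¹ : Rˣ) : R) ^ 3 * (z * s * v i) ^ 2 = 0 := by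
    rw [mul_sum]
    exact sum_eq_zero fun j _ => by
      linear_combination c j * (((x j)⁻¹ : Rˣ) : R) ^ 3 * z * s ^ 2 * v j ^ 2 * haz
  rw [e1, e2, hv]
  ring

lemma sum_inv_of_localSum_ne_zero {ψ : AddChar R ℂ} (hψ : ψ.IsPrimitive) {c : Fin 4 → R} {a : R}
    {x : Fin 4 → Rˣ} (hx : ∑ i, (x i : R) = 0)
    (hκ : ∀ i, a ^ 2 * (c i * (((x i)⁻¹ : Rˣ) : R) ^ 2 - c 0 * (((x 0)⁻¹ : Rˣ) : R) ^ 2) = 0)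
    (h : localSum ψ c a x ≠ 0) : a * ∑ i, c i * (((x i)⁻¹ : Rˣ) : R) = 0 := by
  have hxi : ∀ i, (x i : R) * (((x i)⁻¹ : Rˣ) : R) = 1 := fun i => (x i).mul_inv
  set S := ∑ i, c i * (((x i)⁻¹ : Rˣ) : R) with hS
  have hS2 : a ^ 2 * S = 0 := by
    have : a ^ 2 * S = a ^ 2 * (c 0 * (((x 0)⁻¹ : Rˣ) : R) ^ 2) * ∑ i, (x i : R) := by
      rw [hS, mul_sum, mul_sum]
      apply sum_congr rfl
      intro i _
      linear_combination (x i : R) * hκ i - a ^ 2 * c i * (((x i)⁻¹ : Rˣ) : R) * hxi i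
    rw [this, hx, mul_zero]
  apply eq_zero_of_linear hψ
  intro s
  have ht : (fun j => -s * (x j : R)) ∈ zeroSum R := by
    rw [mem_zeroSum, ← mul_sum, hx, mul_zero]
  have := localSum_shift ψ c a x ht (fun m => by
    linear_combination -2 * s * hκ m + 2 * (-s) * a ^ 2 * c m * (((x m)⁻¹ : Rˣ) : R) ^ 2 * hxi m
     - 2 * (-s) * a ^ 2 * c 0 * (((x 0)⁻¹ : Rˣ) : R) ^ 2 * hxi 0)
  have h1 := mul_right_cancel₀ h ((one_mul _).trans this)
  rw [h1]
  congr 1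
  have e1 : ∑ i, c i * (((x i)⁻¹ : Rˣ) : R) ^ 2 * (-s * (x i : R)) = - s * S := by
    rw [hS, mul_sum]
    exact sum_congr rfl fun i _ => by linear_combination (-s) * c i * (((x i)⁻¹ : Rˣ) : R) * hxi i
  have e2 : ∑ i, c i * (((x i)⁻¹ : Rˣ) : R) ^ 3 * (-s * (x i : R)) ^ 2 = s ^ 2 * S := by
    rw [hS, mul_sum]
    exact sum_congr rfl fun i _ => by
      linear_combination s ^ 2 * c i * (((x i)⁻¹ : Rˣ) : R) * (1 + x i * (((x i)⁻¹ : Rˣ) : R)) * hxi i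
  rw [e1, e2]
  linear_combination - s ^ 2 * hS2

lemma norm_Sig_le_of_localSum (ψ : AddChar R ℂ) (c : Fin 4 → R) {a : R} (ha : a ^ 3 = 0)
    {M : ℝ} (hM : ∀ x, ‖localSum ψ c a x‖ ≤ (zeroSum R).card * M)
    (T : Finset (Fin 4 → Rˣ)) (hT : ∀ x ∈ unitZeroSum R, localSum ψ c a x ≠ 0 → x ∈ T) :
    ‖Sig ψ c‖ ≤ T.card * M := by
  have hz : (0 : ℝ) < (zeroSum R).card := by
    have : 0 < (zeroSum R).card := card_pos.2 ⟨0, by simp [mem_zeroSum]⟩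
    exact_mod_cast this
  have hM0 : 0 ≤ M := by
    have := (norm_nonneg _).trans (hM 1)
    exact nonneg_of_mul_nonneg_right this hz
  have h := card_mul_Sig ψ c ha
  have h2 : ‖∑ x ∈ unitZeroSum R, ψ (∑ i, c i * ((x i)⁻¹ : Rˣ)) * localSum ψ c a x‖ ≤
      T.card * ((zeroSum R).card * M) := by
    refine (norm_sum_le _ _).trans ?_
    calc _ ≤ ∑ x ∈ unitZeroSum R, if x ∈ T then ((zeroSum R).card * M) else 0 := by
          apply sum_le_sum
          intro x hx
          rw [norm_mul, AddChar.norm_apply, one_mul]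
          split_ifs with hxT
          · exact hM x
          · rw [norm_le_zero_iff]
            by_contra hne
            exact hxT (hT x hx hne)
      _ ≤ _ := by
          rw [← sum_filter, sum_const, nsmul_eq_mul]
          have : ((unitZeroSum R).filter (· ∈ T)).card ≤ T.card :=
            card_le_card fun y hy => (mem_filter.1 hy).2
          have : (((unitZeroSum R).filter (· ∈ T)).card : ℝ) ≤ T.card := by exact_mod_cast this
          gcongr
  rw [← h, norm_mul, Complex.norm_natCast] at h2
  nlinarith

end Linear

section Count

lemma card_quad_le {α : Type*} [Fintype α] [DecidableEq α] (T : Finset (Fin 4 → α))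
    (P Q : α → α → Prop) [∀ a, DecidablePred (P a)] [∀ a, DecidablePred (Q a)]
    (hdet : ∀ x ∈ T, ∀ y ∈ T, x 0 = y 0 → x 1 = y 1 → x 2 = y 2 → x 3 = y 3)
    (hP : ∀ x ∈ T, P (x 0) (x 1)) (hQ : ∀ x ∈ T, Q (x 0) (x 2)) {A : ℕ}
    (hPA : ∀ a, (univ.filter (P a)).card ≤ A) (hQA : ∀ a, (univ.filter (Q a)).card ≤ A) :
    T.card ≤ Fintype.card α * A ^ 2 := by
  calc T.card ≤ ((univ : Finset α).sigma
        (fun a => (univ.filter (P a)) ×ˢ (univ.filter (Q a)))).card := by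
        refine card_le_card_of_injOn (fun x => ⟨x 0, (x 1, x 2)⟩) ?_ ?_
        · intro x hx
          simp only [coe_sigma, Set.mem_sigma_iff, coe_univ, Set.mem_univ, true_and, mem_coe,
            mem_product, mem_filter, mem_univ]
          exact ⟨hP x hx, hQ x hx⟩
        · intro x hx y hy hxy
          simp only [Sigma.mk.injEq, heq_eq_eq, Prod.mk.injEq] at hxy
          obtain ⟨h0, h12⟩ := hxy
          obtain ⟨h1, h2⟩ := h12
          have h3 := hdet x hx y hy h0 h1 h2
          ext i
          fin_cases i <;> assumption
    _ = ∑ a, (univ.filter (P a)).card * (univ.filter (Q a)).card := by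
        rw [card_sigma]; simp [card_product]
    _ ≤ ∑ a : α, A * A := sum_le_sum fun a _ => Nat.mul_le_mul (hPA a) (hQA a)
    _ = _ := by rw [sum_const, card_univ, smul_eq_mul, pow_two]

lemma card_zeroSum {R : Type*} [CommRing R] [Fintype R] [DecidableEq R] :
    (zeroSum R).card = Fintype.card R ^ 3 := by
  have : (zeroSum R).card = (univ : Finset (Fin 3 → R)).card := by
    refine card_nbij' (fun d i => d i.castSucc) (fun v => Fin.snoc v (-∑ i, v i)) ?_ ?_ ?_ ?_
    · intro _ _; simp
    · intro v _
      rw [mem_coe, mem_zeroSum, Fin.sum_univ_castSucc]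
      simp only [Fin.snoc_castSucc, Fin.snoc_last]
      ring
    · intro d hd
      have := mem_zeroSum.1 hd
      rw [Fin.sum_univ_castSucc] at this
      ext i
      refine Fin.lastCases ?_ (fun j => ?_) i
      · simp only [Fin.snoc_last]
        exact (eq_neg_of_add_eq_zero_right this).symm
      · simp
    · intro v _
      ext i; simp
  rw [this, card_univ, Fintype.card_fun, Fintype.card_fin]

lemma card_annihilator_le (n d : ℕ) [NeZero n] (hd : 0 < d) :
    ((univ : Finset (ZMod n)).filter (fun w => (d : ZMod n) * w = 0)).card ≤ d := by
  have := IsAddCyclic.card_nsmul_eq_zero_le (α := ZMod n) hd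
  simpa [nsmul_eq_mul] using this

end Count

end AQK

namespace AQK

open Finset

section

variable {p k : ℕ}

lemma pow_dvd_of_dvd_mul (hp : p.Prime) {e : ℕ} {n : ℤ}
    (h : (p : ℤ) ^ k ∣ (p : ℤ) ^ e * ((n - 1) * (n + 1))) :
    (p : ℤ) ^ k ∣ 2 * (p : ℤ) ^ e * (n - 1) ∨ (p : ℤ) ^ k ∣ 2 * (p : ℤ) ^ e * (n + 1) := by
  have hpi : Prime (p : ℤ) := Nat.prime_iff_prime_int.1 hp
  by_cases h1 : (p : ℤ) ∣ n - 1
  · by_cases h2 : (p : ℤ) ∣ n + 1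
    · have h3 : (p : ℤ) ∣ 2 := by
        have := dvd_sub h2 h1
        ring_nf at this
        exact this
      have hp2 : p = 2 := by
        have : p ∣ 2 := by exact_mod_cast h3
        exact (Nat.prime_dvd_prime_iff_eq hp Nat.prime_two).1 this
      subst hp2
      obtain ⟨m, hm⟩ := h1
      push_cast at hm h ⊢
      have hn : n = 2 * m + 1 := by linarith
      subst hn
      rcases Int.even_or_odd m with hev | hodd
      · left
        have hc : IsCoprime ((2 : ℤ) ^ k) (m + 1) :=
          IsCoprime.pow_left (Int.isCoprime_two_left.2 hev.add_one)
        have h' : (2 : ℤ) ^ k ∣ 2 * 2 ^ e * (2 * m + 1 - 1) * (m + 1) := by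
          convert h using 1; ring
        exact hc.dvd_of_dvd_mul_right h'
      · right
        have hc : IsCoprime ((2 : ℤ) ^ k) m := IsCoprime.pow_left (Int.isCoprime_two_left.2 hodd)
        have h' : (2 : ℤ) ^ k ∣ 2 * 2 ^ e * (2 * m + 1 + 1) * m := by
          convert h using 1; ring
        exact hc.dvd_of_dvd_mul_right h'
    · left
      have hc : IsCoprime ((p : ℤ) ^ k) (n + 1) :=
        IsCoprime.pow_left ((hpi.irreducible.coprime_iff_not_dvd).2 h2)
      have : (p : ℤ) ^ k ∣ (p : ℤ) ^ e * (n - 1) :=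
        hc.dvd_of_dvd_mul_right (by rw [mul_assoc]; exact h)
      rw [mul_assoc]; exact this.mul_left _
  · right
    have hc : IsCoprime ((p : ℤ) ^ k) (n - 1) :=
      IsCoprime.pow_left ((hpi.irreducible.coprime_iff_not_dvd).2 h1)
    have h' : (p : ℤ) ^ k ∣ (n - 1) * ((p : ℤ) ^ e * (n + 1)) := by
      convert h using 1; ring
    have : (p : ℤ) ^ k ∣ (p : ℤ) ^ e * (n + 1) := hc.dvd_of_dvd_mul_left h'
    rw [mul_assoc]; exact this.mul_left _

lemma ZMod_factor (hp : p.Prime) {e : ℕ} {v : ZMod (p ^ k)}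
    (h : ((p ^ e : ℕ) : ZMod (p ^ k)) * (v ^ 2 - 1) = 0) :
    ((2 * p ^ e : ℕ) : ZMod (p ^ k)) * (v - 1) = 0 ∨
      ((2 * p ^ e : ℕ) : ZMod (p ^ k)) * (v + 1) = 0 := by
  obtain ⟨n, rfl⟩ := ZMod.intCast_surjective v
  have h1 : (((p : ℤ) ^ e * ((n - 1) * (n + 1)) : ℤ) : ZMod (p ^ k)) = 0 := by
    push_cast at h ⊢
    linear_combination h
  rw [ZMod.intCast_zmod_eq_zero_iff_dvd] at h1
  push_cast at h1
  rcases pow_dvd_of_dvd_mul hp h1 with h2 | h2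
  · left
    have : ((2 * (p : ℤ) ^ e * (n - 1) : ℤ) : ZMod (p ^ k)) = 0 := by
      rw [ZMod.intCast_zmod_eq_zero_iff_dvd]; push_cast; exact h2
    push_cast at this ⊢
    exact this
  · right
    have : ((2 * (p : ℤ) ^ e * (n + 1) : ℤ) : ZMod (p ^ k)) = 0 := by
      rw [ZMod.intCast_zmod_eq_zero_iff_dvd]; push_cast; exact h2
    push_cast at this ⊢
    exact this

instance fact_pow_neZero [hp : Fact p.Prime] : NeZero (p ^ k) := ⟨pow_ne_zero _ hp.out.ne_zero⟩

/-- Number of unit solutions of `p^e (c y⁻² - w) = 0`. -/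
lemma card_unit_sq_le [hp : Fact p.Prime] (e : ℕ) (c : (ZMod (p ^ k))ˣ) (w : ZMod (p ^ k)) :
    ((univ : Finset (ZMod (p ^ k))ˣ).filter (fun y => ((p ^ e : ℕ) : ZMod (p ^ k)) *
      (c * (((y⁻¹ : (ZMod (p ^ k))ˣ) : ZMod (p ^ k))) ^ 2 - w) = 0)).card ≤ 4 * p ^ e := by
  classical
  set T := (univ : Finset (ZMod (p ^ k))ˣ).filter (fun y => ((p ^ e : ℕ) : ZMod (p ^ k)) *
      (c * (((y⁻¹ : (ZMod (p ^ k))ˣ) : ZMod (p ^ k))) ^ 2 - w) = 0) with hT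
  rcases T.eq_empty_or_nonempty with h0 | ⟨y0, hy0⟩
  · rw [h0]; simp
  set A := (univ : Finset (ZMod (p ^ k))).filter
    (fun z => ((2 * p ^ e : ℕ) : ZMod (p ^ k)) * z = 0) with hA
  have hAc : A.card ≤ 2 * p ^ e :=
    card_annihilator_le _ _ (Nat.mul_pos two_pos (pow_pos hp.out.pos _))
  have hsub : T.image (fun y => (((y0 * y⁻¹ : (ZMod (p ^ k))ˣ)) : ZMod (p ^ k))) ⊆
      A.image (fun z => z + 1) ∪ A.image (fun z => z - 1) := by
    intro v hv
    obtain ⟨y, hy, rfl⟩ := mem_image.1 hv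
    have h1 := (mem_filter.1 hy0).2
    have h2 := (mem_filter.1 hy).2
    have h3 : ((p ^ e : ℕ) : ZMod (p ^ k)) *
        ((((y0 * y⁻¹ : (ZMod (p ^ k))ˣ)) : ZMod (p ^ k)) ^ 2 - 1) = 0 := by
      rw [Units.val_mul]
      have hc : (c : ZMod (p ^ k)) * ((c⁻¹ : (ZMod (p ^ k))ˣ) : ZMod (p ^ k)) = 1 := c.mul_inv
      have hy : (y0 : ZMod (p ^ k)) * ((y0⁻¹ : (ZMod (p ^ k))ˣ) : ZMod (p ^ k)) = 1 := y0.mul_inv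
      set Y := ((y⁻¹ : (ZMod (p ^ k))ˣ) : ZMod (p ^ k))
      set Z := ((y0⁻¹ : (ZMod (p ^ k))ˣ) : ZMod (p ^ k))
      linear_combination ((c⁻¹ : (ZMod (p ^ k))ˣ) : ZMod (p ^ k)) * (y0 : ZMod (p ^ k)) ^ 2 *
        (h2 - h1) - ((p ^ e : ℕ) : ZMod (p ^ k)) * (y0 : ZMod (p ^ k)) ^ 2 * (Y ^ 2 - Z ^ 2) * hc
        - ((p ^ e : ℕ) : ZMod (p ^ k)) * (1 + y0 * Z) * hy * (-1)
    rcases ZMod_factor hp.out h3 with h4 | h4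
    · apply mem_union_left
      exact mem_image.2 ⟨_, mem_filter.2 ⟨mem_univ _, h4⟩, by ring⟩
    · apply mem_union_right
      exact mem_image.2 ⟨_, mem_filter.2 ⟨mem_univ _, h4⟩, by ring⟩
  have hinj : (T.image (fun y => (((y0 * y⁻¹ : (ZMod (p ^ k))ˣ)) : ZMod (p ^ k)))).card = T.card := by
    apply card_image_of_injective
    intro y y' h
    simpa using Units.ext h
  rw [← hinj]
  refine (card_le_card hsub).trans ((card_union_le _ _).trans ?_)
  have := card_image_le (s := A) (f := fun z => z + 1)
  have := card_image_le (s := A) (f := fun z => z - 1)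
  omega

/-- Divisibility in `ZMod (p^k)` seen modulo `p^m`. -/
lemma castHom_eq_zero [hp : Fact p.Prime] {e m : ℕ} (hm : m + e = k) (hd : p ^ m ∣ p ^ k)
    {y : ZMod (p ^ k)} (h : ((p ^ e : ℕ) : ZMod (p ^ k)) * y = 0) :
    ZMod.castHom hd (ZMod (p ^ m)) y = 0 := by
  obtain ⟨n, rfl⟩ := ZMod.natCast_zmod_surjective y
  rw [← Nat.cast_mul, ZMod.natCast_eq_zero_iff, ← hm, pow_add, mul_comm] at h
  rw [map_natCast, ZMod.natCast_eq_zero_iff]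
  exact Nat.dvd_of_mul_dvd_mul_left (pow_pos hp.out.pos e) h

lemma condB_of_eq {A : Type*} [CommRing A] {b c : Fin 4 → A} (hbc : ∀ i, c i * b i = 1)
    {x : Fin 4 → Aˣ} (hx : ∑ i, (x i : A) = 0) {i2 : A} (h2 : i2 * 2 = 1)
    (hκ : ∀ i, (c i * (((x i)⁻¹ : Aˣ) : A) ^ 2 - c 0 * (((x 0)⁻¹ : Aˣ) : A) ^ 2) ^ 2 = 0)
    (hS : ∑ i, c i * (((x i)⁻¹ : Aˣ) : A) = 0) : CondB b := by
  have hxi : ∀ i, (x i : A) * (((x i)⁻¹ : Aˣ) : A) = 1 := fun i => (x i).mul_inv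
  -- `κ₀⁻¹ = b₀ x₀²`
  set K : A := b 0 * (x 0 : A) ^ 2 with hK
  have hK1 : K * (c 0 * (((x 0)⁻¹ : Aˣ) : A) ^ 2) = 1 := by
    rw [hK]
    linear_combination (x 0 : A) ^ 2 * (((x 0)⁻¹ : Aˣ) : A) ^ 2 * hbc 0 +
      (1 + (x 0 : A) * (((x 0)⁻¹ : Aˣ) : A)) * hxi 0
  set δ : Fin 4 → A := fun i => K * (c i * (((x i)⁻¹ : Aˣ) : A) ^ 2 -
    c 0 * (((x 0)⁻¹ : Aˣ) : A) ^ 2) with hδ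
  have hδ2 : ∀ i, δ i ^ 2 = 0 := fun i => by rw [hδ]; simp only [mul_pow, hκ i, mul_zero]
  have hδ0 : δ 0 = 0 := by simp [hδ]
  have hinv : ∀ i, (1 + i2 * δ i) * (1 - i2 * δ i) = 1 := fun i => by
    linear_combination -i2 ^ 2 * hδ2 i
  refine ⟨fun i => x i * ⟨1 + i2 * δ i, 1 - i2 * δ i, hinv i, by rw [mul_comm]; exact hinv i⟩,
    ?_, ?_⟩
  · have e1 : ∀ i, (x i : A) * (1 + i2 * δ i) = i2 * (x i : A) + i2 * K *
        (c i * (((x i)⁻¹ : Aˣ) : A)) := by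
      intro i
      rw [hδ]
      linear_combination i2 * K * c i * (((x i)⁻¹ : Aˣ) : A) * hxi i - i2 * x i * hK1 - x i * h2
    simp only [Units.val_mul, e1, sum_add_distrib, ← mul_sum, hx, hS, mul_zero, add_zero]
  · intro i
    have e2 : ∀ i, b i * ((x i : A) * (1 + i2 * δ i)) ^ 2 = K := by
      intro i
      have h3 : (1 + i2 * δ i) ^ 2 = K * (c i * (((x i)⁻¹ : Aˣ) : A) ^ 2) := by
        have : δ i = K * (c i * (((x i)⁻¹ : Aˣ) : A) ^ 2) - 1 := by
          rw [hδ]; linear_combination -hK1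
        linear_combination i2 ^ 2 * hδ2 i + δ i * h2 + this
      rw [mul_pow, h3]
      linear_combination K * (x i : A) ^ 2 * (((x i)⁻¹ : Aˣ) : A) ^ 2 * hbc i +
        K * (1 + (x i : A) * (((x i)⁻¹ : Aˣ) : A)) * hxi i
    simp only [Units.val_mul]
    rw [e2, e2]

end

end AQK

namespace AQK

open Finset

section

variable {p k : ℕ}

/-- Unit quadruples with vanishing sum and `p^e (κᵢ - κ₀) = 0`. -/
noncomputable def critSet (p k e : ℕ) [Fact p.Prime] (c : Fin 4 → ZMod (p ^ k)) :
    Finset (Fin 4 → (ZMod (p ^ k))ˣ) :=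
  (unitZeroSum (ZMod (p ^ k))).filter fun x => ∀ i, ((p ^ e : ℕ) : ZMod (p ^ k)) *
    (c i * (((x i)⁻¹ : (ZMod (p ^ k))ˣ) : ZMod (p ^ k)) ^ 2 -
      c 0 * (((x 0)⁻¹ : (ZMod (p ^ k))ˣ) : ZMod (p ^ k)) ^ 2) = 0

lemma card_critSet_le [hp : Fact p.Prime] (e : ℕ) {b c : Fin 4 → ZMod (p ^ k)}
    (hc : ∀ i, c i * b i = 1) : (critSet p k e c).card ≤ p ^ k * (4 * p ^ e) ^ 2 := by
  classical
  set u : Fin 4 → (ZMod (p ^ k))ˣ := fun i => ⟨c i, b i, hc i, by rw [mul_comm]; exact hc i⟩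
  have hu : ∀ i, c i = u i := fun i => rfl
  have h := card_quad_le (critSet p k e c)
    (fun a y => ((p ^ e : ℕ) : ZMod (p ^ k)) * (u 1 * ((y⁻¹ : (ZMod (p ^ k))ˣ) : ZMod (p ^ k)) ^ 2 -
      c 0 * ((a⁻¹ : (ZMod (p ^ k))ˣ) : ZMod (p ^ k)) ^ 2) = 0)
    (fun a y => ((p ^ e : ℕ) : ZMod (p ^ k)) * (u 2 * ((y⁻¹ : (ZMod (p ^ k))ˣ) : ZMod (p ^ k)) ^ 2 -
      c 0 * ((a⁻¹ : (ZMod (p ^ k))ˣ) : ZMod (p ^ k)) ^ 2) = 0) (A := 4 * p ^ e)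
    ?_ ?_ ?_ ?_ ?_
  · refine h.trans (Nat.mul_le_mul_right _ ?_)
    rw [ZMod.card_units_eq_totient]
    exact Nat.totient_le _
  · intro x hx y hy h0 h1 h2
    have h3 := mem_unitZeroSum.1 (mem_filter.1 hx).1
    have h4 := mem_unitZeroSum.1 (mem_filter.1 hy).1
    rw [Fin.sum_univ_four] at h3 h4
    rw [h0, h1, h2] at h3
    exact Units.ext (by linear_combination h3 - h4)
  · exact fun x hx => (mem_filter.1 hx).2 1
  · exact fun x hx => (mem_filter.1 hx).2 2
  · exact fun a => card_unit_sq_le e (u 1) _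
  · exact fun a => card_unit_sq_le e (u 2) _

lemma norm_localSum_le {R : Type*} [CommRing R] [Fintype R] [DecidableEq R] (ψ : AddChar R ℂ)
    (c : Fin 4 → R) (a : R) (x : Fin 4 → Rˣ) : ‖localSum ψ c a x‖ ≤ (zeroSum R).card :=
  norm_sum_addChar_le ψ _ _

lemma exists_localSum_ne_zero {R : Type*} [CommRing R] [Fintype R] [DecidableEq R]
    {ψ : AddChar R ℂ} {c : Fin 4 → R} {a : R} (ha : a ^ 3 = 0) (h : Sig ψ c ≠ 0) :
    ∃ x ∈ unitZeroSum R, localSum ψ c a x ≠ 0 := by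
  by_contra! hne
  have := card_mul_Sig ψ c ha
  rw [sum_eq_zero (fun x hx => by rw [hne x hx, mul_zero]), mul_eq_zero] at this
  refine this.elim (fun h0 => ?_) h
  have h1 : (zeroSum R).card = 0 := by exact_mod_cast h0
  rw [card_eq_zero] at h1
  exact absurd (mem_zeroSum.2 (by simp) : (0 : Fin 4 → R) ∈ zeroSum R) (by rw [h1]; simp)

section Square

variable [hp : Fact p.Prime] {e m : ℕ} {ψ : AddChar (ZMod (p ^ k)) ℂ} {b : Fin 4 → ℕ}
  {c : Fin 4 → ZMod (p ^ k)}

lemma mem_critSet_of_sq (hψ : ψ.IsPrimitive) (he : k ≤ 2 * e) {x : Fin 4 → (ZMod (p ^ k))ˣ}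
    (hx : x ∈ unitZeroSum (ZMod (p ^ k)))
    (h : localSum ψ c ((p ^ e : ℕ) : ZMod (p ^ k)) x ≠ 0) : x ∈ critSet p k e c := by
  refine mem_filter.2 ⟨hx, fun i => ?_⟩
  have ha : ((p ^ e : ℕ) : ZMod (p ^ k)) ^ 2 * 1 = 0 := by
    rw [mul_one, ← Nat.cast_pow, ZMod.natCast_eq_zero_iff, ← pow_mul]
    exact pow_dvd_pow _ (by omega)
  have := linear_of_localSum_ne_zero hψ ha h i
  rwa [mul_one] at this

lemma norm_Sig_le_of_sq (hψ : ψ.IsPrimitive) (hc : ∀ i, c i * (b i : ZMod (p ^ k)) = 1)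
    (he : k ≤ 2 * e) : ‖Sig ψ c‖ ≤ 16 * (p : ℝ) ^ (k + 2 * e) := by
  have ha : ((p ^ e : ℕ) : ZMod (p ^ k)) ^ 3 = 0 := by
    rw [← Nat.cast_pow, ZMod.natCast_eq_zero_iff, ← pow_mul]
    exact pow_dvd_pow _ (by omega)
  refine (norm_Sig_le_of_localSum ψ c ha (M := 1) (fun x => ?_) (critSet p k e c)
    (fun x hx h => mem_critSet_of_sq hψ he hx h)).trans ?_
  · rw [mul_one]; exact norm_localSum_le _ _ _ _
  · rw [mul_one]
    have h1 : ((critSet p k e c).card : ℝ) ≤ ((p ^ k * (4 * p ^ e) ^ 2 : ℕ) : ℝ) := by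
      exact_mod_cast card_critSet_le e hc
    refine h1.trans (le_of_eq ?_)
    push_cast
    ring

lemma condB_of_sq (hψ : ψ.IsPrimitive) (hc : ∀ i, c i * (b i : ZMod (p ^ k)) = 1)
    (he : k ≤ 2 * e) (hm : m + e = k) (h : Sig ψ c ≠ 0) :
    CondB (fun i => (b i : ZMod (p ^ m))) := by
  have ha : ((p ^ e : ℕ) : ZMod (p ^ k)) ^ 3 = 0 := by
    rw [← Nat.cast_pow, ZMod.natCast_eq_zero_iff, ← pow_mul]
    exact pow_dvd_pow _ (by omega)
  obtain ⟨x, hx, hne⟩ := exists_localSum_ne_zero ha h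
  have hcrit := (mem_filter.1 (mem_critSet_of_sq hψ he hx hne)).2
  have hd : p ^ m ∣ p ^ k := pow_dvd_pow _ (by omega)
  set F := ZMod.castHom hd (ZMod (p ^ m))
  have hF : ∀ i, F (c i) * F (((x i)⁻¹ : (ZMod (p ^ k))ˣ) : ZMod (p ^ k)) ^ 2 =
      F (c 0) * F (((x 0)⁻¹ : (ZMod (p ^ k))ˣ) : ZMod (p ^ k)) ^ 2 := fun i => by
    have := castHom_eq_zero hm hd (hcrit i)
    rw [map_sub, map_mul, map_mul, map_pow, map_pow, sub_eq_zero] at this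
    exact this
  have hcb : ∀ i, F (c i) * (b i : ZMod (p ^ m)) = 1 := fun i => by
    have := congrArg F (hc i)
    rwa [map_mul, map_natCast, map_one] at this
  have hxi : ∀ i, F (x i : ZMod (p ^ k)) * F (((x i)⁻¹ : (ZMod (p ^ k))ˣ) : ZMod (p ^ k)) = 1 :=
    fun i => by rw [← map_mul, Units.mul_inv, map_one]
  refine ⟨fun i => Units.map F.toMonoidHom (x i), ?_, fun i => ?_⟩
  · have := congrArg F (mem_unitZeroSum.1 hx)
    rw [map_sum, map_zero] at this
    exact this
  · show (b i : ZMod (p ^ m)) * F (x i) ^ 2 = (b 0 : ZMod (p ^ m)) * F (x 0) ^ 2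
    have h1 := hF i
    have h2 := hcb i
    have h3 := hcb 0
    have h4 := hxi i
    have h5 := hxi 0
    set X := F (x i); set Y := F (x 0)
    set X' := F (((x i)⁻¹ : (ZMod (p ^ k))ˣ) : ZMod (p ^ k))
    set Y' := F (((x 0)⁻¹ : (ZMod (p ^ k))ˣ) : ZMod (p ^ k))
    have g : ∀ C B X X' : ZMod (p ^ m), C * B = 1 → X * X' = 1 → (C * X' ^ 2) * (B * X ^ 2) = 1 :=
      fun C B X X' hh1 hh2 => by linear_combination X' ^ 2 * X ^ 2 * hh1 + (1 + X * X') * hh2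
    have g1 := g _ _ _ _ h2 h4
    have g2 := g _ _ _ _ h3 h5
    linear_combination (b i : ZMod (p ^ m)) * X ^ 2 * (-1) * g2 +
      (b 0 : ZMod (p ^ m)) * Y ^ 2 * g1 - (b i : ZMod (p ^ m)) * X ^ 2 *
      (b 0 : ZMod (p ^ m)) * Y ^ 2 * h1

end Square

section Odd

variable [hp : Fact p.Prime] {j : ℕ} {ψ : AddChar (ZMod (p ^ k)) ℂ} {b : Fin 4 → ℕ}
  {c : Fin 4 → ZMod (p ^ k)}

lemma crit_of_odd (hψ : ψ.IsPrimitive) (hk : k = 2 * j + 1) {x : Fin 4 → (ZMod (p ^ k))ˣ}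
    (h : localSum ψ c ((p ^ j : ℕ) : ZMod (p ^ k)) x ≠ 0) (i : Fin 4) :
    ((p ^ (j + 1) : ℕ) : ZMod (p ^ k)) *
    (c i * (((x i)⁻¹ : (ZMod (p ^ k))ˣ) : ZMod (p ^ k)) ^ 2 -
      c 0 * (((x 0)⁻¹ : (ZMod (p ^ k))ˣ) : ZMod (p ^ k)) ^ 2) = 0 := by
  have ha : ((p ^ j : ℕ) : ZMod (p ^ k)) ^ 2 * (p : ZMod (p ^ k)) = 0 := by
    rw [← Nat.cast_pow, ← Nat.cast_mul, ZMod.natCast_eq_zero_iff, ← pow_mul, ← pow_succ]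
    exact pow_dvd_pow _ (by omega)
  have := linear_of_localSum_ne_zero hψ ha h i
  rwa [← Nat.cast_mul, ← pow_succ] at this

lemma norm_localSum_le_of_odd (hψ : ψ.IsPrimitive) (hc : ∀ i, c i * (b i : ZMod (p ^ k)) = 1)
    (hp2 : p ≠ 2) (hk : k = 2 * j + 1) (x : Fin 4 → (ZMod (p ^ k))ˣ) :
    ‖localSum ψ c ((p ^ j : ℕ) : ZMod (p ^ k)) x‖ ≤
      (zeroSum (ZMod (p ^ k))).card * (p : ℝ)⁻¹ := by
  classical
  set a := ((p ^ j : ℕ) : ZMod (p ^ k)) with ha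
  have h := norm_localSum_sq_le ψ hψ c a x
  set T := (zeroSum (ZMod (p ^ k))).filter (fun t => ∀ i, a ^ 2 * (2 * (c i *
      (((x i)⁻¹ : (ZMod (p ^ k))ˣ) : ZMod (p ^ k)) ^ 3 * t i)) =
      a ^ 2 * (2 * (c 0 * (((x 0)⁻¹ : (ZMod (p ^ k))ˣ) : ZMod (p ^ k)) ^ 3 * t 0))) with hT
  obtain ⟨i2, hi2⟩ : ∃ i2 : ZMod (p ^ k), 2 * i2 = 1 := by
    have : IsUnit ((2 : ℕ) : ZMod (p ^ k)) := by
      rw [ZMod.isUnit_iff_coprime]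
      exact Nat.Coprime.pow_right _ ((Nat.coprime_primes Nat.prime_two hp.out).2 (Ne.symm hp2))
    obtain ⟨u, hu⟩ := this
    exact ⟨(u⁻¹ : (ZMod (p ^ k))ˣ), by rw [← Nat.cast_two, ← hu, Units.mul_inv]⟩
  have hsol : ∀ (i : Fin 4) (w : ZMod (p ^ k)), ((univ : Finset (ZMod (p ^ k))).filter
      (fun s => a ^ 2 * (2 * (c i * (((x i)⁻¹ : (ZMod (p ^ k))ˣ) : ZMod (p ^ k)) ^ 3 * s)) =
        a ^ 2 * (2 * (c 0 * (((x 0)⁻¹ : (ZMod (p ^ k))ˣ) : ZMod (p ^ k)) ^ 3 * w)))).card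
      ≤ p ^ (2 * j) := by
    intro i w
    set V := (univ : Finset (ZMod (p ^ k))).filter
      (fun s => a ^ 2 * (2 * (c i * (((x i)⁻¹ : (ZMod (p ^ k))ˣ) : ZMod (p ^ k)) ^ 3 * s)) =
        a ^ 2 * (2 * (c 0 * (((x 0)⁻¹ : (ZMod (p ^ k))ˣ) : ZMod (p ^ k)) ^ 3 * w))) with hV
    rcases V.eq_empty_or_nonempty with h0 | ⟨s0, hs0⟩
    · rw [h0]; simp
    refine le_trans ?_ (card_annihilator_le (p ^ k) (p ^ (2 * j)) (pow_pos hp.out.pos _))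
    apply card_le_card_of_injOn (fun s => s - s0)
    · intro s hs
      have h1 := (mem_filter.1 hs).2
      have h2 := (mem_filter.1 hs0).2
      simp only [coe_filter, mem_univ, true_and, Set.mem_ofPred_eq]
      have e1 : ((p ^ (2 * j) : ℕ) : ZMod (p ^ k)) = a ^ 2 := by
        rw [ha]; push_cast; ring
      rw [e1]
      have hxi : (x i : ZMod (p ^ k)) * (((x i)⁻¹ : (ZMod (p ^ k))ˣ) : ZMod (p ^ k)) = 1 :=
        (x i).mul_inv
      set X := (((x i)⁻¹ : (ZMod (p ^ k))ˣ) : ZMod (p ^ k))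
      have e3 : 2 * (c i * X ^ 3) * (i2 * b i * (x i : ZMod (p ^ k)) ^ 3) = 1 := by
        have : (x i : ZMod (p ^ k)) ^ 3 * X ^ 3 = 1 := by rw [← mul_pow, hxi, one_pow]
        linear_combination c i * X ^ 3 * b i * (x i : ZMod (p ^ k)) ^ 3 * hi2 +
          X ^ 3 * (x i : ZMod (p ^ k)) ^ 3 * hc i + this
      linear_combination (i2 * b i * (x i : ZMod (p ^ k)) ^ 3) * (h1 - h2) - a ^ 2 * (s - s0) * e3
    · intro s _ s' _ hss
      simpa using hss
  have hTc : T.card ≤ p ^ k * (p ^ (2 * j)) ^ 2 := by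
    have := card_quad_le T
      (fun w s => a ^ 2 * (2 * (c 1 * (((x 1)⁻¹ : (ZMod (p ^ k))ˣ) : ZMod (p ^ k)) ^ 3 * s)) =
        a ^ 2 * (2 * (c 0 * (((x 0)⁻¹ : (ZMod (p ^ k))ˣ) : ZMod (p ^ k)) ^ 3 * w)))
      (fun w s => a ^ 2 * (2 * (c 2 * (((x 2)⁻¹ : (ZMod (p ^ k))ˣ) : ZMod (p ^ k)) ^ 3 * s)) =
        a ^ 2 * (2 * (c 0 * (((x 0)⁻¹ : (ZMod (p ^ k))ˣ) : ZMod (p ^ k)) ^ 3 * w)))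
      (A := p ^ (2 * j)) ?_ ?_ ?_ (hsol 1) (hsol 2)
    · rwa [ZMod.card] at this
    · intro x hx y hy h0 h1 h2
      have h3 := mem_zeroSum.1 (mem_filter.1 hx).1
      have h4 := mem_zeroSum.1 (mem_filter.1 hy).1
      rw [Fin.sum_univ_four] at h3 h4
      rw [h0, h1, h2] at h3
      linear_combination h3 - h4
    · exact fun t ht => (mem_filter.1 ht).2 1
    · exact fun t ht => (mem_filter.1 ht).2 2
  have hz : ((zeroSum (ZMod (p ^ k))).card : ℝ) = ((p : ℝ) ^ k) ^ 3 := by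
    rw [card_zeroSum, ZMod.card]; push_cast; rfl
  have hp0 : (0 : ℝ) < p := by exact_mod_cast hp.out.pos
  refine abs_le_of_sq_le_sq' ?_ (by positivity) |>.2
  refine h.trans ?_
  have hTr : (T.card : ℝ) ≤ (p : ℝ) ^ k * ((p : ℝ) ^ (2 * j)) ^ 2 := by exact_mod_cast hTc
  refine (mul_le_mul_of_nonneg_left hTr (by positivity)).trans (le_of_eq ?_)
  rw [hz, hk]
  field_simp
  ring

lemma norm_Sig_le_of_odd (hψ : ψ.IsPrimitive) (hc : ∀ i, c i * (b i : ZMod (p ^ k)) = 1)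
    (hp2 : p ≠ 2) (hk : k = 2 * j + 1) (hj : 1 ≤ j) : ‖Sig ψ c‖ ≤ 16 * (p : ℝ) ^ (2 * k) := by
  have ha : ((p ^ j : ℕ) : ZMod (p ^ k)) ^ 3 = 0 := by
    rw [← Nat.cast_pow, ZMod.natCast_eq_zero_iff, ← pow_mul]
    exact pow_dvd_pow _ (by omega)
  refine (norm_Sig_le_of_localSum ψ c ha (norm_localSum_le_of_odd hψ hc hp2 hk)
    (critSet p k (j + 1) c)
    (fun x hx h => mem_filter.2 ⟨hx, crit_of_odd hψ hk h⟩)).trans ?_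
  have hp0 : (0 : ℝ) < p := by exact_mod_cast hp.out.pos
  have h1 : ((critSet p k (j + 1) c).card : ℝ) ≤ ((p ^ k * (4 * p ^ (j + 1)) ^ 2 : ℕ) : ℝ) := by
    exact_mod_cast card_critSet_le (j + 1) hc
  refine (mul_le_mul_of_nonneg_right h1 (by positivity)).trans (le_of_eq ?_)
  push_cast
  have : (p : ℝ) ^ (2 * k) = (p : ℝ) ^ k * (p : ℝ) ^ (2 * j + 1) := by
    rw [← pow_add]; congr 1; omega
  rw [this]
  field_simp
  ring

lemma condB_of_odd (hψ : ψ.IsPrimitive) (hc : ∀ i, c i * (b i : ZMod (p ^ k)) = 1)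
    (hp2 : p ≠ 2) (hk : k = 2 * j + 1) (hj : 1 ≤ j) (h : Sig ψ c ≠ 0) :
    CondB (fun i => (b i : ZMod (p ^ (j + 1)))) := by
  have ha : ((p ^ j : ℕ) : ZMod (p ^ k)) ^ 3 = 0 := by
    rw [← Nat.cast_pow, ZMod.natCast_eq_zero_iff, ← pow_mul]
    exact pow_dvd_pow _ (by omega)
  obtain ⟨x, hx, hne⟩ := exists_localSum_ne_zero ha h
  have hx0 := mem_unitZeroSum.1 hx
  have hcrit := crit_of_odd hψ hk hne
  have hS := sum_inv_of_localSum_ne_zero hψ hx0 (fun i => by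
    have : ((p ^ j : ℕ) : ZMod (p ^ k)) ^ 2 = ((p ^ (j - 1) : ℕ) : ZMod (p ^ k)) *
        ((p ^ (j + 1) : ℕ) : ZMod (p ^ k)) := by
      rw [← Nat.cast_pow, ← Nat.cast_mul, ← pow_mul, ← pow_add]
      congr 2; omega
    rw [this, mul_assoc, hcrit i, mul_zero]) hne
  have hd : p ^ (j + 1) ∣ p ^ k := pow_dvd_pow _ (by omega)
  have hdj : p ^ j ∣ p ^ k := pow_dvd_pow _ (by omega)
  set F := ZMod.castHom hd (ZMod (p ^ (j + 1)))
  have hcb : ∀ i, F (c i) * (b i : ZMod (p ^ (j + 1))) = 1 := fun i => by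
    have := congrArg F (hc i)
    rwa [map_mul, map_natCast, map_one] at this
  obtain ⟨i2, hi2⟩ : ∃ i2 : ZMod (p ^ (j + 1)), i2 * 2 = 1 := by
    have : IsUnit ((2 : ℕ) : ZMod (p ^ (j + 1))) := by
      rw [ZMod.isUnit_iff_coprime]
      exact Nat.Coprime.pow_right _ ((Nat.coprime_primes Nat.prime_two hp.out).2 (Ne.symm hp2))
    obtain ⟨u, hu⟩ := this
    exact ⟨(u⁻¹ : (ZMod (p ^ (j + 1)))ˣ), by rw [← Nat.cast_two, ← hu, Units.inv_mul]⟩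
  refine condB_of_eq (x := fun i => Units.map F.toMonoidHom (x i)) hcb ?_ hi2 ?_ ?_
  · have := congrArg F hx0
    rw [map_sum, map_zero] at this
    exact this
  · intro i
    have h1 : ((p ^ (j + 1) : ℕ) : ZMod (p ^ k)) *
      (c i * (((x i)⁻¹ : (ZMod (p ^ k))ˣ) : ZMod (p ^ k)) ^ 2 -
      c 0 * (((x 0)⁻¹ : (ZMod (p ^ k))ˣ) : ZMod (p ^ k)) ^ 2) = 0 := hcrit i
    obtain ⟨n, hn⟩ := ZMod.natCast_zmod_surjective
      (c i * (((x i)⁻¹ : (ZMod (p ^ k))ˣ) : ZMod (p ^ k)) ^ 2 -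
      c 0 * (((x 0)⁻¹ : (ZMod (p ^ k))ˣ) : ZMod (p ^ k)) ^ 2)
    rw [← hn, ← Nat.cast_mul, ZMod.natCast_eq_zero_iff] at h1
    have h2 : p ^ j ∣ n := by
      have e : k = (j + 1) + j := by omega
      rw [e, pow_add] at h1
      exact Nat.dvd_of_mul_dvd_mul_left (pow_pos hp.out.pos _) h1
    have h3 := congrArg F hn
    rw [map_natCast, map_sub, map_mul, map_mul, map_pow, map_pow] at h3
    have h4 : (n : ZMod (p ^ (j + 1))) ^ 2 = 0 := by
      rw [← Nat.cast_pow, ZMod.natCast_eq_zero_iff]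
      refine dvd_trans ?_ (pow_dvd_pow_of_dvd h2 2)
      rw [← pow_mul]
      exact pow_dvd_pow _ (by omega)
    rw [h3] at h4
    exact h4
  · have := castHom_eq_zero (m := j + 1) (by omega) hd hS
    rw [map_sum] at this
    simp only [map_mul] at this
    exact this

end Odd

/-- The exponent of `p` in the modulus of the local solvability condition. -/
def halfExp (p k : ℕ) : ℕ := if p = 2 then k / 2 else (k + 1) / 2

lemma norm_Sig_primePow_le [hp : Fact p.Prime] (hk : 2 ≤ k) {ψ : AddChar (ZMod (p ^ k)) ℂ}
    (hψ : ψ.IsPrimitive) {b : Fin 4 → ℕ} {c : Fin 4 → ZMod (p ^ k)}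
    (hc : ∀ i, c i * (b i : ZMod (p ^ k)) = 1) : ‖Sig ψ c‖ ≤ 32 * ((p : ℝ) ^ k) ^ 2 := by
  have hp0 : (0 : ℝ) < p := by exact_mod_cast hp.out.pos
  rw [← pow_mul, mul_comm k 2]
  obtain ⟨j, hj⟩ := Nat.even_or_odd' k
  rcases hj with hj | hj
  · refine (norm_Sig_le_of_sq (e := j) hψ hc (by omega)).trans ?_
    rw [show k + 2 * j = 2 * k by omega]
    have : (0 : ℝ) < (p : ℝ) ^ (2 * k) := by positivity
    linarith
  · by_cases hp2 : p = 2
    · refine (norm_Sig_le_of_sq (e := j + 1) hψ hc (by omega)).trans ?_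
      rw [show k + 2 * (j + 1) = 2 * k + 1 by omega, pow_succ]
      have : (p : ℝ) = 2 := by exact_mod_cast hp2
      rw [this]
      linarith
    · refine (norm_Sig_le_of_odd hψ hc hp2 hj (by omega)).trans ?_
      have : (0 : ℝ) < (p : ℝ) ^ (2 * k) := by positivity
      linarith

lemma condB_of_Sig_ne_zero [hp : Fact p.Prime] (hk : 2 ≤ k) {ψ : AddChar (ZMod (p ^ k)) ℂ}
    (hψ : ψ.IsPrimitive) {b : Fin 4 → ℕ} {c : Fin 4 → ZMod (p ^ k)}
    (hc : ∀ i, c i * (b i : ZMod (p ^ k)) = 1) (h : Sig ψ c ≠ 0) :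
    CondB (fun i => (b i : ZMod (p ^ halfExp p k))) := by
  obtain ⟨j, hj⟩ := Nat.even_or_odd' k
  rcases hj with hj | hj
  · have : halfExp p k = j := by unfold halfExp; split_ifs <;> omega
    rw [this]
    exact condB_of_sq (e := j) hψ hc (by omega) (by omega) h
  · by_cases hp2 : p = 2
    · have : halfExp p k = j := by unfold halfExp; split_ifs; omega
      rw [this]
      exact condB_of_sq (e := j + 1) hψ hc (by omega) (by omega) h
    · have : halfExp p k = j + 1 := by unfold halfExp; split_ifs; omega
      rw [this]
      exact condB_of_odd hψ hc hp2 hj (by omega) h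

end

end AQK

namespace AQK

open Finset

section

variable {R : Type*} [CommRing R] [Fintype R] [DecidableEq R]

/-- The complete sum `∑ ψ(h x + n x⁻²)` over units. -/
noncomputable def unitSum (ψ : AddChar R ℂ) (h n : R) : ℂ :=
  ∑ x : Rˣ, ψ (h * x + n * ((x⁻¹ : Rˣ) : R) ^ 2)

/-- The quadratic exponential sum `∑ ψ(α u + β u²)`. -/
noncomputable def quadSum (ψ : AddChar R ℂ) (α β : R) : ℂ := ∑ u, ψ (α * u + β * u ^ 2)

omit [DecidableEq R] in
lemma norm_quadSum_le (ψ : AddChar R ℂ) (α β : R) : ‖quadSum ψ α β‖ ≤ Fintype.card R :=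
  norm_sum_addChar_le ψ univ _

lemma norm_quadSum_sq_le {ψ : AddChar R ℂ} (hψ : ψ.IsPrimitive) (α β : R) :
    ‖quadSum ψ α β‖ ^ 2 ≤ Fintype.card R * #{t : R | 2 * β * t = 0} := by
  have h1 : (quadSum ψ α β) * (starRingEnd ℂ) (quadSum ψ α β) =
      ∑ t : R, if 2 * β * t = 0 then Fintype.card R * ψ (α * t + β * t ^ 2) else 0 := by
    rw [quadSum, map_sum, sum_mul_sum, sum_comm]
    calc ∑ v, ∑ u, ψ (α * u + β * u ^ 2) * (starRingEnd ℂ) (ψ (α * v + β * v ^ 2))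
        = ∑ v, ∑ t, ψ (α * t + β * t ^ 2) * ψ (v * (2 * β * t)) := by
          refine sum_congr rfl fun v _ => ?_
          refine (Fintype.sum_equiv (Equiv.addRight v) _ _ fun t => ?_).symm
          rw [← AddChar.map_neg_eq_conj, ← AddChar.map_add_eq_mul, ← AddChar.map_add_eq_mul]
          congr 1
          simp only [Equiv.coe_addRight]
          ring
      _ = _ := by
          rw [sum_comm]
          refine sum_congr rfl fun t _ => ?_
          rw [← mul_sum, sum_primitive hψ]
          split_ifs <;> ring
  have h2 : ((‖quadSum ψ α β‖ ^ 2 : ℝ) : ℂ) = quadSum ψ α β * (starRingEnd ℂ) (quadSum ψ α β) := by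
    rw [Complex.mul_conj, Complex.normSq_eq_norm_sq]
  have h3 : ‖quadSum ψ α β‖ ^ 2 = ‖((‖quadSum ψ α β‖ ^ 2 : ℝ) : ℂ)‖ := by
    rw [Complex.norm_real, Real.norm_of_nonneg (by positivity)]
  rw [h3, h2, h1, ← sum_filter, ← mul_sum, norm_mul, Complex.norm_natCast]
  exact mul_le_mul_of_nonneg_left (norm_sum_addChar_le ψ _ _) (Nat.cast_nonneg _)

lemma mul_eq_zero_of_quadSum_ne_zero {ψ : AddChar R ℂ} (hψ : ψ.IsPrimitive) {α β z : R}
    (hz : β * z = 0) (h : quadSum ψ α β ≠ 0) : α * z = 0 := by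
  have key : ∀ w, ψ (w * (α * z)) = 1 := by
    intro w
    have h1 : quadSum ψ α β = ψ (w * (α * z)) * quadSum ψ α β := by
      conv_lhs => rw [quadSum]
      rw [quadSum, mul_sum]
      refine (Fintype.sum_equiv (Equiv.addRight (z * w)) _ _ fun t => ?_).symm
      rw [← AddChar.map_add_eq_mul]
      congr 1
      simp only [Equiv.coe_addRight]
      linear_combination (-2 * t * w - z * w ^ 2) * hz
    exact mul_right_cancel₀ h (by rw [← h1, one_mul])
  by_contra h0
  have h1 := sum_primitive hψ (α * z)
  rw [if_neg h0, sum_congr rfl fun w _ => key w] at h1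
  simp at h1

lemma card_mul_unitSum (ψ : AddChar R ℂ) (h n : R) {a : R} (ha : a ^ 3 = 0) :
    (Fintype.card R : ℂ) * unitSum ψ h n = ∑ x : Rˣ, ψ (h * x + n * ((x⁻¹ : Rˣ) : R) ^ 2) *
      quadSum ψ (a * (h - 2 * n * ((x⁻¹ : Rˣ) : R) ^ 3)) (a ^ 2 * (3 * n * ((x⁻¹ : Rˣ) : R) ^ 4)) := by
  have hn : ∀ u : R, IsNilpotent (a * u) := fun u => ⟨3, by rw [mul_pow, ha, zero_mul]⟩
  have h1 : ∀ u : R, unitSum ψ h n = ∑ x : Rˣ, ψ (h * (x + a * u) + n *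
      (((x⁻¹ : Rˣ) : R) ^ 2 - 2 * (a * u) * ((x⁻¹ : Rˣ) : R) ^ 3 +
        3 * (a * u) ^ 2 * ((x⁻¹ : Rˣ) : R) ^ 4)) := by
    intro u
    rw [unitSum]
    symm
    refine sum_bij' (fun x _ => unitShift x (hn u)) (fun x _ => unitShift x (hn (-u)))
      (fun _ _ => mem_univ _) (fun _ _ => mem_univ _) ?_ ?_ ?_
    · intro x _
      ext
      simp
    · intro x _
      ext
      simp
    · intro x _
      rw [unitShift_inv _ (hn u) (by rw [mul_pow, ha, zero_mul]), unitShift_val]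
      congr 1
      linear_combination (-n * u ^ 3 * (-2 * ((x⁻¹ : Rˣ) : R) ^ 5 +
        a * u * ((x⁻¹ : Rˣ) : R) ^ 6)) * ha
  calc (Fintype.card R : ℂ) * unitSum ψ h n = ∑ u : R, unitSum ψ h n := by
        rw [sum_const, nsmul_eq_mul, card_univ]
    _ = _ := by
        rw [sum_congr rfl fun u _ => h1 u, sum_comm]
        refine sum_congr rfl fun x _ => ?_
        rw [quadSum, mul_sum]
        refine sum_congr rfl fun u _ => ?_
        rw [← AddChar.map_add_eq_mul]
        congr 1
        ring

lemma norm_unitSum_le_of_quadSum (ψ : AddChar R ℂ) (h n : R) {a : R} (ha : a ^ 3 = 0) {M : ℝ}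
    (T : Finset Rˣ)
    (hT : ∀ x : Rˣ, quadSum ψ (a * (h - 2 * n * ((x⁻¹ : Rˣ) : R) ^ 3))
      (a ^ 2 * (3 * n * ((x⁻¹ : Rˣ) : R) ^ 4)) ≠ 0 → x ∈ T)
    (hM : ∀ x ∈ T, ‖quadSum ψ (a * (h - 2 * n * ((x⁻¹ : Rˣ) : R) ^ 3))
      (a ^ 2 * (3 * n * ((x⁻¹ : Rˣ) : R) ^ 4))‖ ≤ Fintype.card R * M) :
    ‖unitSum ψ h n‖ ≤ T.card * M := by
  have hpos : (0 : ℝ) < Fintype.card R := by exact_mod_cast Fintype.card_pos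
  have h1 : Fintype.card R * ‖unitSum ψ h n‖ ≤ T.card * (Fintype.card R * M) := by
    rw [← Complex.norm_natCast, ← norm_mul, card_mul_unitSum ψ h n ha, Complex.norm_natCast,
      ← nsmul_eq_mul, ← sum_subset (subset_univ T)]
    · refine (norm_sum_le _ _).trans (sum_le_card_nsmul _ _ _ fun x hx => ?_)
      rw [norm_mul, AddChar.norm_apply, one_mul]
      exact hM x hx
    · intro x _ hx
      rw [mul_eq_zero]
      right
      by_contra h2
      exact hx (hT x h2)
  have h2 : Fintype.card R * ‖unitSum ψ h n‖ ≤ Fintype.card R * (T.card * M) := by linarith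
  exact le_of_mul_le_mul_left h2 hpos

end

end AQK

namespace AQK

open Finset Polynomial UniqueFactorizationMonoid

section

variable (F : Type*) [Field F] [Finite F]

lemma finite_monic_natDegree (k : ℕ) : {g : F[X] | g.Monic ∧ g.natDegree = k}.Finite := by
  refine Set.Finite.of_injOn (f := fun g (i : Fin (k + 1)) => g.coeff i) (t := Set.univ)
    (fun _ _ => Set.mem_univ _) ?_ Set.finite_univ
  rintro g ⟨-, hg⟩ g' ⟨-, hg'⟩ h
  ext i
  by_cases hi : i < k + 1
  · exact congrFun h ⟨i, hi⟩
  · rw [coeff_eq_zero_of_natDegree_lt (by omega), coeff_eq_zero_of_natDegree_lt (by omega)]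

/-- The monic polynomials of degree `k` over a finite field. -/
noncomputable def monics (k : ℕ) : Finset F[X] := (finite_monic_natDegree F k).toFinset

open Classical in
/-- The monic irreducible polynomials of degree at most `k` over a finite field. -/
noncomputable def monicIrreds (k : ℕ) : Finset F[X] :=
  ((range (k + 1)).biUnion (monics F)).filter Irreducible

variable {F}

@[simp] lemma mem_monics {k : ℕ} {g : F[X]} : g ∈ monics F k ↔ g.Monic ∧ g.natDegree = k := by
  simp [monics]

@[simp] lemma mem_monicIrreds {k : ℕ} {g : F[X]} :
    g ∈ monicIrreds F k ↔ g.Monic ∧ g.natDegree ≤ k ∧ Irreducible g := by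
  simp only [monicIrreds, mem_filter, mem_biUnion, mem_range, mem_monics]
  constructor
  · rintro ⟨⟨a, ha, hg, rfl⟩, hi⟩
    exact ⟨hg, by omega, hi⟩
  · rintro ⟨hg, ha, hi⟩
    exact ⟨⟨_, by omega, hg, rfl⟩, hi⟩

open Classical in
lemma sum_natDegree_pow_dvd {k : ℕ} {g : F[X]} (hg : g ∈ monics F k) :
    ∑ P ∈ monicIrreds F k, ∑ a ∈ Icc 1 k, (if P ^ a ∣ g then P.natDegree else 0) = k := by
  obtain ⟨hm, hk⟩ := mem_monics.1 hg
  have hg0 := hm.ne_zero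
  have hdeg : (Multiset.map natDegree (normalizedFactors g)).sum = k := by
    have hmon : ∀ f ∈ normalizedFactors g, f.Monic := by
      intro f hf
      rw [← normalize_normalized_factor f hf]
      exact monic_normalize (irreducible_of_normalized_factor f hf).ne_zero
    rw [← natDegree_multiset_prod_of_monic _ hmon, prod_normalizedFactors_eq hg0,
      hm.normalize_eq_self, hk]
  have hinner : ∀ P ∈ monicIrreds F k,
      ∑ a ∈ Icc 1 k, (if P ^ a ∣ g then P.natDegree else 0) =
        (normalizedFactors g).count P * P.natDegree := by
    intro P hP
    obtain ⟨hPm, -, hPi⟩ := mem_monicIrreds.1 hP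
    have hcount := emultiplicity_eq_count_normalizedFactors hPi hg0
    rw [hPm.normalize_eq_self] at hcount
    have hiff : ∀ a, P ^ a ∣ g ↔ a ≤ (normalizedFactors g).count P := by
      intro a
      rw [pow_dvd_iff_le_emultiplicity, hcount]
      exact Nat.cast_le
    have hle : (normalizedFactors g).count P ≤ k := by
      have h1 := (hiff _).2 le_rfl
      have h2 := natDegree_le_of_dvd h1 hg0
      rw [natDegree_pow, hk] at h2
      have h3 := hPi.natDegree_pos
      nlinarith
    rw [← sum_filter, sum_const, smul_eq_mul]
    congr 1
    have : (Icc 1 k).filter (fun a => P ^ a ∣ g) = Icc 1 ((normalizedFactors g).count P) := by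
      ext a
      simp only [mem_filter, mem_Icc, hiff]
      omega
    rw [this, Nat.card_Icc]
    omega
  rw [sum_congr rfl hinner]
  rw [Finset.sum_multiset_map_count] at hdeg
  refine Eq.trans ?_ hdeg
  symm
  simp only [smul_eq_mul]
  refine sum_subset ?_ ?_
  · intro P hP
    rw [Multiset.mem_toFinset] at hP
    have hPi := irreducible_of_normalized_factor P hP
    refine mem_monicIrreds.2 ⟨?_, ?_, hPi⟩
    · rw [← normalize_normalized_factor P hP]
      exact monic_normalize hPi.ne_zero
    · rw [← hk]
      exact natDegree_le_of_dvd (dvd_of_mem_normalizedFactors hP) hg0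
  · intro P _ hP
    rw [Multiset.mem_toFinset] at hP
    rw [Multiset.count_eq_zero_of_notMem hP, zero_mul]

/-- The sum of a function over monic polynomials of given degree. -/
noncomputable def monicSum (χ : F[X] → ℂ) (k : ℕ) : ℂ := ∑ g ∈ monics F k, χ g

/-- The weighted sum of a function over prime powers of given degree. -/
noncomputable def primePowSum (χ : F[X] → ℂ) (j : ℕ) : ℂ :=
  ∑ P ∈ monicIrreds F j, ∑ a ∈ Icc 1 j, if a * P.natDegree = j then P.natDegree * χ P ^ a else 0

lemma monicSum_zero {χ : F[X] → ℂ} (h1 : χ 1 = 1) : monicSum χ 0 = 1 := by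
  have : monics F 0 = {1} := by
    ext g
    simp only [mem_monics, mem_singleton]
    constructor
    · rintro ⟨h, h0⟩
      exact h.natDegree_eq_zero.1 h0
    · rintro rfl
      exact ⟨monic_one, natDegree_one⟩
  rw [monicSum, this, sum_singleton, h1]

omit [Finite F] in
lemma map_pow_of_monic {χ : F[X] → ℂ} (h1 : χ 1 = 1)
    (hmul : ∀ f g : F[X], f.Monic → g.Monic → χ (f * g) = χ f * χ g) {P : F[X]} (hP : P.Monic)
    (a : ℕ) : χ (P ^ a) = χ P ^ a := by
  induction a with
  | zero => simp [h1]
  | succ a ih => rw [pow_succ, hmul _ _ (hP.pow a) hP, ih, pow_succ]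

open Classical in
lemma sum_monics_dvd {χ : F[X] → ℂ} (h1 : χ 1 = 1)
    (hmul : ∀ f g : F[X], f.Monic → g.Monic → χ (f * g) = χ f * χ g) {P : F[X]} (hP : P.Monic)
    (a k : ℕ) : ∑ g ∈ monics F k, (if P ^ a ∣ g then χ g else 0) =
      if a * P.natDegree ≤ k then χ P ^ a * monicSum χ (k - a * P.natDegree) else 0 := by
  have hPa := hP.pow a
  split_ifs with h
  · rw [← sum_filter, monicSum, mul_sum]
    symm
    refine sum_bij (fun g _ => P ^ a * g) ?_ ?_ ?_ ?_
    · intro g hg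
      obtain ⟨hgm, hgd⟩ := mem_monics.1 hg
      refine mem_filter.2 ⟨mem_monics.2 ⟨hPa.mul hgm, ?_⟩, dvd_mul_right _ _⟩
      rw [hPa.natDegree_mul hgm, natDegree_pow, hgd]
      omega
    · intro g _ g' _ hgg
      exact mul_left_cancel₀ hPa.ne_zero hgg
    · intro g hg
      obtain ⟨hg, f, rfl⟩ := mem_filter.1 hg
      obtain ⟨hgm, hgd⟩ := mem_monics.1 hg
      have hf := hPa.of_mul_monic_left hgm
      refine ⟨f, mem_monics.2 ⟨hf, ?_⟩, rfl⟩
      rw [hPa.natDegree_mul hf, natDegree_pow] at hgd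
      omega
    · intro g hg
      rw [hmul _ _ hPa (mem_monics.1 hg).1, map_pow_of_monic h1 hmul hP]
  · refine sum_eq_zero fun g hg => if_neg fun hd => h ?_
    obtain ⟨hgm, hgd⟩ := mem_monics.1 hg
    have := natDegree_le_of_dvd hd hgm.ne_zero
    rwa [natDegree_pow, hgd] at this

/-- The logarithmic derivative of the Euler product, coefficient by coefficient. -/
theorem mul_monicSum {χ : F[X] → ℂ} (h1 : χ 1 = 1)
    (hmul : ∀ f g : F[X], f.Monic → g.Monic → χ (f * g) = χ f * χ g) (k : ℕ) :
    k * monicSum χ k = ∑ j ∈ Icc 1 k, primePowSum χ j * monicSum χ (k - j) := by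
  classical
  have e1 : k * monicSum χ k = ∑ P ∈ monicIrreds F k, ∑ a ∈ Icc 1 k,
      (if a * P.natDegree ≤ k then
        P.natDegree * χ P ^ a * monicSum χ (k - a * P.natDegree) else 0) := by
    calc k * monicSum χ k = ∑ g ∈ monics F k, ∑ P ∈ monicIrreds F k, ∑ a ∈ Icc 1 k,
          P.natDegree * (if P ^ a ∣ g then χ g else 0) := by
          rw [monicSum, mul_sum]
          refine sum_congr rfl fun g hg => ?_
          have h2 := congrArg (Nat.cast : ℕ → ℂ) (sum_natDegree_pow_dvd hg)
          rw [← h2]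
          push_cast
          rw [sum_mul]
          refine sum_congr rfl fun P _ => ?_
          rw [sum_mul]
          refine sum_congr rfl fun a _ => ?_
          split_ifs <;> simp
      _ = _ := by
          rw [sum_comm]
          refine sum_congr rfl fun P hP => ?_
          rw [sum_comm]
          refine sum_congr rfl fun a _ => ?_
          rw [← mul_sum, sum_monics_dvd h1 hmul (mem_monicIrreds.1 hP).1]
          split_ifs <;> ring
  have e2 : ∀ j ∈ Icc 1 k, primePowSum χ j * monicSum χ (k - j) =
      ∑ P ∈ monicIrreds F k, ∑ a ∈ Icc 1 k, if a * P.natDegree = j then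
        P.natDegree * χ P ^ a * monicSum χ (k - a * P.natDegree) else 0 := by
    intro j hj
    rw [mem_Icc] at hj
    have e3 : primePowSum χ j = ∑ P ∈ monicIrreds F k, ∑ a ∈ Icc 1 k,
        if a * P.natDegree = j then P.natDegree * χ P ^ a else 0 := by
      rw [primePowSum]
      have : ∀ P ∈ monicIrreds F j, (∑ a ∈ Icc 1 j,
          if a * P.natDegree = j then P.natDegree * χ P ^ a else 0) = ∑ a ∈ Icc 1 k,
          if a * P.natDegree = j then P.natDegree * χ P ^ a else 0 := by
        intro P hP
        refine sum_subset (Icc_subset_Icc le_rfl hj.2) fun a ha ha' => if_neg fun h => ha' ?_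
        have := (mem_monicIrreds.1 hP).2.2.natDegree_pos
        rw [mem_Icc] at ha ⊢
        exact ⟨ha.1, by nlinarith⟩
      rw [sum_congr rfl this]
      refine sum_subset ?_ ?_
      · intro P hP
        obtain ⟨h3, h4, h5⟩ := mem_monicIrreds.1 hP
        exact mem_monicIrreds.2 ⟨h3, h4.trans hj.2, h5⟩
      · intro P hP hP'
        refine sum_eq_zero fun a ha => if_neg fun h => hP' ?_
        obtain ⟨h3, h4, h5⟩ := mem_monicIrreds.1 hP
        rw [mem_Icc] at ha
        exact mem_monicIrreds.2 ⟨h3, by nlinarith, h5⟩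
    rw [e3, sum_mul]
    refine sum_congr rfl fun P _ => ?_
    rw [sum_mul]
    refine sum_congr rfl fun a _ => ?_
    split_ifs with h
    · rw [h]
    · rw [zero_mul]
  rw [e1, sum_congr rfl e2]
  symm
  rw [sum_comm]
  refine sum_congr rfl fun P hP => ?_
  rw [sum_comm]
  refine sum_congr rfl fun a ha => ?_
  have h3 := (mem_monicIrreds.1 hP).2.2.natDegree_pos
  have h4 := (mem_Icc.1 ha).1
  have h5 : 1 ≤ a * P.natDegree := Nat.mul_pos h4 h3
  rw [Finset.sum_ite_eq]
  simp only [mem_Icc, h5, true_and]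

end

end AQK

namespace AQK

open Finset Polynomial

/-- For `g = ∏ (X - r)` with nonzero `r`, this is `∑ (h r + n r⁻²)`, written in terms of the
coefficients of `g`. -/
noncomputable def polyPhase {F : Type*} [Field F] (h n : F) (g : F[X]) : F :=
  -(h * g.nextCoeff) +
    n * ((g.coeff 1 / g.coeff 0) ^ 2 - 2 * (g.coeff 2 / g.coeff 0))

lemma polyPhase_one {F : Type*} [Field F] (h n : F) : polyPhase h n 1 = 0 := by
  have : (1 : F[X]).nextCoeff = 0 := by
    rw [← C_1, nextCoeff_C_eq_zero]
  simp [polyPhase, this, coeff_one]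

lemma polyPhase_mul {F : Type*} [Field F] (h n : F) {f g : F[X]} (hf : f.Monic) (hg : g.Monic)
    (hf0 : f.coeff 0 ≠ 0) (hg0 : g.coeff 0 ≠ 0) :
    polyPhase h n (f * g) = polyPhase h n f + polyPhase h n g := by
  have h2 : (f * g).coeff 2 =
      f.coeff 0 * g.coeff 2 + f.coeff 1 * g.coeff 1 + f.coeff 2 * g.coeff 0 := by
    rw [coeff_mul, Nat.sum_antidiagonal_eq_sum_range_succ_mk]
    simp [sum_range_succ]
  rw [polyPhase, hf.nextCoeff_mul hg, mul_coeff_zero, mul_coeff_one, h2, polyPhase, polyPhase]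
  field_simp
  ring

lemma polyPhase_X_sub_C {F : Type*} [Field F] (h n a : F) :
    polyPhase h n (X - C a) = h * a + n * (a⁻¹) ^ 2 := by
  have h2 : (X - C a).coeff 2 = 0 := by simp [coeff_X]
  rw [polyPhase, nextCoeff_X_sub_C, h2]
  simp

lemma polyPhase_multiset_prod {F : Type*} [Field F] (h n : F) (s : Multiset F)
    (hs : ∀ a ∈ s, a ≠ 0) :
    polyPhase h n (s.map fun a => X - C a).prod = (s.map fun a => h * a + n * (a⁻¹) ^ 2).sum := by
  induction s using Multiset.induction with
  | empty => simp [polyPhase_one]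
  | cons a s ih =>
    have hs' : ∀ b ∈ s, b ≠ 0 := fun b hb => hs b (Multiset.mem_cons_of_mem hb)
    have ha : a ≠ 0 := hs a (Multiset.mem_cons_self a s)
    rw [Multiset.map_cons, Multiset.prod_cons, polyPhase_mul, ih hs', polyPhase_X_sub_C,
      Multiset.map_cons, Multiset.sum_cons]
    · exact monic_X_sub_C a
    · exact monic_multisetProd_X_sub_C s
    · simpa using ha
    · rw [coeff_zero_eq_eval_zero, eval_multiset_prod]
      refine Multiset.prod_ne_zero fun h0 => ?_
      simp only [Multiset.map_map, Multiset.mem_map, Function.comp_apply] at h0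
      obtain ⟨b, hb, h1⟩ := h0
      exact hs' b hb (by simpa using h1)

lemma polyPhase_map {F K : Type*} [Field F] [Field K] (φ : F →+* K) (h n : F) (g : F[X]) :
    polyPhase (φ h) (φ n) (g.map φ) = φ (polyPhase h n g) := by
  simp [polyPhase, nextCoeff_map φ.injective, map_ofNat φ 2]

open Classical in
/-- The completely multiplicative function on monic polynomials attached to `ψ (h x + n x⁻²)`. -/
noncomputable def polyChar {F : Type*} [Field F] (ψ : AddChar F ℂ) (h n : F) (g : F[X]) : ℂ :=
  if g.coeff 0 = 0 then 0 else ψ (polyPhase h n g)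

lemma polyChar_one {F : Type*} [Field F] (ψ : AddChar F ℂ) (h n : F) : polyChar ψ h n 1 = 1 := by
  simp [polyChar, polyPhase_one]

lemma polyChar_mul {F : Type*} [Field F] (ψ : AddChar F ℂ) (h n : F) (f g : F[X]) (hf : f.Monic)
    (hg : g.Monic) : polyChar ψ h n (f * g) = polyChar ψ h n f * polyChar ψ h n g := by
  simp only [polyChar, mul_coeff_zero, mul_eq_zero]
  by_cases h1 : f.coeff 0 = 0
  · simp [h1]
  by_cases h2 : g.coeff 0 = 0
  · simp [h2]
  simp [h1, h2, polyPhase_mul h n hf hg h1 h2, AddChar.map_add_eq_mul]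

lemma monicSum_polyChar_eq_zero {F : Type*} [Field F] [Fintype F] {ψ : AddChar F ℂ}
    (hψ : ψ.IsPrimitive) {h : F} (hh : h ≠ 0) (n : F) {k : ℕ} (hk : 4 ≤ k) :
    monicSum (polyChar ψ h n) k = 0 := by
  classical
  obtain ⟨t, ht⟩ : ∃ t, ψ (-(h * t)) ≠ 1 := by
    have h1 := hψ (neg_ne_zero.2 hh)
    obtain ⟨t, ht⟩ := (AddChar.ne_one_iff).1 h1
    exact ⟨t, by simpa [AddChar.mulShift_apply] using ht⟩
  have key : monicSum (polyChar ψ h n) k = ψ (-(h * t)) * monicSum (polyChar ψ h n) k := by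
    rw [monicSum, mul_sum]
    have hdeg : ∀ (s : F) {g : F[X]}, g ∈ monics F k → g + C s * X ^ (k - 1) ∈ monics F k := by
      intro s g hg
      obtain ⟨hm, hd⟩ := mem_monics.1 hg
      have hlt : (C s * X ^ (k - 1)).degree < g.degree := by
        rw [degree_eq_natDegree hm.ne_zero, hd]
        refine (degree_C_mul_X_pow_le _ _).trans_lt ?_
        exact_mod_cast (by omega : k - 1 < k)
      exact mem_monics.2 ⟨hm.add_of_left hlt, by
        rw [natDegree_add_eq_left_of_degree_lt hlt, hd]⟩
    symm
    refine sum_bij' (fun g _ => g + C t * X ^ (k - 1)) (fun g _ => g + C (-t) * X ^ (k - 1))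
      (fun g hg => hdeg t hg) (fun g hg => hdeg (-t) hg) ?_ ?_ ?_
    · intro g _
      simp
    · intro g _
      simp
    · intro g hg
      obtain ⟨hm, hd⟩ := mem_monics.1 hg
      obtain ⟨hm', hd'⟩ := mem_monics.1 (hdeg t hg)
      have hc : ∀ i, i < k - 1 → (g + C t * X ^ (k - 1)).coeff i = g.coeff i := by
        intro i hi
        rw [coeff_add, coeff_C_mul_X_pow, if_neg (by omega), add_zero]
      have hnext : (g + C t * X ^ (k - 1)).nextCoeff = g.nextCoeff + t := by
        rw [nextCoeff_of_natDegree_pos (by omega), nextCoeff_of_natDegree_pos (by omega), hd, hd',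
          coeff_add, coeff_C_mul_X_pow, if_pos rfl]
      simp only [polyChar, polyPhase, hc 0 (by omega), hc 1 (by omega), hc 2 (by omega), hnext]
      split_ifs
      · simp
      · rw [← AddChar.map_add_eq_mul]
        congr 1
        ring
  have h2 : (1 - ψ (-(h * t))) * monicSum (polyChar ψ h n) k = 0 := by
    rw [sub_mul, ← key]
    ring
  rcases mul_eq_zero.1 h2 with h3 | h3
  · exact absurd (sub_eq_zero.1 h3).symm ht
  · exact h3

end AQK

namespace AQK

open Polynomial Finset

/-- A homogeneous linear system with more unknowns than equations has a nonzero solution. -/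
lemma exists_ne_zero_of_card_lt {F ι κ : Type*} [Field F] [Fintype ι] [Fintype κ]
    (L : κ → ((ι → F) →ₗ[F] F)) (h : Fintype.card κ < Fintype.card ι) :
    ∃ v : ι → F, v ≠ 0 ∧ ∀ k, L k v = 0 := by
  have h1 : (LinearMap.ker (LinearMap.pi L)) ≠ ⊥ := by
    apply LinearMap.ker_ne_bot_of_finrank_lt
    simpa using h
  obtain ⟨v, hv, hv0⟩ := Submodule.exists_mem_ne_zero_of_ne_bot h1
  refine ⟨v, hv0, fun k => ?_⟩
  have := congrFun (LinearMap.mem_ker.1 hv) k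
  simpa using this

/-- The polynomial with prescribed list of coefficients. -/
noncomputable def polyOf {F : Type*} [Field F] (d : ℕ) : (Fin d → F) →ₗ[F] F[X] where
  toFun v := ∑ e : Fin d, C (v e) * X ^ (e : ℕ)
  map_add' u v := by simp [add_mul, sum_add_distrib]
  map_smul' c v := by simp [smul_eq_C_mul, mul_sum, mul_assoc]

lemma polyOf_coeff {F : Type*} [Field F] {d : ℕ} (v : Fin d → F) (e : Fin d) :
    (polyOf d v).coeff e = v e := by
  simp only [polyOf, LinearMap.coe_mk, AddHom.coe_mk, finsetSum_coeff, coeff_C_mul_X_pow]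
  rw [sum_eq_single e]
  · simp
  · intro b _ hb
    rw [if_neg]
    intro h
    exact hb (Fin.ext h.symm)
  · simp

lemma polyOf_natDegree {F : Type*} [Field F] {d : ℕ} (v : Fin d → F) :
    (polyOf d v).natDegree ≤ d - 1 := by
  show (∑ e : Fin d, C (v e) * X ^ (e : ℕ)).natDegree ≤ d - 1
  apply natDegree_sum_le_of_forall_le
  intro e _
  refine (natDegree_C_mul_X_pow_le _ _).trans ?_
  omega

lemma polyOf_eq_zero {F : Type*} [Field F] {d : ℕ} {v : Fin d → F} (h : polyOf d v = 0) :
    v = 0 := by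
  ext e
  rw [← polyOf_coeff v e, h]
  simp

/-- A nonzero polynomial of degree at most `D` that vanishes to order at least `l` on `S`. -/
lemma card_mul_le_natDegree {F : Type*} [Field F] [DecidableEq F] {φ : F[X]} (h0 : φ ≠ 0)
    (S : Finset F) (l : ℕ) (h : ∀ x ∈ S, l ≤ φ.rootMultiplicity x) :
    S.card * l ≤ φ.natDegree := by
  rcases Nat.eq_zero_or_pos l with rfl | hl
  · simp
  calc S.card * l = ∑ x ∈ S, l := by simp
    _ ≤ ∑ x ∈ S, φ.roots.count x := by
        apply sum_le_sum
        intro x hx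
        rw [count_roots]
        exact h x hx
    _ ≤ ∑ x ∈ φ.roots.toFinset, φ.roots.count x := by
        apply sum_le_sum_of_subset
        intro x hx
        rw [Multiset.mem_toFinset, mem_roots h0, ← rootMultiplicity_pos h0]
        exact lt_of_lt_of_le hl (h x hx)
    _ = Multiset.card φ.roots := Multiset.toFinset_sum_count_eq _
    _ ≤ φ.natDegree := card_roots' φ

end AQK

namespace AQK

open Finset Polynomial

section

variable {K : Type*} [Field K] {p : ℕ} [hp : Fact p.Prime]

/-- `∑_{i<μ} (h x^{p^i} + n x^{-2 p^i})`. -/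
def halfTrace (p μ : ℕ) (h n x : K) : K := ∑ i ∈ range μ, (h * x ^ p ^ i + n * (x⁻¹) ^ (2 * p ^ i))

/-- `X^{2 p^(μ-1)}` times the half trace. -/
noncomputable def halfTracePoly (p ν : ℕ) (h n : K) : K[X] :=
  ∑ i ∈ range (ν + 1), (C h * X ^ (p ^ i + 2 * p ^ ν) + C n * X ^ (2 * p ^ ν - 2 * p ^ i))

lemma eval_halfTracePoly (ν : ℕ) (h n : K) {x : K} (hx : x ≠ 0) :
    (halfTracePoly p ν h n).eval x = x ^ (2 * p ^ ν) * halfTrace p (ν + 1) h n x := by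
  rw [halfTracePoly, halfTrace, eval_finsetSum, mul_sum]
  apply sum_congr rfl
  intro i hi
  have hle : 2 * p ^ i ≤ 2 * p ^ ν :=
    Nat.mul_le_mul_left _ (Nat.pow_le_pow_right hp.out.pos (by simpa [Nat.lt_succ_iff] using hi))
  simp only [eval_add, eval_mul, eval_C, eval_pow, eval_X]
  have : x ^ (2 * p ^ ν) = x ^ (2 * p ^ ν - 2 * p ^ i) * x ^ (2 * p ^ i) := by
    rw [← pow_add, Nat.sub_add_cancel hle]
  have hinv : x ^ (2 * p ^ i) * (x⁻¹) ^ (2 * p ^ i) = 1 := by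
    rw [← mul_pow, mul_inv_cancel₀ hx, one_pow]
  rw [mul_add]
  congr 1
  · ring
  · rw [this]
    linear_combination -n * x ^ (2 * p ^ ν - 2 * p ^ i) * hinv

lemma natDegree_halfTracePoly (ν : ℕ) {h : K} (n : K) (hh : h ≠ 0) :
    (halfTracePoly p ν h n).natDegree = 3 * p ^ ν := by
  have hle : ∀ i ≤ ν, p ^ i ≤ p ^ ν := fun i hi => Nat.pow_le_pow_right hp.out.pos hi
  apply natDegree_eq_of_le_of_coeff_ne_zero
  · rw [halfTracePoly]
    apply natDegree_sum_le_of_forall_le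
    intro i hi
    have := hle i (by simpa [Nat.lt_succ_iff] using hi)
    refine (natDegree_add_le _ _).trans (max_le ?_ ?_)
    · exact (natDegree_C_mul_X_pow_le _ _).trans (by omega)
    · exact (natDegree_C_mul_X_pow_le _ _).trans (by omega)
  · rw [halfTracePoly, finsetSum_coeff, sum_eq_single ν]
    · have : ¬ (3 * p ^ ν = 2 * p ^ ν - 2 * p ^ ν) := by
        have := pow_pos hp.out.pos ν
        omega
      rw [coeff_add, coeff_C_mul_X_pow, coeff_C_mul_X_pow, if_neg this,
        if_pos (by ring), add_zero]
      exact hh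
    · intro i hi hne
      have h1 : p ^ i < p ^ ν := by
        apply Nat.pow_lt_pow_right hp.out.one_lt
        have := mem_range.1 hi
        omega
      rw [coeff_add, coeff_C_mul_X_pow, coeff_C_mul_X_pow, if_neg (by omega), if_neg (by omega),
        add_zero]
    · intro hν
      simp at hν

variable [Fintype K] [DecidableEq K] [CharP K p]

/-- Stepanov's method for `Tr(h x + n x⁻²) = t`, in the form of a half trace. -/
lemma card_halfTrace_le (ν : ℕ) (hcard : Fintype.card K = (p ^ (ν + 1)) ^ 2) {h : K} (n t : K)
    (hh : h ≠ 0) :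
    ((univ : Finset K).filter (fun x => x ≠ 0 ∧ halfTrace p (ν + 1) h n x +
      halfTrace p (ν + 1) h n x ^ p ^ (ν + 1) = t)).card ≤ p ^ (ν + 1) * (p ^ ν + 8) := by
  set s := p ^ (ν + 1) with hs
  set r := p ^ ν with hr
  have hsr : s = r * p := by rw [hs, hr, pow_succ]
  have hr1 : 1 ≤ r := Nat.one_le_iff_ne_zero.2 (pow_ne_zero _ hp.out.ne_zero)
  have hp2 := hp.out.two_le
  have hs2 : 2 * r ≤ s := by rw [hsr]; nlinarith
  set J := r + 6 with hJ
  set G := halfTracePoly p ν h n with hG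
  have hGd : G.natDegree = 3 * r := natDegree_halfTracePoly ν n hh
  have hG0 : G ≠ 0 := by
    intro h0; rw [h0, natDegree_zero] at hGd; omega
  set Q : Fin r × Fin J × Fin p → K[X] := fun ⟨i, j, l⟩ =>
    X ^ (s * i + j : ℕ) * (C t * X ^ (2 * r) - G) ^ (l : ℕ) * X ^ (2 * (p - 1 - l) * r) with hQ
  set Φ : Fin r × Fin J × Fin p → K[X] := fun ⟨i, j, l⟩ =>
    X ^ (i + s * j : ℕ) * G ^ (l : ℕ) * X ^ (2 * (p - 1 - l) * r) with hΦ
  set L : Fin (s * r + 2 * s + J) → ((Fin r × Fin J × Fin p → K) →ₗ[K] K) := fun k =>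
    (lcoeff K k) ∘ₗ (Fintype.linearCombination K Q) with hL
  have hcard2 : Fintype.card (Fin (s * r + 2 * s + J)) < Fintype.card (Fin r × Fin J × Fin p) := by
    simp only [Fintype.card_fin, Fintype.card_prod]
    have : r * (J * p) = s * J := by rw [hsr]; ring
    rw [this, hJ]
    nlinarith
  obtain ⟨v, hv0, hv⟩ := exists_ne_zero_of_card_lt L hcard2
  have hPv : ∑ k, v k • Q k = 0 := by
    ext m
    by_cases hm : m < s * r + 2 * s + J
    · have := hv ⟨m, hm⟩
      simpa [hL, Fintype.linearCombination_apply] using this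
    · rw [coeff_zero]
      apply coeff_eq_zero_of_natDegree_lt
      refine lt_of_le_of_lt (b := s * r + 2 * s + J - 1) ?_ (by omega)
      apply natDegree_sum_le_of_forall_le
      rintro ⟨i, j, l⟩ _
      refine (natDegree_smul_le _ _).trans ?_
      have e1 : (C t * X ^ (2 * r) - G).natDegree ≤ 3 * r := by
        refine (natDegree_sub_le _ _).trans (max_le ?_ hGd.le)
        exact (natDegree_C_mul_X_pow_le _ _).trans (by omega)
      have e2 : ((C t * X ^ (2 * r) - G) ^ (l : ℕ)).natDegree ≤ l * (3 * r) :=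
        natDegree_pow_le_of_le _ e1 |>.trans (le_of_eq (by ring))
      have hi := i.2
      have hj := j.2
      have hl := l.2
      have e3 : ((Q (i, j, l)).natDegree) ≤ (s * i + j) + l * (3 * r) + 2 * (p - 1 - l) * r := by
        rw [hQ]
        refine (natDegree_mul_le).trans (add_le_add ((natDegree_mul_le).trans
          (add_le_add (natDegree_X_pow_le _) e2)) (natDegree_X_pow_le _))
      refine e3.trans ?_
      obtain ⟨w, hw⟩ := Nat.exists_eq_add_of_lt hl
      have hpw : p - 1 - l = w := by omega
      rw [hpw]
      have h5 : s * (i : ℕ) + s ≤ s * r := by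
        rw [← Nat.mul_succ]; exact Nat.mul_le_mul_left _ hi
      have h6 : (l : ℕ) * (3 * r) + 2 * w * r + 3 * r ≤ 3 * s := by
        have : s = r * ((l : ℕ) + w + 1) := hsr.trans (congrArg (r * ·) hw)
        rw [this]; nlinarith
      omega
  set a : Fin r × Fin J × Fin p → K := fun k => v k ^ s with ha
  have has : ∀ k, a k ^ s = v k := fun k => by
    rw [ha]
    simp only
    rw [← pow_mul, ← pow_two, ← hcard, FiniteField.pow_card]
  set φ := ∑ k, a k • Φ k with hφ
  have hΦd : ∀ (i : Fin r) (j : Fin J) (l : Fin p),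
      (Φ (i, j, l)).natDegree = i + s * j + r * l + 2 * (p - 1) * r := by
    intro i j l
    have hl := l.2
    obtain ⟨w, hw⟩ := Nat.exists_eq_add_of_lt hl
    have hpw : p - 1 - l = w := by omega
    have hpw' : p - 1 = l + w := by omega
    rw [hΦ]
    simp only
    rw [natDegree_mul (mul_ne_zero (pow_ne_zero _ X_ne_zero) (pow_ne_zero _ hG0))
      (pow_ne_zero _ X_ne_zero), natDegree_mul (pow_ne_zero _ X_ne_zero) (pow_ne_zero _ hG0),
      natDegree_X_pow, natDegree_X_pow, natDegree_pow, hGd, hpw, hpw']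
    ring
  have hΦ0 : ∀ k, Φ k ≠ 0 := fun ⟨i, j, l⟩ =>
    mul_ne_zero (mul_ne_zero (pow_ne_zero _ X_ne_zero) (pow_ne_zero _ hG0))
      (pow_ne_zero _ X_ne_zero)
  have hinj : ∀ k k', (Φ k).natDegree = (Φ k').natDegree → k = k' := by
    rintro ⟨i, j, l⟩ ⟨i', j', l'⟩ hkk
    rw [hΦd, hΦd] at hkk
    have h1 : (i : ℕ) + r * (l + p * j) = i' + r * (l' + p * j') := by
      have e : ∀ x y z : ℕ, x + s * z + r * y = x + r * (y + p * z) := fun x y z => by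
        rw [hsr]; ring
      have := Nat.add_right_cancel hkk
      rwa [e, e] at this
    have h2 : (i : ℕ) = i' := by
      have := congrArg (· % r) h1
      simpa [Nat.add_mul_mod_self_left, Nat.mod_eq_of_lt i.2, Nat.mod_eq_of_lt i'.2] using this
    have h3 : (l : ℕ) + p * j = l' + p * j' := by
      rw [h2] at h1
      exact Nat.eq_of_mul_eq_mul_left (by omega) (Nat.add_left_cancel h1)
    have h4 : (l : ℕ) = l' := by
      have := congrArg (· % p) h3
      simpa [Nat.add_mul_mod_self_left, Nat.mod_eq_of_lt l.2, Nat.mod_eq_of_lt l'.2] using this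
    have h5 : (j : ℕ) = j' := by
      rw [h4] at h3
      exact Nat.eq_of_mul_eq_mul_left (by omega) (Nat.add_left_cancel h3)
    rw [Fin.ext h2, Fin.ext h4, Fin.ext h5]
  have hφ0 : φ ≠ 0 := by
    obtain ⟨k0, hk0⟩ : ∃ k, v k ≠ 0 := by
      by_contra! hne
      exact hv0 (funext hne)
    have ha0 : a k0 ≠ 0 := pow_ne_zero _ hk0
    have hdeg := degree_sum_eq_of_disjoint (fun k => a k • Φ k) univ (by
      rintro k ⟨_, hk⟩ k' ⟨_, hk'⟩ hne heq
      apply hne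
      apply hinj
      have hak : a k ≠ 0 := fun h0 => hk (by rw [h0, zero_smul])
      have hak' : a k' ≠ 0 := fun h0 => hk' (by rw [h0, zero_smul])
      have := natDegree_eq_of_degree_eq heq
      rwa [natDegree_smul _ hak, natDegree_smul _ hak'] at this)
    intro h0
    rw [← hφ, h0, degree_zero] at hdeg
    have h1 : degree (a k0 • Φ k0) ≤ ⊥ := by
      rw [hdeg]; exact le_sup (f := fun k => degree (a k • Φ k)) (mem_univ k0)
    rw [le_bot_iff, degree_eq_bot] at h1
    exact (smul_ne_zero ha0 (hΦ0 k0)) h1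
  have hφd : φ.natDegree ≤ s * (r + 8) := by
    apply natDegree_sum_le_of_forall_le
    rintro ⟨i, j, l⟩ _
    refine (natDegree_smul_le _ _).trans ?_
    rw [hΦd]
    have hi := i.2
    have hj := j.2
    have hl := l.2
    have h1 : s * (j : ℕ) + s ≤ s * J := by
      rw [← Nat.mul_succ]; exact Nat.mul_le_mul_left _ hj
    have h2 : r * (l : ℕ) + r ≤ s := by
      rw [← Nat.mul_succ, hsr]; exact Nat.mul_le_mul_left _ hl
    have h3 : 2 * (p - 1) * r ≤ 2 * s := by
      rw [hsr, mul_assoc, mul_comm r p]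
      exact Nat.mul_le_mul_left _ (Nat.mul_le_mul_right _ (by omega))
    have h4 : s * (r + 8) = s * J + 2 * s := by rw [hJ]; ring
    omega
  have hroot : ∀ x, (x ≠ 0 ∧ halfTrace p (ν + 1) h n x +
      halfTrace p (ν + 1) h n x ^ s = t) → φ.eval x = 0 := by
    rintro x ⟨hx, ht⟩
    set g := halfTrace p (ν + 1) h n x with hg
    have hGx : G.eval x = x ^ (2 * r) * g := eval_halfTracePoly ν h n hx
    have hgs : g ^ s = t - g := by rw [← ht]; ring
    have hxs : x ^ (s * s) = x := by rw [← pow_two, ← hcard, FiniteField.pow_card]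
    have hpow : (φ.eval x) ^ s * x ^ (2 * (p - 1) * r) = 0 := by
      rw [hφ, eval_finsetSum, hs, sum_pow_char_pow, ← hs, sum_mul]
      have hP := congrArg (fun P : K[X] => x ^ (2 * (p - 1) * r * s) * P.eval x) hPv
      simp only [eval_finsetSum, eval_zero, mul_zero, mul_sum] at hP
      rw [← hP]
      apply sum_congr rfl
      rintro ⟨i, j, l⟩ _
      have hl := l.2
      obtain ⟨w, hw⟩ := Nat.exists_eq_add_of_lt hl
      have hpw : p - 1 - l = w := by omega
      have hpw' : p - 1 = l + w := by omega
      rw [eval_smul, eval_smul, smul_eq_mul, smul_eq_mul, mul_pow, has]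
      simp only [hQ, hΦ, eval_mul, eval_pow, eval_X, eval_sub, eval_C, hGx, hpw', Nat.add_sub_cancel_left]
      have e1 : (x ^ ((i : ℕ) + s * j)) ^ s = x ^ (s * i + j : ℕ) := by
        calc (x ^ ((i : ℕ) + s * j)) ^ s = x ^ (s * i : ℕ) * (x ^ (s * s)) ^ (j : ℕ) := by
              rw [← pow_mul, ← pow_mul, ← pow_add]; congr 1; ring
          _ = _ := by rw [hxs, ← pow_add]
      have e2 : ((x ^ (2 * r) * g) ^ (l : ℕ)) ^ s = x ^ (2 * r * l * s) * (t - g) ^ (l : ℕ) := by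
        have gen : ∀ (X Y : K) (a b c : ℕ), ((X ^ a * Y) ^ b) ^ c = X ^ (a * b * c) * (Y ^ c) ^ b := by
          intros; ring
        rw [gen, hgs]
      have e3 : t * x ^ (2 * r) - x ^ (2 * r) * g = x ^ (2 * r) * (t - g) := by ring
      have gen : ∀ (A T y z : K) (r s l w : ℕ),
          y * (A * (z ^ (2 * r * l * s) * T ^ l) * (z ^ (2 * w * r)) ^ s) * z ^ (2 * (l + w) * r) =
          z ^ (2 * (l + w) * r * s) * (y * (A * (z ^ (2 * r) * T) ^ l * z ^ (2 * w * r))) := by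
        intros; ring
      rw [mul_pow, mul_pow, e1, e2, e3]
      exact gen _ _ _ _ _ _ _ _
    rcases mul_eq_zero.1 hpow with h1 | h1
    · exact pow_eq_zero_iff (by omega) |>.1 h1
    · exact absurd h1 (pow_ne_zero _ hx)
  refine le_trans ?_ hφd
  have := card_mul_le_natDegree hφ0 ((univ : Finset K).filter (fun x => x ≠ 0 ∧
    halfTrace p (ν + 1) h n x + halfTrace p (ν + 1) h n x ^ s = t)) 1 (fun x hx =>
    (rootMultiplicity_pos hφ0).2 (hroot x (mem_filter.1 hx).2))
  rwa [mul_one] at this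

end

end AQK

namespace AQK

open Finset Polynomial

section

variable {p : ℕ} [hp : Fact p.Prime]

/-- The sum `∑ ψ(Tr(h x + n x⁻²))` over the nonzero elements of an extension of `𝔽_p`. -/
noncomputable def traceSum (ψ : AddChar (ZMod p) ℂ) (h n : ZMod p) (K : Type*) [Field K]
    [Fintype K] [DecidableEq K] [Algebra (ZMod p) K] : ℂ :=
  ∑ x : K with x ≠ 0, ψ (Algebra.trace (ZMod p) K (algebraMap (ZMod p) K h * x +
    algebraMap (ZMod p) K n * (x⁻¹) ^ 2))

lemma algebraMap_trace_eq {K : Type*} [Field K] [Fintype K] [DecidableEq K] [Algebra (ZMod p) K]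
    (h n : ZMod p) (x : K) : algebraMap (ZMod p) K (Algebra.trace (ZMod p) K
      (algebraMap (ZMod p) K h * x + algebraMap (ZMod p) K n * (x⁻¹) ^ 2)) =
    ∑ i ∈ range (Module.finrank (ZMod p) K), (algebraMap (ZMod p) K h * x ^ p ^ i +
      algebraMap (ZMod p) K n * (x⁻¹) ^ (2 * p ^ i)) := by
  have : CharP K p := charP_of_injective_algebraMap (algebraMap (ZMod p) K).injective p
  rw [FiniteField.algebraMap_trace_eq_sum_pow, Nat.card_zmod]
  apply sum_congr rfl
  intro i _
  rw [add_pow_char_pow, mul_pow, mul_pow, ← map_pow, ← map_pow, ZMod.pow_card_pow,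
    ZMod.pow_card_pow, ← pow_mul]

lemma algebraMap_trace_eq_halfTrace {K : Type*} [Field K] [Fintype K] [DecidableEq K]
    [Algebra (ZMod p) K] {μ : ℕ} (hK : Module.finrank (ZMod p) K = 2 * μ)
    (h n : ZMod p) (x : K) : algebraMap (ZMod p) K (Algebra.trace (ZMod p) K
      (algebraMap (ZMod p) K h * x + algebraMap (ZMod p) K n * (x⁻¹) ^ 2)) =
    halfTrace p μ (algebraMap (ZMod p) K h) (algebraMap (ZMod p) K n) x +
      halfTrace p μ (algebraMap (ZMod p) K h) (algebraMap (ZMod p) K n) x ^ p ^ μ := by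
  have : CharP K p := charP_of_injective_algebraMap (algebraMap (ZMod p) K).injective p
  rw [algebraMap_trace_eq, hK, two_mul, sum_range_add, halfTrace, sum_pow_char_pow]
  congr 1
  apply sum_congr rfl
  intro i _
  rw [add_pow_char_pow, mul_pow, mul_pow, ← map_pow, ← map_pow, ZMod.pow_card_pow,
    ZMod.pow_card_pow, ← pow_mul, ← pow_mul, pow_add]
  congr 3 <;> ring

lemma norm_traceSum_le {ψ : AddChar (ZMod p) ℂ} (hψ : ψ.IsPrimitive) {h : ZMod p} (n : ZMod p)
    (hh : h ≠ 0) {K : Type*} [Field K] [Fintype K] [DecidableEq K] [Algebra (ZMod p) K] {μ : ℕ}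
    (hμ : μ ≠ 0) (hK : Module.finrank (ZMod p) K = 2 * μ) :
    ‖traceSum ψ h n K‖ ≤ 9 * (p : ℝ) * (p : ℝ) ^ μ := by
  have : CharP K p := charP_of_injective_algebraMap (algebraMap (ZMod p) K).injective p
  obtain ⟨ν, rfl⟩ := Nat.exists_eq_succ_of_ne_zero hμ
  have hcard : Fintype.card K = (p ^ (ν + 1)) ^ 2 := by
    rw [Module.card_eq_pow_finrank (K := ZMod p), ZMod.card, hK, ← pow_mul, mul_comm]
  set f : K → ZMod p := fun x => Algebra.trace (ZMod p) K (algebraMap (ZMod p) K h * x +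
    algebraMap (ZMod p) K n * (x⁻¹) ^ 2) with hf
  set N : ZMod p → ℕ := fun t => ((univ : Finset K).filter (fun x => x ≠ 0 ∧ f x = t)).card with hN
  set U : ℕ := p ^ (ν + 1) * (p ^ ν + 8) with hU
  have hNU : ∀ t, N t ≤ U := fun t => by
    refine le_trans (card_le_card ?_) (card_halfTrace_le ν hcard (algebraMap (ZMod p) K n)
      (algebraMap (ZMod p) K t) (h := algebraMap (ZMod p) K h) (by simpa using hh))
    intro x hx
    simp only [mem_filter, mem_univ, true_and] at hx ⊢
    refine ⟨hx.1, ?_⟩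
    rw [← hx.2, hf, algebraMap_trace_eq_halfTrace hK]
  have hsum : ∑ t, N t + 1 = (p ^ (ν + 1)) ^ 2 := by
    have h1 : ((univ : Finset K).filter (fun x => x ≠ 0)).card = ∑ t, N t := by
      rw [card_eq_sum_card_fiberwise (f := f) (t := univ) (fun _ _ => mem_coe.2 (mem_univ _))]
      simp only [hN, filter_filter]
    rw [← h1, filter_ne', card_erase_of_mem (mem_univ _), card_univ, hcard]
    exact Nat.sub_add_cancel (Nat.one_le_iff_ne_zero.2
      (pow_ne_zero _ (pow_ne_zero _ hp.out.ne_zero)))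
  have hψ0 : ∑ t, ψ t = 0 := by
    have := sum_primitive' hψ 1
    simpa using this
  have hS : traceSum ψ h n K = ∑ t, ((N t : ℂ) - U) * ψ t := by
    simp only [sub_mul, sum_sub_distrib, ← mul_sum, hψ0, mul_zero, sub_zero]
    rw [traceSum, ← sum_fiberwise (s := univ.filter (fun x : K => x ≠ 0)) (g := f)]
    apply sum_congr rfl
    intro t _
    rw [filter_filter, hN]
    simp only
    rw [← nsmul_eq_mul, ← sum_const]
    apply sum_congr rfl
    intro x hx
    rw [← (mem_filter.1 hx).2.2]
  rw [hS]
  calc ‖∑ t, ((N t : ℂ) - U) * ψ t‖ ≤ ∑ t, ((U : ℝ) - N t) := by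
        refine (norm_sum_le _ _).trans (sum_le_sum fun t _ => ?_)
        rw [norm_mul, AddChar.norm_apply, mul_one]
        have h1 : ((N t : ℂ) - U) = ((N t - U : ℝ) : ℂ) := by push_cast; rfl
        have h2 : (N t : ℝ) ≤ U := by exact_mod_cast hNU t
        rw [h1, Complex.norm_real, Real.norm_eq_abs, abs_sub_comm, abs_of_nonneg (by linarith)]
    _ = p * U - ∑ t, (N t : ℝ) := by
        rw [sum_sub_distrib, sum_const, card_univ, ZMod.card, nsmul_eq_mul]
    _ ≤ _ := by
        have h3 : ∑ t, (N t : ℝ) + 1 = ((p : ℝ) ^ (ν + 1)) ^ 2 := by exact_mod_cast hsum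
        have h4 : (U : ℝ) = (p : ℝ) ^ (ν + 1) * ((p : ℝ) ^ ν + 8) := by rw [hU]; push_cast; ring
        have h5 : (1 : ℝ) ≤ (p : ℝ) * (p : ℝ) ^ (ν + 1) := by
          rw [← pow_succ']
          exact one_le_pow₀ (by exact_mod_cast hp.out.one_le)
        rw [h4]
        have h6 : (p : ℝ) * ((p : ℝ) ^ (ν + 1) * ((p : ℝ) ^ ν + 8)) = ((p : ℝ) ^ (ν + 1)) ^ 2 +
            8 * ((p : ℝ) * (p : ℝ) ^ (ν + 1)) := by ring
        rw [h6, Nat.succ_eq_add_one]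
        linarith

end

end AQK

namespace AQK

open Finset Polynomial IntermediateField

section

variable {p : ℕ} [hp : Fact p.Prime]

/-- The trace from a simple extension in terms of the minimal polynomial. -/
lemma trace_eq_polyPhase {F L : Type*} [Field F] [Field L] [Algebra F L]
    [FiniteDimensional F L] [Algebra.IsSeparable F L] (pb : PowerBasis F L) (h n : F)
    (h0 : pb.gen ≠ 0) :
    Algebra.trace F L (algebraMap F L h * pb.gen + algebraMap F L n * (pb.gen⁻¹) ^ 2) =
      polyPhase h n (minpoly F pb.gen) := by
  classical
  have h_int : IsIntegral F pb.gen := Algebra.IsIntegral.isIntegral _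
  apply (algebraMap F (AlgebraicClosure F)).injective
  have hsplit : ((minpoly F pb.gen).map (algebraMap F (AlgebraicClosure F))).Splits :=
    IsAlgClosed.splits _
  rw [trace_eq_sum_embeddings (AlgebraicClosure F), ← polyPhase_map]
  have hprod := hsplit.eq_prod_roots_of_monic ((minpoly.monic h_int).map _)
  rw [hprod, polyPhase_multiset_prod]
  · rw [Fintype.sum_equiv pb.liftEquiv' _ (fun y => algebraMap F (AlgebraicClosure F) h * y.1 +
      algebraMap F (AlgebraicClosure F) n * (y.1⁻¹) ^ 2)]
    · rw [Finset.sum_mem_multiset _ _ (fun y : AlgebraicClosure F =>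
        algebraMap F (AlgebraicClosure F) h * y +
          algebraMap F (AlgebraicClosure F) n * (y⁻¹) ^ 2) (fun _ => rfl),
        Finset.sum_eq_multiset_sum, Multiset.toFinset_val, Multiset.dedup_eq_self.mpr]
      · exact nodup_roots ((separable_map _).mpr (Algebra.IsSeparable.isSeparable F _))
    · intro σ
      simp [PowerBasis.liftEquiv'_apply_coe]
  · intro a ha h1
    subst h1
    have h2 := (mem_roots'.1 ha).2
    rw [IsRoot, eval_map, ← aeval_def] at h2
    have h3 : (minpoly F pb.gen).coeff 0 = 0 := by
      have : (algebraMap F (AlgebraicClosure F)) ((minpoly F pb.gen).coeff 0) = 0 := by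
        simpa [aeval_def, eval₂_at_zero] using h2
      exact (map_eq_zero _).1 this
    exact h0 ((minpoly.coeff_zero_eq_zero h_int).1 h3)

lemma psi_trace_eq {F K : Type*} [Field F] [Field K] [Algebra F K]
    [FiniteDimensional F K] [Algebra.IsSeparable F K] (ψ : AddChar F ℂ) (h n : F) {x : K}
    (hx : x ≠ 0) {a : ℕ} (ha : a * (minpoly F x).natDegree = Module.finrank F K) :
    ψ (Algebra.trace F K (algebraMap F K h * x + algebraMap F K n * (x⁻¹) ^ 2)) =
      polyChar ψ h n (minpoly F x) ^ a := by
  have h_int : IsIntegral F x := Algebra.IsIntegral.isIntegral _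
  set pb := adjoin.powerBasis h_int
  have hgen : pb.gen = AdjoinSimple.gen F x := adjoin.powerBasis_gen h_int
  have hmin : minpoly F pb.gen = minpoly F x := by rw [hgen]; exact minpoly_gen F x
  have hg0 : pb.gen ≠ 0 := by
    intro h1
    apply hx
    rw [hgen] at h1
    rw [← AdjoinSimple.algebraMap_gen F x, h1, map_zero]
  have : Algebra.IsSeparable F F⟮x⟯ := Algebra.isSeparable_tower_bot_of_isSeparable F F⟮x⟯ K
  have e : algebraMap F K h * x + algebraMap F K n * (x⁻¹) ^ 2 = algebraMap F⟮x⟯ K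
      (algebraMap F F⟮x⟯ h * pb.gen + algebraMap F F⟮x⟯ n * (pb.gen⁻¹) ^ 2) := by
    rw [map_add, map_mul, map_mul, map_pow, map_inv₀, hgen, AdjoinSimple.algebraMap_gen,
      ← IsScalarTower.algebraMap_apply, ← IsScalarTower.algebraMap_apply]
  have hfin : Module.finrank F⟮x⟯ K = a := by
    have h1 := Module.finrank_mul_finrank F F⟮x⟯ K
    rw [adjoin.finrank h_int, ← ha, mul_comm] at h1
    exact Nat.eq_of_mul_eq_mul_right (minpoly.natDegree_pos h_int) h1
  rw [e, ← Algebra.trace_trace (S := F⟮x⟯), Algebra.trace_algebraMap, hfin, map_nsmul,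
    trace_eq_polyPhase pb h n hg0, hmin, AddChar.map_nsmul_eq_pow, polyChar, if_neg]
  rw [minpoly.coeff_zero_eq_zero h_int]
  exact hx

/-- The number of elements of a finite field with a given minimal polynomial. -/
lemma card_minpoly_eq {K : Type*} [Field K] [Fintype K] [Algebra (ZMod p) K]
    {P : (ZMod p)[X]} (hP : P.Monic) (hPi : Irreducible P)
    (hd : P.natDegree ∣ Module.finrank (ZMod p) K) [DecidablePred fun x : K => minpoly (ZMod p) x = P] :
    #{x : K | minpoly (ZMod p) x = P} = P.natDegree := by
  classical
  have hcard : Fintype.card K = p ^ Module.finrank (ZMod p) K := by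
    rw [Module.card_eq_pow_finrank (K := ZMod p), ZMod.card]
  have hdvd : P ∣ X ^ p ^ Module.finrank (ZMod p) K - X := by
    have := hPi.natDegree_dvd_iff_dvd_X_pow_card_pow_sub_X.1 hd
    rwa [Nat.card_zmod] at this
  have hsplit : (P.map (algebraMap (ZMod p) K)).Splits := by
    refine Splits.of_dvd (g := X ^ p ^ Module.finrank (ZMod p) K - X) ?_ ?_ ?_
    · rw [← hcard]
      exact splits_iff_card_roots.2 (by
        rw [FiniteField.roots_X_pow_card_sub_X, FiniteField.X_pow_card_sub_X_natDegree_eq K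
          Fintype.one_lt_card, ← Finset.card_def, Finset.card_univ])
    · exact FiniteField.X_pow_card_sub_X_ne_zero K (by
        rw [← hcard]; exact Fintype.one_lt_card)
    · simpa using Polynomial.map_dvd (algebraMap (ZMod p) K) hdvd
  rw [← card_rootSet_eq_natDegree (K := K) (PerfectField.separable_of_irreducible hPi) hsplit,
    ← Set.toFinset_card]
  congr 1
  ext x
  simp only [mem_filter, mem_univ, true_and, Set.mem_toFinset, mem_rootSet]
  constructor
  · rintro rfl
    exact ⟨hP.ne_zero, minpoly.aeval _ _⟩
  · rintro ⟨-, h1⟩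
    exact (minpoly.eq_of_irreducible_of_monic hPi h1 hP).symm

/-- Grouping the elements of an extension by minimal polynomial. -/
theorem traceSum_eq_primePowSum (ψ : AddChar (ZMod p) ℂ) (h n : ZMod p) {K : Type*} [Field K]
    [Fintype K] [DecidableEq K] [Algebra (ZMod p) K] {j : ℕ}
    (hj : Module.finrank (ZMod p) K = j) :
    traceSum ψ h n K = primePowSum (polyChar ψ h n) j := by
  classical
  have hmaps : ∀ x ∈ (univ : Finset K).filter (· ≠ 0),
      minpoly (ZMod p) x ∈ monicIrreds (ZMod p) j := by
    intro x _
    have h_int : IsIntegral (ZMod p) x := Algebra.IsIntegral.isIntegral _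
    refine mem_monicIrreds.2 ⟨minpoly.monic h_int, ?_, minpoly.irreducible h_int⟩
    rw [← hj]
    exact minpoly.natDegree_le x
  rw [traceSum, ← sum_fiberwise_of_maps_to hmaps, primePowSum]
  refine sum_congr rfl fun P hP => ?_
  obtain ⟨hPm, hPd, hPi⟩ := mem_monicIrreds.1 hP
  by_cases hd : P.natDegree ∣ j
  · obtain ⟨a, ha⟩ := hd
    have hjpos : 0 < j := by rw [← hj]; exact Module.finrank_pos
    have hapos : 0 < a := Nat.pos_of_mul_pos_left (ha ▸ hjpos)
    have hR : (∑ b ∈ Icc 1 j, if b * P.natDegree = j then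
        (P.natDegree : ℂ) * polyChar ψ h n P ^ b else 0) =
        P.natDegree * polyChar ψ h n P ^ a := by
      have hiff : ∀ b, b * P.natDegree = j ↔ b = a := by
        intro b
        rw [ha, mul_comm]
        exact Nat.mul_right_inj hPi.natDegree_pos.ne'
      simp only [hiff]
      rw [Finset.sum_ite_eq', if_pos]
      rw [mem_Icc, ha]
      exact ⟨hapos, Nat.le_mul_of_pos_left _ hPi.natDegree_pos⟩
    rw [hR]
    by_cases h0 : P.coeff 0 = 0
    · rw [polyChar, if_pos h0, zero_pow hapos.ne', mul_zero]
      refine sum_eq_zero fun x hx => ?_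
      simp only [mem_filter, mem_univ, true_and] at hx
      obtain ⟨hx0, rfl⟩ := hx
      exact absurd ((minpoly.coeff_zero_eq_zero (Algebra.IsIntegral.isIntegral x)).1 h0) hx0
    · rw [← card_minpoly_eq (K := K) hPm hPi (by rw [hj, ha]; exact dvd_mul_right _ _),
        ← nsmul_eq_mul, ← sum_const]
      refine sum_congr ?_ ?_
      · ext x
        simp only [mem_filter, mem_univ, true_and, and_iff_right_iff_imp]
        rintro rfl rfl
        simp at h0
      · intro x hx
        simp only [mem_filter, mem_univ, true_and] at hx
        subst hx
        rw [psi_trace_eq ψ h n (a := a) _ (by rw [hj, ha, mul_comm])]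
        rintro rfl
        simp at h0
  · rw [sum_eq_zero, sum_eq_zero]
    · intro a _
      exact if_neg fun h1 => hd ⟨a, by rw [← h1, mul_comm]⟩
    · intro x hx
      simp only [mem_filter, mem_univ, true_and] at hx
      refine absurd ?_ hd
      rw [← hj, ← hx.2]
      exact minpoly.degree_dvd (Algebra.IsIntegral.isIntegral x)

end

end AQK

namespace AQK

open Finset

lemma le_of_pow_le_mul_pow {a R C : ℝ} (hR : 0 ≤ R)
    (h : ∀ μ : ℕ, 1 ≤ μ → a ^ μ ≤ C * R ^ μ) : a ≤ R := by
  by_contra hlt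
  push Not at hlt
  rcases hR.eq_or_lt with rfl | hR
  · have := h 1 le_rfl
    simp at this
    linarith
  · have h1 : 1 < a / R := (one_lt_div hR).2 hlt
    obtain ⟨μ, hμ⟩ := pow_unbounded_of_one_lt C h1
    have h2 : a ^ (μ + 1) ≤ C * R ^ (μ + 1) := h (μ + 1) (by omega)
    rw [← div_le_iff₀ (by positivity), ← div_pow, pow_succ] at h2
    have h3 : 0 < (a / R) ^ μ := by positivity
    nlinarith

lemma norm_le_of_powerSum_le_aux {a b c : ℂ} {C R : ℝ} (hR : 0 ≤ R)
    (h : ∀ μ : ℕ, 1 ≤ μ → ‖a ^ μ + b ^ μ + c ^ μ‖ ≤ C * R ^ μ) : ‖a‖ ≤ R := by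
  rcases eq_or_ne a 0 with rfl | ha
  · simpa using hR
  obtain ⟨b', hb, hab⟩ : ∃ b' : ℂ, (b = a ∨ b = b') ∧ a ≠ b' := by
    by_cases hb : b = a
    · exact ⟨0, Or.inl hb, ha⟩
    · exact ⟨b, Or.inr rfl, Ne.symm hb⟩
  obtain ⟨c', hc, hac⟩ : ∃ c' : ℂ, (c = a ∨ c = c') ∧ a ≠ c' := by
    by_cases hc : c = a
    · exact ⟨0, Or.inl hc, ha⟩
    · exact ⟨c, Or.inr rfl, Ne.symm hc⟩
  set Q := (a - b') * (a - c') with hQ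
  have hQ0 : Q ≠ 0 := mul_ne_zero (sub_ne_zero.2 hab) (sub_ne_zero.2 hac)
  obtain ⟨m, hm, hkey⟩ : ∃ m : ℕ, 1 ≤ m ∧ ∀ μ : ℕ,
      (a ^ (μ + 2) + b ^ (μ + 2) + c ^ (μ + 2)) - (b' + c') * (a ^ (μ + 1) + b ^ (μ + 1) + c ^ (μ + 1))
        + b' * c' * (a ^ μ + b ^ μ + c ^ μ) = m * (Q * a ^ μ) := by
    rcases hb with rfl | rfl <;> rcases hc with rfl | rfl
    · exact ⟨3, by norm_num, fun μ => by rw [hQ]; push_cast; ring⟩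
    · exact ⟨2, by norm_num, fun μ => by rw [hQ]; push_cast; ring⟩
    · exact ⟨2, by norm_num, fun μ => by rw [hQ]; push_cast; ring⟩
    · exact ⟨1, by norm_num, fun μ => by rw [hQ]; push_cast; ring⟩
  refine le_of_pow_le_mul_pow hR
    (C := (C * R ^ 2 + ‖b' + c'‖ * (C * R) + ‖b' * c'‖ * C) / ‖Q‖) fun μ hμ => ?_
  have hQpos : 0 < ‖Q‖ := norm_pos_iff.2 hQ0
  rw [div_mul_eq_mul_div, le_div_iff₀ hQpos, ← norm_pow, ← norm_mul]
  calc ‖a ^ μ * Q‖ ≤ m * ‖a ^ μ * Q‖ :=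
        le_mul_of_one_le_left (norm_nonneg _) (by exact_mod_cast hm)
    _ = ‖(m : ℂ) * (Q * a ^ μ)‖ := by rw [norm_mul (m : ℂ), Complex.norm_natCast, mul_comm Q]
    _ ≤ C * R ^ (μ + 2) + ‖b' + c'‖ * (C * R ^ (μ + 1)) + ‖b' * c'‖ * (C * R ^ μ) := by
        rw [← hkey]
        refine (norm_add_le _ _).trans (add_le_add ((norm_sub_le _ _).trans (add_le_add
          (h _ (by omega)) ?_)) ?_)
        · rw [norm_mul]
          exact mul_le_mul_of_nonneg_left (h _ (by omega)) (norm_nonneg _)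
        · rw [norm_mul (b' * c')]
          exact mul_le_mul_of_nonneg_left (h _ hμ) (norm_nonneg _)
    _ = _ := by ring

lemma norm_le_of_powerSum_le {a b c : ℂ} {C R : ℝ} (hR : 0 ≤ R)
    (h : ∀ μ : ℕ, 1 ≤ μ → ‖a ^ μ + b ^ μ + c ^ μ‖ ≤ C * R ^ μ) : ‖a‖ ≤ R ∧ ‖b‖ ≤ R ∧ ‖c‖ ≤ R := by
  refine ⟨norm_le_of_powerSum_le_aux hR h, norm_le_of_powerSum_le_aux (C := C) (b := c) (c := a) hR ?_,
    norm_le_of_powerSum_le_aux (C := C) (b := a) (c := b) hR ?_⟩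
  · intro μ hμ
    convert h μ hμ using 2
    ring
  · intro μ hμ
    convert h μ hμ using 2
    ring

lemma exists_cubic_roots (A₁ A₂ A₃ : ℂ) : ∃ a b c : ℂ,
    a + b + c = -A₁ ∧ a * b + a * c + b * c = A₂ ∧ a * b * c = -A₃ := by
  obtain ⟨a, ha⟩ : ∃ a : ℂ, a ^ 3 + A₁ * a ^ 2 + A₂ * a + A₃ = 0 := by
    have hd : (Cubic.mk 1 A₁ A₂ A₃).toPoly.degree ≠ 0 := by
      rw [Cubic.degree_of_a_ne_zero (by simp)]
      norm_num
    obtain ⟨a, ha⟩ := IsAlgClosed.exists_root _ hd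
    refine ⟨a, ?_⟩
    simpa [Cubic.toPoly, Polynomial.IsRoot] using ha
  obtain ⟨s, hs⟩ := IsAlgClosed.exists_pow_nat_eq
    (((A₁ + a) ^ 2 - 4 * (A₂ + a * (A₁ + a))) : ℂ) (n := 2) (by norm_num)
  refine ⟨a, (-(A₁ + a) + s) / 2, (-(A₁ + a) - s) / 2, by ring, by linear_combination -hs / 4, ?_⟩
  linear_combination -a * hs / 4 + ha

/-- Newton's identities for a series whose coefficients vanish beyond degree `3`. -/
lemma newton_three {A S : ℕ → ℂ} (hA0 : A 0 = 1) (hA : ∀ k, 4 ≤ k → A k = 0)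
    (hrec : ∀ k : ℕ, k * A k = ∑ j ∈ Icc 1 k, S j * A (k - j)) {a b c : ℂ}
    (h1 : a + b + c = -A 1) (h2 : a * b + a * c + b * c = A 2) (h3 : a * b * c = -A 3)
    (k : ℕ) : S (k + 1) = -(a ^ (k + 1) + b ^ (k + 1) + c ^ (k + 1)) := by
  induction k using Nat.strong_induction_on with
  | _ k ih =>
    have r1 := hrec 1
    have r2 := hrec 2
    have r3 := hrec 3
    have i1 : Icc 1 1 = {1} := by decide
    have i2 : Icc 1 2 = {1, 2} := by decide
    have i3 : Icc 1 3 = {1, 2, 3} := by decide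
    rw [i1] at r1
    rw [i2] at r2
    rw [i3] at r3
    simp [hA0] at r1 r2 r3
    have hA1 : A 1 = -(a + b + c) := by rw [h1]; ring
    have hA3 : A 3 = -(a * b * c) := by rw [h3]; ring
    rw [hA1] at r1
    rw [← h2, hA1] at r2
    rw [hA3, ← h2, hA1] at r3
    match k, ih with
    | 0, _ => linear_combination -r1
    | 1, ih =>
      have s1 := ih 0 (by omega)
      simp only [zero_add, pow_one] at s1 ⊢
      rw [s1] at r2
      linear_combination -r2
    | 2, ih =>
      have s1 := ih 0 (by omega)
      have s2 := ih 1 (by omega)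
      simp only [zero_add, pow_one] at s1 s2 ⊢
      rw [s1, s2] at r3
      linear_combination -r3
    | k + 3, ih =>
      have s1 := ih k (by omega)
      have s2 := ih (k + 1) (by omega)
      have s3 := ih (k + 2) (by omega)
      have r := hrec (k + 4)
      rw [hA _ (by omega), mul_zero] at r
      have : ∑ j ∈ Icc 1 (k + 4), S j * A (k + 4 - j) =
          S (k + 1) * A 3 + S (k + 2) * A 2 + S (k + 3) * A 1 + S (k + 4) := by
        have hsub : ({k + 1, k + 2, k + 3, k + 4} : Finset ℕ) ⊆ Icc 1 (k + 4) := by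
          intro x hx
          simp at hx
          rw [mem_Icc]
          omega
        rw [← sum_subset hsub]
        · rw [sum_insert (by simp), sum_insert (by simp), sum_insert (by simp), sum_singleton]
          rw [show k + 4 - (k + 1) = 3 by omega, show k + 4 - (k + 2) = 2 by omega,
            show k + 4 - (k + 3) = 1 by omega, Nat.sub_self, hA0]
          ring
        · intro x hx hx'
          simp at hx'
          rw [mem_Icc] at hx
          rw [hA _ (by omega), mul_zero]
      rw [this, s1, s2] at r
      have s3' : S (k + 3) = _ := s3
      rw [s3'] at r
      rw [hA1, ← h2, hA3] at r
      linear_combination -r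

end AQK

namespace AQK

open Finset

/-- Weil's bound for the sum `∑ ψ(h x + n x⁻²)` over `𝔽_p`. -/
theorem norm_sum_prime_le {p : ℕ} [Fact p.Prime] {ψ : AddChar (ZMod p) ℂ} (hψ : ψ.IsPrimitive)
    {h : ZMod p} (hh : h ≠ 0) (n : ZMod p) :
    ‖∑ x : ZMod p with x ≠ 0, ψ (h * x + n * (x⁻¹) ^ 2)‖ ≤ 3 * √p := by
  classical
  set A := monicSum (polyChar ψ h n) with hA
  set S := primePowSum (polyChar ψ h n) with hS
  have hA0 : A 0 = 1 := monicSum_zero (polyChar_one ψ h n)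
  obtain ⟨a, b, c, h1, h2, h3⟩ := exists_cubic_roots (A 1) (A 2) (A 3)
  have newton := newton_three hA0 (fun k hk => monicSum_polyChar_eq_zero hψ hh n hk)
    (mul_monicSum (polyChar_one ψ h n) (polyChar_mul ψ h n)) h1 h2 h3
  have hpow : ∀ μ : ℕ, 1 ≤ μ → ‖(a ^ 2) ^ μ + (b ^ 2) ^ μ + (c ^ 2) ^ μ‖ ≤ 9 * p * (p : ℝ) ^ μ := by
    intro μ hμ
    have : Fintype (GaloisField p (2 * μ)) := Fintype.ofFinite _
    have hrank : Module.finrank (ZMod p) (GaloisField p (2 * μ)) = 2 * μ :=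
      GaloisField.finrank p (by omega)
    have hb := norm_traceSum_le hψ n hh (by omega : μ ≠ 0) hrank
    rw [traceSum_eq_primePowSum ψ h n hrank] at hb
    have hn := newton (2 * μ - 1)
    rw [Nat.sub_add_cancel (by omega)] at hn
    rw [hn, norm_neg] at hb
    simpa only [← pow_mul] using hb
  obtain ⟨ha, hb, hc⟩ := norm_le_of_powerSum_le (Nat.cast_nonneg p) hpow
  have hsqrt : ∀ z : ℂ, ‖z ^ 2‖ ≤ p → ‖z‖ ≤ √p := by
    intro z hz
    rw [norm_pow] at hz
    exact Real.le_sqrt_of_sq_le hz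
  have hW : ∑ x : ZMod p with x ≠ 0, ψ (h * x + n * (x⁻¹) ^ 2) = S 1 := by
    rw [hS, ← traceSum_eq_primePowSum ψ h n (K := ZMod p) (Module.finrank_self _), traceSum]
    refine sum_congr rfl fun x _ => ?_
    rw [Algebra.trace_self_apply]
    rfl
  rw [hW, show S 1 = _ from newton 0, norm_neg]
  simp only [zero_add, pow_one]
  calc ‖a + b + c‖ ≤ ‖a‖ + ‖b‖ + ‖c‖ := norm_add₃_le
    _ ≤ √p + √p + √p := by gcongr <;> exact hsqrt _ (by assumption)
    _ = _ := by ring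

end AQK

namespace AQK

open Finset

section

variable {p k : ℕ}

/-- Units solving `p ^ e (h - 2 n x⁻³) = 0`. -/
def cubicSet (p k e : ℕ) (h n : ZMod (p ^ k)) [NeZero (p ^ k)] : Finset (ZMod (p ^ k))ˣ :=
  univ.filter fun x => ((p ^ e : ℕ) : ZMod (p ^ k)) *
    (h - 2 * n * (((x⁻¹ : (ZMod (p ^ k))ˣ) : ZMod (p ^ k))) ^ 3) = 0

lemma card_units_le_of_sub {N D : ℕ} [NeZero N] (hD : 0 < D) (T : Finset (ZMod N)ˣ)
    (hT : ∀ x ∈ T, ∀ y ∈ T, (D : ZMod N) * ((x : ZMod N) - y) = 0) : T.card ≤ D := by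
  classical
  rcases T.eq_empty_or_nonempty with rfl | ⟨y, hy⟩
  · simp
  refine le_trans ?_ (card_annihilator_le N D hD)
  refine card_le_card_of_injOn (fun x => (x : ZMod N) - y) ?_ ?_
  · intro x hx
    simpa using hT x hx y hy
  · intro x _ x' _ h
    ext
    simpa using h

lemma card_cube_roots_le [Fact p.Prime] (hp2 : p ≠ 2) (m : ℕ) :
    #{z : (ZMod (p ^ m))ˣ | z ^ 3 = 1} ≤ 3 := by
  have := ZMod.isCyclic_units_of_prime_pow p (Fact.out) hp2 m
  exact IsCyclic.card_pow_eq_one_le (by norm_num)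

/-- Approximate cube roots of unity modulo an odd prime power. -/
lemma card_approx_cube_roots_le [hp : Fact p.Prime] (hp2 : p ≠ 2) {e : ℕ} (he : e ≤ k) :
    #{z : (ZMod (p ^ k))ˣ | ((p ^ e : ℕ) : ZMod (p ^ k)) * ((z : ZMod (p ^ k)) ^ 3 - 1) = 0} ≤
      3 * p ^ e := by
  classical
  have hd : p ^ (k - e) ∣ p ^ k := pow_dvd_pow p (by omega)
  set π := ZMod.castHom hd (ZMod (p ^ (k - e))) with hπ
  set T := univ.filter fun z : (ZMod (p ^ k))ˣ =>
    ((p ^ e : ℕ) : ZMod (p ^ k)) * ((z : ZMod (p ^ k)) ^ 3 - 1) = 0 with hT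
  have h1 : T.card ≤ p ^ e * (T.image (Units.map π.toMonoidHom)).card := by
    refine card_le_mul_card_image T _ fun w _ => ?_
    refine card_units_le_of_sub (pow_pos hp.out.pos e) _ fun x hx y hy => ?_
    have hx := (mem_filter.1 hx).2
    have hy := (mem_filter.1 hy).2
    have hxy : π ((x : ZMod (p ^ k)) - (y : ZMod (p ^ k))) = 0 := by
      rw [map_sub, sub_eq_zero]
      exact congrArg Units.val (hx.trans hy.symm)
    obtain ⟨N, hN⟩ := ZMod.intCast_surjective ((x : ZMod (p ^ k)) - (y : ZMod (p ^ k)))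
    rw [← hN, map_intCast, ZMod.intCast_zmod_eq_zero_iff_dvd] at hxy
    rw [← hN]
    have h3 : (((p ^ e : ℕ) : ZMod (p ^ k)) * (N : ZMod (p ^ k))) =
      (((p : ℤ) ^ e * N : ℤ) : ZMod (p ^ k)) := by push_cast; ring
    rw [h3, ZMod.intCast_zmod_eq_zero_iff_dvd]
    obtain ⟨c, rfl⟩ := hxy
    refine ⟨c, ?_⟩
    push_cast
    rw [← mul_assoc, ← pow_add, Nat.add_sub_cancel' he]
  have h2 : T.image (Units.map π.toMonoidHom) ⊆
      univ.filter fun z : (ZMod (p ^ (k - e)))ˣ => z ^ 3 = 1 := by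
    intro w hw
    obtain ⟨z, hz, rfl⟩ := mem_image.1 hw
    have hz := (mem_filter.1 hz).2
    have h3 := castHom_eq_zero (m := k - e) (by omega) hd hz
    refine mem_filter.2 ⟨mem_univ _, ?_⟩
    ext
    rw [map_sub, map_pow, map_one, sub_eq_zero] at h3
    rw [Units.val_pow_eq_pow_val, Units.coe_map, Units.val_one]
    exact h3
  calc T.card ≤ p ^ e * (T.image (Units.map π.toMonoidHom)).card := h1
    _ ≤ p ^ e * 3 := Nat.mul_le_mul_left _ ((card_le_card h2).trans (card_cube_roots_le hp2 _))
    _ = _ := by ring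

lemma isUnit_natCast_primePow [hp : Fact p.Prime] {h : ℕ} (hh : ¬ p ∣ h) :
    IsUnit (h : ZMod (p ^ k)) := by
  rw [ZMod.isUnit_iff_coprime]
  exact ((hp.out.coprime_iff_not_dvd).2 hh).symm.pow_right k

lemma not_dvd_of_mem_cubicSet [hp : Fact p.Prime] (hp2 : p ≠ 2) {e : ℕ} (he : e < k) {h n : ℕ}
    (hhn : ¬ (p ∣ h ∧ p ∣ n)) {x : (ZMod (p ^ k))ˣ} (hx : x ∈ cubicSet p k e h n) :
    ¬ p ∣ h ∧ ¬ p ∣ n := by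
  have h0 := (mem_filter.1 hx).2
  have hd : p ^ (k - e) ∣ p ^ k := pow_dvd_pow p (by omega)
  have h1 := castHom_eq_zero (m := k - e) (by omega) hd h0
  have hd' : p ∣ p ^ (k - e) := dvd_pow_self p (by omega)
  have h2 := congrArg (ZMod.castHom hd' (ZMod p)) h1
  simp only [map_sub, map_mul, map_pow, map_natCast, map_zero, map_ofNat] at h2
  set y := (ZMod.castHom hd' (ZMod p)) ((ZMod.castHom hd (ZMod (p ^ (k - e))))
    (((x⁻¹ : (ZMod (p ^ k))ˣ) : ZMod (p ^ k)))) with hy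
  have hyu : y ≠ 0 := by
    have : IsUnit y := (((x⁻¹).isUnit.map (ZMod.castHom hd (ZMod (p ^ (k - e)))))).map
      (ZMod.castHom hd' (ZMod p))
    exact this.ne_zero
  have h2p : (2 : ZMod p) ≠ 0 := by
    intro h
    have h3 : ((2 : ℕ) : ZMod p) = 0 := by exact_mod_cast h
    rw [ZMod.natCast_eq_zero_iff] at h3
    exact hp2 ((Nat.prime_dvd_prime_iff_eq hp.out Nat.prime_two).1 h3)
  rw [← ZMod.natCast_eq_zero_iff, ← ZMod.natCast_eq_zero_iff]
  rw [← ZMod.natCast_eq_zero_iff, ← ZMod.natCast_eq_zero_iff] at hhn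
  constructor
  · intro hh
    rw [hh, zero_sub, neg_eq_zero, mul_eq_zero, mul_eq_zero] at h2
    rcases h2 with (h2 | h2) | h2
    · exact h2p h2
    · exact hhn ⟨hh, h2⟩
    · exact hyu (pow_eq_zero_iff (by norm_num) |>.1 h2)
  · intro hn
    rw [hn, mul_zero, zero_mul, sub_zero] at h2
    exact hhn ⟨h2, hn⟩

lemma card_cubicSet_le [hp : Fact p.Prime] {e : ℕ} (he : e < k) {h n : ℕ}
    (hhn : ¬ (p ∣ h ∧ p ∣ n)) : (cubicSet p k e h n).card ≤ 3 * p ^ e := by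
  classical
  have hcube : ∀ x ∈ cubicSet p k e h n, ((p ^ e : ℕ) : ZMod (p ^ k)) *
      (h * (x : ZMod (p ^ k)) ^ 3 - 2 * n) = 0 := by
    intro x hx
    have h0 := (mem_filter.1 hx).2
    have hx1 : (x : ZMod (p ^ k)) * ((x⁻¹ : (ZMod (p ^ k))ˣ) : ZMod (p ^ k)) = 1 := x.mul_inv
    have hx3 : (x : ZMod (p ^ k)) ^ 3 * ((x⁻¹ : (ZMod (p ^ k))ˣ) : ZMod (p ^ k)) ^ 3 = 1 := by
      rw [← mul_pow, hx1, one_pow]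
    linear_combination (x : ZMod (p ^ k)) ^ 3 * h0 + ((p ^ e : ℕ) : ZMod (p ^ k)) * 2 * n * hx3
  rcases (cubicSet p k e h n).eq_empty_or_nonempty with h0 | ⟨y, hy⟩
  · rw [h0]
    simp
  have hyc := hcube y hy
  by_cases hp2 : p = 2
  · subst hp2
    refine le_trans (b := 2 ^ (e + 1)) ?_ (by rw [pow_succ]; omega)
    refine card_units_le_of_sub (by positivity) _ fun x hx y hy => ?_
    have hodd : ∀ m : ZMod (2 ^ k), IsUnit (2 * m + 1) := by
      intro m
      obtain ⟨a, rfl⟩ := ZMod.natCast_zmod_surjective m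
      have := isUnit_natCast_primePow (p := 2) (k := k) (h := 2 * a + 1) (by omega)
      simpa using this
    have hunit_odd : ∀ u : (ZMod (2 ^ k))ˣ, ∃ m, (u : ZMod (2 ^ k)) = 2 * m + 1 := by
      intro u
      obtain ⟨a, ha⟩ := ZMod.natCast_zmod_surjective (u : ZMod (2 ^ k))
      have h1 : IsUnit (a : ZMod (2 ^ k)) := ha ▸ u.isUnit
      rw [ZMod.isUnit_iff_coprime] at h1
      have h2 : Nat.Coprime a 2 := h1.coprime_dvd_right (dvd_pow_self 2 (by omega))
      have h3 : a % 2 = 1 := by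
        rcases Nat.mod_two_eq_zero_or_one a with h | h
        · exact absurd (h2.symm) (by rw [Nat.Prime.coprime_iff_not_dvd Nat.prime_two]; omega)
        · exact h
      refine ⟨((a / 2 : ℕ) : ZMod (2 ^ k)), ?_⟩
      rw [← ha]
      have : a = 2 * (a / 2) + 1 := by omega
      conv_lhs => rw [this]
      push_cast
      ring
    have hxc := hcube x hx
    have hyc := hcube y hy
    by_cases h4 : 4 ∣ h
    · obtain ⟨h', rfl⟩ := h4
      have hn : ¬ 2 ∣ n := fun hn => hhn ⟨⟨2 * h', by ring⟩, hn⟩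
      obtain ⟨n', hn'⟩ : ∃ n', n = 2 * n' + 1 := ⟨n / 2, by omega⟩
      have hu : IsUnit (2 * (h' * (x : ZMod (2 ^ k)) ^ 3 - n' - 1) + 1) := hodd _
      have : ((2 ^ (e + 1) : ℕ) : ZMod (2 ^ k)) * (2 * (h' * (x : ZMod (2 ^ k)) ^ 3 - n' - 1) + 1) = 0 := by
        rw [hn'] at hxc
        push_cast at hxc ⊢
        linear_combination hxc
      rw [hu.mul_left_eq_zero.1 this, zero_mul]
    · obtain ⟨m, hm⟩ := hunit_odd x
      obtain ⟨m', hm'⟩ := hunit_odd y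
      have hu : IsUnit (2 * (2 * m ^ 2 + 2 * m * m' + 2 * m' ^ 2 + 3 * m + 3 * m' + 1) + 1) := hodd _
      have hdiff : ((2 ^ e : ℕ) : ZMod (2 ^ k)) * h * ((x : ZMod (2 ^ k)) - y) = 0 := by
        apply hu.mul_left_eq_zero.1
        rw [hm] at hxc
        rw [hm'] at hyc
        rw [hm, hm']
        linear_combination hxc - hyc
      by_cases h2 : 2 ∣ h
      · obtain ⟨h', rfl⟩ := h2
        obtain ⟨a, rfl⟩ : ∃ a, h' = 2 * a + 1 := ⟨h' / 2, by omega⟩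
        apply (hodd a).mul_left_eq_zero.1
        push_cast at hdiff ⊢
        linear_combination hdiff
      · obtain ⟨a, rfl⟩ : ∃ a, h = 2 * a + 1 := ⟨h / 2, by omega⟩
        apply (hodd a).mul_left_eq_zero.1
        push_cast at hdiff ⊢
        linear_combination 2 * hdiff
  · obtain ⟨hh, -⟩ := not_dvd_of_mem_cubicSet hp2 he hhn hy
    have hu := isUnit_natCast_primePow (k := k) hh
    refine le_trans ?_ (card_approx_cube_roots_le hp2 he.le)
    refine card_le_card_of_injOn (fun x => x * y⁻¹) ?_ (fun x _ x' _ h => mul_right_cancel h)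
    intro x hx
    have hxc := hcube x hx
    simp only [coe_filter, mem_univ, true_and, Set.mem_ofPred_eq, Units.val_mul]
    apply hu.mul_left_eq_zero.1
    have hy1 : (y : ZMod (p ^ k)) * ((y⁻¹ : (ZMod (p ^ k))ˣ) : ZMod (p ^ k)) = 1 := y.mul_inv
    have hy3 : (y : ZMod (p ^ k)) ^ 3 * ((y⁻¹ : (ZMod (p ^ k))ˣ) : ZMod (p ^ k)) ^ 3 = 1 := by
      rw [← mul_pow, hy1, one_pow]
    linear_combination ((y⁻¹ : (ZMod (p ^ k))ˣ) : ZMod (p ^ k)) ^ 3 * (hxc - hyc) +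
      ((p ^ e : ℕ) : ZMod (p ^ k)) * h * hy3

end

end AQK

namespace AQK

open Finset

section

variable {p k : ℕ} [hp : Fact p.Prime]

lemma norm_unitSum_le_of_sq {ψ : AddChar (ZMod (p ^ k)) ℂ} (hψ : ψ.IsPrimitive) {e : ℕ}
    (he : k ≤ 2 * e) (hek : e < k) {h n : ℕ} (hhn : ¬ (p ∣ h ∧ p ∣ n)) :
    ‖unitSum ψ h n‖ ≤ 3 * (p : ℝ) ^ e := by
  have ha2 : ((p ^ e : ℕ) : ZMod (p ^ k)) ^ 2 = 0 := by
    rw [← Nat.cast_pow, ZMod.natCast_eq_zero_iff, ← pow_mul]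
    exact pow_dvd_pow p (by omega)
  have h1 := norm_unitSum_le_of_quadSum ψ (h : ZMod (p ^ k)) n (a := ((p ^ e : ℕ) : ZMod (p ^ k)))
    (by rw [pow_succ, ha2, zero_mul]) (M := 1) (cubicSet p k e h n) (fun x hx => ?_) (fun x _ => ?_)
  · refine h1.trans ?_
    rw [mul_one]
    exact_mod_cast card_cubicSet_le hek hhn
  · refine mem_filter.2 ⟨mem_univ _, ?_⟩
    have := mul_eq_zero_of_quadSum_ne_zero hψ (z := 1) (by rw [ha2, zero_mul, zero_mul]) hx
    rwa [mul_one] at this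
  · rw [mul_one]
    exact norm_quadSum_le _ _ _

lemma norm_unitSum_sq_le_of_odd {ψ : AddChar (ZMod (p ^ k)) ℂ} (hψ : ψ.IsPrimitive) {i : ℕ}
    (hi : 1 ≤ i) (hk : k = 2 * i + 1) (hp5 : 5 ≤ p) {h n : ℕ} (hhn : ¬ (p ∣ h ∧ p ∣ n)) :
    ‖unitSum ψ h n‖ ^ 2 ≤ 9 * (p : ℝ) ^ k := by
  have hp0 : (0 : ℝ) < p := by exact_mod_cast hp.out.pos
  have hcast : ∀ m : ℕ, k ≤ m → (p : ZMod (p ^ k)) ^ m = 0 := by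
    intro m hm
    rw [← Nat.cast_pow, ZMod.natCast_eq_zero_iff]
    exact pow_dvd_pow p hm
  set M : ℝ := √((p : ℝ) ^ (2 * i) / (p : ℝ) ^ k) with hM
  have hMsq : M ^ 2 = (p : ℝ) ^ (2 * i) / (p : ℝ) ^ k := Real.sq_sqrt (by positivity)
  have h1 := norm_unitSum_le_of_quadSum ψ (h : ZMod (p ^ k)) n (a := ((p ^ i : ℕ) : ZMod (p ^ k)))
    (by push_cast; rw [← pow_mul]; exact hcast _ (by omega)) (M := M)
    (cubicSet p k (i + 1) h n) (fun x hx => ?_) (fun x hx => ?_)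
  · have h2 : ‖unitSum ψ h n‖ ≤ 3 * (p : ℝ) ^ (i + 1) * M := by
      refine h1.trans (mul_le_mul_of_nonneg_right ?_ (Real.sqrt_nonneg _))
      exact_mod_cast card_cubicSet_le (by omega) hhn
    calc ‖unitSum ψ h n‖ ^ 2 ≤ (3 * (p : ℝ) ^ (i + 1) * M) ^ 2 :=
          pow_le_pow_left₀ (norm_nonneg _) h2 2
      _ = 9 * ((p : ℝ) ^ (i + 1)) ^ 2 * M ^ 2 := by ring
      _ = 9 * (p : ℝ) ^ k := by
          rw [hMsq, hk]
          field_simp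
          ring
  · refine mem_filter.2 ⟨mem_univ _, ?_⟩
    have := mul_eq_zero_of_quadSum_ne_zero hψ (z := (p : ZMod (p ^ k))) (by
      have := hcast (2 * i + 1) (by omega)
      push_cast
      linear_combination (3 * (n : ZMod (p ^ k)) *
        (((x⁻¹ : (ZMod (p ^ k))ˣ) : ZMod (p ^ k))) ^ 4) * this) hx
    push_cast at this ⊢
    linear_combination this
  · obtain ⟨-, hn⟩ := not_dvd_of_mem_cubicSet (by omega) (by omega) hhn hx
    have hpcard : (Fintype.card (ZMod (p ^ k)) : ℝ) = (p : ℝ) ^ k := by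
      rw [ZMod.card]; push_cast; rfl
    rw [hpcard]
    refine abs_le_of_sq_le_sq' ?_ (by positivity) |>.2
    rw [mul_pow, hMsq]
    refine (norm_quadSum_sq_le hψ _ _).trans ?_
    rw [hpcard]
    have hset : ((univ.filter fun t : ZMod (p ^ k) => 2 * (((p ^ i : ℕ) : ZMod (p ^ k)) ^ 2 *
        (3 * (n : ZMod (p ^ k)) * (((x⁻¹ : (ZMod (p ^ k))ˣ) : ZMod (p ^ k))) ^ 4)) * t = 0).card : ℝ)
        ≤ (p : ℝ) ^ (2 * i) := by
      have h3 := card_annihilator_le (p ^ k) (p ^ (2 * i)) (pow_pos hp.out.pos _)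
      refine (Nat.cast_le.2 ((card_le_card fun t ht => ?_).trans h3)).trans_eq (by push_cast; rfl)
      have ht := (mem_filter.1 ht).2
      refine mem_filter.2 ⟨mem_univ _, ?_⟩
      have hu : IsUnit ((6 * n : ℕ) : ZMod (p ^ k)) := by
        refine isUnit_natCast_primePow ?_
        rw [hp.out.dvd_mul, not_or]
        refine ⟨fun h6 => ?_, hn⟩
        have : p ∣ 2 * 3 := h6
        rcases (hp.out.dvd_mul).1 this with h | h
        · have := Nat.le_of_dvd (by norm_num) h; omega
        · have := Nat.le_of_dvd (by norm_num) h; omega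
      apply (hu.mul ((x⁻¹).isUnit.pow 4)).mul_left_eq_zero.1
      push_cast at ht ⊢
      linear_combination ht
    calc (p : ℝ) ^ k * _ ≤ (p : ℝ) ^ k * (p : ℝ) ^ (2 * i) := by gcongr
      _ = _ := by field_simp

lemma norm_unitSum_sq_le_of_prime {ψ : AddChar (ZMod p) ℂ} (hψ : ψ.IsPrimitive)
    {h n : ℕ} (hhn : ¬ (p ∣ h ∧ p ∣ n)) : ‖unitSum ψ h n‖ ^ 2 ≤ 9 * (p : ℝ) := by
  have hp2 : (2 : ℝ) ≤ p := by exact_mod_cast hp.out.two_le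
  by_cases hh : p ∣ h
  · have hn : ¬ p ∣ n := fun hn => hhn ⟨hh, hn⟩
    have h0 : (h : ZMod p) = 0 := (ZMod.natCast_eq_zero_iff _ _).2 hh
    have hn0 : (n : ZMod p) ≠ 0 := fun h => hn ((ZMod.natCast_eq_zero_iff _ _).1 h)
    have e1 : unitSum ψ (h : ZMod p) n = quadSum ψ 0 (n : ZMod p) - 1 := by
      rw [eq_sub_iff_add_eq, unitSum, quadSum,
        ← Fintype.sum_equiv (Equiv.inv (ZMod p)ˣ) (fun x => ψ (n * (x : ZMod p) ^ 2)) _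
          (fun x => by rw [h0, zero_mul, zero_add]; rfl)]
      rw [← add_sum_erase univ _ (mem_univ (0 : ZMod p)), add_comm]
      congr 1
      · simp
      · refine sum_bij (fun x _ => (x : ZMod p))
          (fun x _ => mem_erase.2 ⟨x.ne_zero, mem_univ _⟩) (fun _ _ _ _ h => Units.ext h)
          (fun y hy => ⟨Units.mk0 y (mem_erase.1 hy).1, mem_univ _, rfl⟩)
          (fun x _ => by rw [zero_mul, zero_add])
    have e2 : ‖quadSum ψ 0 (n : ZMod p)‖ ^ 2 ≤ 2 * p := by
      refine (norm_quadSum_sq_le hψ _ _).trans ?_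
      rw [ZMod.card, mul_comm]
      refine mul_le_mul_of_nonneg_right ?_ (by positivity)
      have h3 := card_annihilator_le p 2 (by norm_num)
      refine (Nat.cast_le.2 ((card_le_card fun t ht => ?_).trans h3)).trans_eq (by push_cast; rfl)
      have ht := (mem_filter.1 ht).2
      refine mem_filter.2 ⟨mem_univ _, ?_⟩
      apply (mul_eq_zero.1 (show (n : ZMod p) * (((2 : ℕ) : ZMod p) * t) = 0 from ?_)).resolve_left hn0
      push_cast
      linear_combination ht
    rw [e1]
    have e3 : ‖quadSum ψ 0 (n : ZMod p) - 1‖ ≤ ‖quadSum ψ 0 (n : ZMod p)‖ + 1 := by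
      refine (norm_sub_le _ _).trans ?_
      simp
    nlinarith [norm_nonneg (quadSum ψ 0 (n : ZMod p) - 1), norm_nonneg (quadSum ψ 0 (n : ZMod p)),
      sq_nonneg (‖quadSum ψ 0 (n : ZMod p)‖ - 1)]
  · have h0 : (h : ZMod p) ≠ 0 := fun h => hh ((ZMod.natCast_eq_zero_iff _ _).1 h)
    have e1 : unitSum ψ (h : ZMod p) n =
        ∑ x : ZMod p with x ≠ 0, ψ ((h : ZMod p) * x + n * (x⁻¹) ^ 2) := by
      rw [unitSum]
      refine sum_bij (fun x _ => (x : ZMod p))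
          (fun x _ => mem_filter.2 ⟨mem_univ _, x.ne_zero⟩) (fun _ _ _ _ h => Units.ext h)
          (fun y hy => ⟨Units.mk0 y (mem_filter.1 hy).2, mem_univ _, rfl⟩)
          (fun x _ => by rw [Units.val_inv_eq_inv_val])
    rw [e1]
    calc _ ≤ (3 * √p) ^ 2 := pow_le_pow_left₀ (norm_nonneg _) (norm_sum_prime_le hψ h0 n) 2
      _ = 9 * p := by rw [mul_pow, Real.sq_sqrt (by positivity)]; norm_num

lemma norm_unitSum_sq_le_of_coprime {ψ : AddChar (ZMod (p ^ k)) ℂ} (hψ : ψ.IsPrimitive)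
    (hk : 1 ≤ k) {h n : ℕ} (hhn : ¬ (p ∣ h ∧ p ∣ n)) :
    ‖unitSum ψ h n‖ ^ 2 ≤ 27 * (p : ℝ) ^ k := by
  have hp0 : (0 : ℝ) < p := by exact_mod_cast hp.out.pos
  rcases hk.eq_or_lt with rfl | hk
  · have key : ∀ N : ℕ, N = p → ∀ [NeZero N] (ψ : AddChar (ZMod N) ℂ), ψ.IsPrimitive →
        ‖unitSum ψ (h : ZMod N) n‖ ^ 2 ≤ 9 * (p : ℝ) := by
      rintro N rfl _ ψ hψ
      convert norm_unitSum_sq_le_of_prime hψ hhn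
    refine (key (p ^ 1) (pow_one p) ψ hψ).trans ?_
    rw [pow_one]
    linarith
  rcases Nat.even_or_odd' k with ⟨i, rfl | hi⟩
  · have h1 := norm_unitSum_le_of_sq hψ (e := i) le_rfl (by omega) hhn
    calc _ ≤ (3 * (p : ℝ) ^ i) ^ 2 := pow_le_pow_left₀ (norm_nonneg _) h1 2
      _ = 9 * (p : ℝ) ^ (2 * i) := by rw [mul_pow, ← pow_mul, mul_comm i]; norm_num
      _ ≤ _ := by gcongr; norm_num
  · by_cases hp5 : 5 ≤ p
    · refine (norm_unitSum_sq_le_of_odd hψ (by omega) hi hp5 hhn).trans ?_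
      gcongr
      norm_num
    · have hp3 : p ≤ 3 := by
        by_contra h3
        have : p = 4 := by omega
        exact absurd hp.out (by rw [this]; norm_num)
      have h1 := norm_unitSum_le_of_sq hψ (e := i + 1) (by omega) (by omega) hhn
      calc _ ≤ (3 * (p : ℝ) ^ (i + 1)) ^ 2 := pow_le_pow_left₀ (norm_nonneg _) h1 2
        _ = 9 * p * (p : ℝ) ^ k := by rw [hi]; ring
        _ ≤ 9 * 3 * (p : ℝ) ^ k := by gcongr; exact_mod_cast hp3
        _ = _ := by norm_num

end

end AQK

namespace AQK

open Finset

section Reduction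

variable {d d' g : ℕ}

/-- The additive map `ZMod d' → ZMod (g d')` induced by multiplication by `g`. -/
def mulHom (hd : d = g * d') : ZMod d' →+ ZMod d :=
  ZMod.lift d' ⟨zmultiplesHom (ZMod d) (g : ZMod d), by
    rw [zmultiplesHom_apply, natCast_zsmul, nsmul_eq_mul, ← Nat.cast_mul, mul_comm d' g, ← hd,
      ZMod.natCast_self]⟩

lemma mulHom_natCast (hd : d = g * d') (n : ℕ) : mulHom hd (n : ZMod d') = g * (n : ZMod d) := by
  have := ZMod.lift_coe d' ⟨zmultiplesHom (ZMod d) (g : ZMod d), by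
    rw [zmultiplesHom_apply, natCast_zsmul, nsmul_eq_mul, ← Nat.cast_mul, mul_comm d' g, ← hd,
      ZMod.natCast_self]⟩ (n : ℤ)
  rw [mulHom, ← Int.cast_natCast (R := ZMod d'), this]
  simp [mul_comm]

lemma mulHom_castHom [NeZero d] (hd : d = g * d') (hdvd : d' ∣ d) (x : ZMod d) :
    mulHom hd (ZMod.castHom hdvd (ZMod d') x) = g * x := by
  obtain ⟨n, rfl⟩ : ∃ n : ℕ, (n : ZMod d) = x := ⟨x.val, by simp⟩
  rw [map_natCast, mulHom_natCast]

lemma mulHom_injective [NeZero d] (hd : d = g * d') : Function.Injective (mulHom hd) := by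
  have hg : 0 < g := Nat.pos_of_ne_zero (by rintro rfl; exact NeZero.ne d (by rw [hd, zero_mul]))
  have hd' : d' ≠ 0 := by rintro rfl; exact NeZero.ne d (by rw [hd, mul_zero])
  have : NeZero d' := ⟨hd'⟩
  rw [injective_iff_map_eq_zero]
  intro y hy
  obtain ⟨n, rfl⟩ : ∃ n : ℕ, (n : ZMod d') = y := ⟨y.val, by simp⟩
  rw [mulHom_natCast, ← Nat.cast_mul, ZMod.natCast_eq_zero_iff, hd] at hy
  rw [ZMod.natCast_eq_zero_iff]
  exact (Nat.mul_dvd_mul_iff_left hg).1 hy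

lemma isPrimitive_mulHom [NeZero d] (hd : d = g * d') {ψ : AddChar (ZMod d) ℂ}
    (hψ : ψ.IsPrimitive) : (ψ.compAddMonoidHom (mulHom hd)).IsPrimitive := by
  have hdvd : d' ∣ d := ⟨g, by rw [hd, mul_comm]⟩
  intro a ha h1
  have ha' : mulHom hd a ≠ 0 := by
    rwa [Ne, map_eq_zero_iff _ (mulHom_injective hd)]
  refine hψ ha' ?_
  ext x
  obtain ⟨b, rfl⟩ := ZMod.castHom_surjective hdvd a
  have := DFunLike.congr_fun h1 (ZMod.castHom hdvd (ZMod d') x)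
  rw [AddChar.mulShift_apply, AddChar.one_apply, AddChar.compAddMonoidHom_apply, ← map_mul,
    mulHom_castHom] at this
  rw [AddChar.mulShift_apply, AddChar.one_apply, mulHom_castHom, mul_assoc, this]

lemma norm_unitSum_mul_le [NeZero d] [NeZero d'] (hd : d = g * d') (ψ : AddChar (ZMod d) ℂ)
    (h n : ℕ) : ‖unitSum ψ ((g * h : ℕ) : ZMod d) ((g * n : ℕ) : ZMod d)‖ ≤
      g * ‖unitSum (ψ.compAddMonoidHom (mulHom hd)) (h : ZMod d') n‖ := by
  classical
  have hdvd : d' ∣ d := ⟨g, by rw [hd, mul_comm]⟩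
  have hg : 0 < g := Nat.pos_of_ne_zero (by rintro rfl; exact NeZero.ne d (by rw [hd, zero_mul]))
  set F : (ZMod d')ˣ → ℂ := fun y => ψ.compAddMonoidHom (mulHom hd)
    ((h : ZMod d') * y + n * ((y⁻¹ : (ZMod d')ˣ) : ZMod d') ^ 2) with hF
  have h1 : unitSum ψ ((g * h : ℕ) : ZMod d) ((g * n : ℕ) : ZMod d) =
      ∑ x : (ZMod d)ˣ, F (ZMod.unitsMap hdvd x) := by
    refine sum_congr rfl fun x _ => ?_
    have e1 : ((ZMod.unitsMap hdvd x : (ZMod d')ˣ) : ZMod d') = ZMod.castHom hdvd (ZMod d') x := rfl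
    have e2 : (((ZMod.unitsMap hdvd x)⁻¹ : (ZMod d')ˣ) : ZMod d') =
      ZMod.castHom hdvd (ZMod d') ((x⁻¹ : (ZMod d)ˣ) : ZMod d) := by rw [← map_inv]; rfl
    rw [hF]
    simp only
    rw [e1, e2, AddChar.compAddMonoidHom_apply, ← map_natCast (ZMod.castHom hdvd (ZMod d')) h,
      ← map_natCast (ZMod.castHom hdvd (ZMod d')) n, ← map_pow, ← map_mul, ← map_mul, ← map_add,
      mulHom_castHom]
    push_cast
    congr 1
    ring
  have hsurj := ZMod.unitsMap_surjective hdvd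
  set K := #{x : (ZMod d)ˣ | ZMod.unitsMap hdvd x = 1} with hK
  have hKg : K ≤ g := by
    have := card_annihilator_le d g hg
    have hinj : Function.Injective fun x : (ZMod d)ˣ => ((x : ZMod d) - 1) :=
      fun x y hxy => Units.ext (sub_left_injective hxy)
    refine le_trans ?_ this
    rw [hK, ← card_image_of_injective _ hinj]
    refine card_le_card fun w hw => ?_
    obtain ⟨x, hx, rfl⟩ := mem_image.1 hw
    have hx := (mem_filter.1 hx).2
    refine mem_filter.2 ⟨mem_univ _, ?_⟩
    have e1 : ZMod.castHom hdvd (ZMod d') ((x : ZMod d) - 1) = 0 := by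
      rw [map_sub, map_one, sub_eq_zero]
      exact congrArg Units.val hx
    rw [← mulHom_castHom hd hdvd, e1, map_zero]
  have h2 : ∑ x : (ZMod d)ˣ, F (ZMod.unitsMap hdvd x) = K * ∑ y, F y := by
    rw [← sum_fiberwise_of_maps_to (s := univ) (t := univ) (g := ZMod.unitsMap hdvd)
      (fun _ _ => mem_univ _), mul_sum]
    refine sum_congr rfl fun y _ => ?_
    rw [sum_congr rfl (g := fun _ => F y) (fun x hx => by rw [(mem_filter.1 hx).2]), sum_const,
      nsmul_eq_mul, hK, MonoidHom.card_fiber_eq_of_mem_range (ZMod.unitsMap hdvd) (hsurj y) (hsurj 1)]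
  rw [h1, h2, norm_mul, Complex.norm_natCast]
  exact mul_le_mul_of_nonneg_right (by exact_mod_cast hKg) (norm_nonneg _)

end Reduction

section Product

variable {R R₁ R₂ : Type*} [CommRing R] [CommRing R₁] [CommRing R₂]

/-- The restriction of an additive character to the first factor of a product decomposition. -/
def charFst (e : R ≃+* R₁ × R₂) (ψ : AddChar R ℂ) : AddChar R₁ ℂ :=
  ψ.compAddMonoidHom ((e.symm : R₁ × R₂ →+ R).comp (AddMonoidHom.inl R₁ R₂))

/-- The restriction of an additive character to the second factor of a product decomposition. -/
def charSnd (e : R ≃+* R₁ × R₂) (ψ : AddChar R ℂ) : AddChar R₂ ℂ :=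
  ψ.compAddMonoidHom ((e.symm : R₁ × R₂ →+ R).comp (AddMonoidHom.inr R₁ R₂))

lemma charFst_apply (e : R ≃+* R₁ × R₂) (ψ : AddChar R ℂ) (x : R₁) :
    charFst e ψ x = ψ (e.symm (x, 0)) := rfl

lemma charSnd_apply (e : R ≃+* R₁ × R₂) (ψ : AddChar R ℂ) (x : R₂) :
    charSnd e ψ x = ψ (e.symm (0, x)) := rfl

lemma charFst_mul_charSnd (e : R ≃+* R₁ × R₂) (ψ : AddChar R ℂ) (x : R) :
    charFst e ψ (e x).1 * charSnd e ψ (e x).2 = ψ x := by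
  rw [charFst_apply, charSnd_apply, ← AddChar.map_add_eq_mul, ← map_add]
  simp

lemma isPrimitive_charFst (e : R ≃+* R₁ × R₂) {ψ : AddChar R ℂ} (hψ : ψ.IsPrimitive) :
    (charFst e ψ).IsPrimitive := by
  intro a ha h1
  have ha' : e.symm (a, 0) ≠ 0 := by
    rw [Ne, map_eq_zero_iff _ e.symm.injective, Prod.mk_eq_zero]
    exact fun h => ha h.1
  refine hψ ha' ?_
  ext x
  have := DFunLike.congr_fun h1 (e x).1
  rw [AddChar.mulShift_apply, AddChar.one_apply, charFst_apply] at this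
  rw [AddChar.mulShift_apply, AddChar.one_apply, ← this]
  congr 1
  apply e.injective
  rw [map_mul, e.apply_symm_apply, e.apply_symm_apply]
  ext <;> simp

lemma isPrimitive_charSnd (e : R ≃+* R₁ × R₂) {ψ : AddChar R ℂ} (hψ : ψ.IsPrimitive) :
    (charSnd e ψ).IsPrimitive := by
  intro a ha h1
  have ha' : e.symm (0, a) ≠ 0 := by
    rw [Ne, map_eq_zero_iff _ e.symm.injective, Prod.mk_eq_zero]
    exact fun h => ha h.2
  refine hψ ha' ?_
  ext x
  have := DFunLike.congr_fun h1 (e x).2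
  rw [AddChar.mulShift_apply, AddChar.one_apply, charSnd_apply] at this
  rw [AddChar.mulShift_apply, AddChar.one_apply, ← this]
  congr 1
  apply e.injective
  rw [map_mul, e.apply_symm_apply, e.apply_symm_apply]
  ext <;> simp

/-- The unit group of a ring decomposed as a product. -/
def unitsProd (e : R ≃+* R₁ × R₂) : Rˣ ≃* R₁ˣ × R₂ˣ :=
  (Units.mapEquiv (e : R ≃* R₁ × R₂)).trans MulEquiv.prodUnits

lemma unitsProd_fst (e : R ≃+* R₁ × R₂) (x : Rˣ) : (((unitsProd e x).1 : R₁ˣ) : R₁) = (e x).1 := rfl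

lemma unitsProd_snd (e : R ≃+* R₁ × R₂) (x : Rˣ) : (((unitsProd e x).2 : R₂ˣ) : R₂) = (e x).2 := rfl

lemma unitsProd_fst_inv (e : R ≃+* R₁ × R₂) (x : Rˣ) :
    (((unitsProd e x).1⁻¹ : R₁ˣ) : R₁) = (e ((x⁻¹ : Rˣ) : R)).1 := by
  rw [← unitsProd_fst, map_inv, Prod.fst_inv]

lemma unitsProd_snd_inv (e : R ≃+* R₁ × R₂) (x : Rˣ) :
    (((unitsProd e x).2⁻¹ : R₂ˣ) : R₂) = (e ((x⁻¹ : Rˣ) : R)).2 := by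
  rw [← unitsProd_snd, map_inv, Prod.snd_inv]

variable [Fintype R] [DecidableEq R] [Fintype R₁] [DecidableEq R₁] [Fintype R₂] [DecidableEq R₂]

lemma unitSum_prod (e : R ≃+* R₁ × R₂) (ψ : AddChar R ℂ) (h n : R) :
    unitSum ψ h n = unitSum (charFst e ψ) (e h).1 (e n).1 *
      unitSum (charSnd e ψ) (e h).2 (e n).2 := by
  rw [unitSum, unitSum, unitSum, sum_mul_sum, ← sum_product', univ_product_univ]
  refine Fintype.sum_equiv (unitsProd e).toEquiv _ _ fun x => ?_
  change _ = charFst e ψ ((e h).1 * ((unitsProd e x).1 : R₁ˣ) +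
    (e n).1 * (((unitsProd e x).1⁻¹ : R₁ˣ) : R₁) ^ 2) * charSnd e ψ ((e h).2 *
      ((unitsProd e x).2 : R₂ˣ) + (e n).2 * (((unitsProd e x).2⁻¹ : R₂ˣ) : R₂) ^ 2)
  rw [unitsProd_fst_inv, unitsProd_snd_inv, unitsProd_fst, unitsProd_snd,
    ← charFst_mul_charSnd e ψ]
  simp only [map_add, map_mul, map_pow, Prod.fst_add, Prod.snd_add, Prod.fst_mul, Prod.snd_mul,
    Prod.pow_fst, Prod.pow_snd]

lemma Sig_prod (e : R ≃+* R₁ × R₂) (ψ : AddChar R ℂ) (c : Fin 4 → R) :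
    Sig ψ c = Sig (charFst e ψ) (fun i => (e (c i)).1) *
      Sig (charSnd e ψ) (fun i => (e (c i)).2) := by
  rw [Sig, Sig, Sig, sum_mul_sum, ← sum_product']
  refine sum_bij' (fun x _ => (fun i => (unitsProd e (x i)).1, fun i => (unitsProd e (x i)).2))
    (fun y _ i => (unitsProd e).symm (y.1 i, y.2 i)) (fun x hx => ?_) (fun y hy => ?_)
    (fun x hx => ?_) (fun y hy => ?_) (fun x hx => ?_)
  · have h0 := (mem_filter.1 hx).2
    have h1 := congrArg e h0
    rw [map_sum, map_zero] at h1
    refine mem_product.2 ⟨mem_filter.2 ⟨mem_univ _, ?_⟩, mem_filter.2 ⟨mem_univ _, ?_⟩⟩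
    · simp only [unitsProd_fst]
      rw [← Prod.fst_sum, h1, Prod.fst_zero]
    · simp only [unitsProd_snd]
      rw [← Prod.snd_sum, h1, Prod.snd_zero]
  · obtain ⟨h1, h2⟩ := mem_product.1 hy
    refine mem_filter.2 ⟨mem_univ _, e.injective ?_⟩
    rw [map_sum, map_zero]
    have e1 : ∀ i, e (((unitsProd e).symm (y.1 i, y.2 i) : Rˣ) : R) = ((y.1 i : R₁), (y.2 i : R₂)) := by
      intro i
      ext
      · rw [← unitsProd_fst, MulEquiv.apply_symm_apply]
      · rw [← unitsProd_snd, MulEquiv.apply_symm_apply]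
    simp only [e1]
    ext
    · rw [Prod.fst_sum]; exact (mem_filter.1 h1).2
    · rw [Prod.snd_sum]; exact (mem_filter.1 h2).2
  · funext i
    exact (unitsProd e).symm_apply_apply _
  · ext i : 2
    · exact congrArg Prod.fst ((unitsProd e).apply_symm_apply _)
    · exact congrArg Prod.snd ((unitsProd e).apply_symm_apply _)
  · simp only [unitsProd_fst_inv, unitsProd_snd_inv]
    rw [← charFst_mul_charSnd e ψ]
    simp only [map_sum, map_mul, Prod.fst_sum, Prod.snd_sum, Prod.fst_mul, Prod.snd_mul]

end Product

end AQK

namespace AQK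

open Finset

lemma norm_unitSum_sq_primePow_le {p k : ℕ} [hp : Fact p.Prime] {ψ : AddChar (ZMod (p ^ k)) ℂ}
    (hψ : ψ.IsPrimitive) (h n : ℕ) :
    ‖unitSum ψ h n‖ ^ 2 ≤ 27 * ((p ^ k : ℕ) * (Nat.gcd (h.gcd n) (p ^ k) : ℕ)) := by
  obtain ⟨a, hak, ha⟩ := (Nat.dvd_prime_pow hp.out).1 (Nat.gcd_dvd_right (h.gcd n) (p ^ k))
  have hpa : p ^ a ∣ h.gcd n := ha ▸ Nat.gcd_dvd_left (h.gcd n) (p ^ k)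
  rw [ha]
  rcases hak.eq_or_lt with rfl | hak
  · have h1 : ‖unitSum ψ (h : ZMod (p ^ a)) n‖ ≤ (p ^ a : ℕ) := by
      refine (norm_sum_addChar_le ψ univ _).trans ?_
      rw [card_univ, ZMod.card_units_eq_totient]
      exact_mod_cast Nat.totient_le _
    have := pow_le_pow_left₀ (norm_nonneg _) h1 2
    nlinarith [Nat.cast_nonneg (α := ℝ) (p ^ a)]
  obtain ⟨h', rfl⟩ : p ^ a ∣ h := hpa.trans (Nat.gcd_dvd_left _ _)
  obtain ⟨n', rfl⟩ : p ^ a ∣ n := hpa.trans (Nat.gcd_dvd_right _ _)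
  have hd : p ^ k = p ^ a * p ^ (k - a) := by rw [← pow_add]; congr 1; omega
  have hcop : ¬ (p ∣ h' ∧ p ∣ n') := by
    rintro ⟨h1, h2⟩
    have h3 : p ^ (a + 1) ∣ p ^ a := by
      conv_rhs => rw [← ha]
      refine Nat.dvd_gcd (Nat.dvd_gcd ?_ ?_) (pow_dvd_pow p (by omega))
      · rw [pow_succ]; exact mul_dvd_mul_left _ h1
      · rw [pow_succ]; exact mul_dvd_mul_left _ h2
    have := (Nat.pow_dvd_pow_iff_le_right hp.out.one_lt).1 h3
    omega
  have h1 := norm_unitSum_mul_le hd ψ h' n'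
  have h2 := norm_unitSum_sq_le_of_coprime (isPrimitive_mulHom hd hψ) (by omega) hcop
  calc _ ≤ (((p ^ a : ℕ) : ℝ) * _) ^ 2 := pow_le_pow_left₀ (norm_nonneg _) h1 2
    _ = ((p ^ a : ℕ) : ℝ) ^ 2 * _ := mul_pow _ _ _
    _ ≤ ((p ^ a : ℕ) : ℝ) ^ 2 * (27 * (p : ℝ) ^ (k - a)) := by gcongr
    _ = 27 * (((p ^ a * p ^ (k - a) : ℕ) : ℝ) * ((p ^ a : ℕ) : ℝ)) := by push_cast; ring
    _ = _ := by rw [← hd]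

lemma card_primeFactors_mul {a b : ℕ} (h : a.Coprime b) :
    (a * b).primeFactors.card = a.primeFactors.card + b.primeFactors.card := by
  rw [h.primeFactors_mul, card_union_of_disjoint h.disjoint_primeFactors]

theorem norm_unitSum_sq_le (d : ℕ) (hd : 0 < d) : ∀ [NeZero d] (ψ : AddChar (ZMod d) ℂ),
    ψ.IsPrimitive → ∀ h n : ℕ, ‖unitSum ψ (h : ZMod d) n‖ ^ 2 ≤
      27 ^ d.primeFactors.card * (d * (Nat.gcd (h.gcd n) d : ℕ)) := by
  induction d using Nat.recOnPosPrimePosCoprime with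
  | zero => exact absurd hd (lt_irrefl 0)
  | one =>
    intro _ ψ _ h n
    have h1 : ‖unitSum ψ (h : ZMod 1) n‖ ≤ 1 := by
      refine (norm_sum_addChar_le ψ univ _).trans ?_
      rw [card_univ, ZMod.card_units_eq_totient]
      simp
    have := pow_le_pow_left₀ (norm_nonneg _) h1 2
    simpa using this
  | prime_pow p k hp hk =>
    intro _ ψ hψ h n
    have := Fact.mk hp
    rw [Nat.primeFactors_prime_pow hk.ne' hp, card_singleton, pow_one]
    convert norm_unitSum_sq_primePow_le hψ h n
  | coprime a b ha hb hab iha ihb =>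
    intro _ ψ hψ h n
    have : NeZero a := ⟨by omega⟩
    have : NeZero b := ⟨by omega⟩
    rw [unitSum_prod (ZMod.chineseRemainder hab), norm_mul, mul_pow, card_primeFactors_mul hab,
      Nat.Coprime.gcd_mul _ hab]
    have h1 := iha (by omega) _ (isPrimitive_charFst (ZMod.chineseRemainder hab) hψ) h n
    have h2 := ihb (by omega) _ (isPrimitive_charSnd (ZMod.chineseRemainder hab) hψ) h n
    rw [map_natCast, map_natCast]
    calc _ ≤ _ := mul_le_mul h1 h2 (by positivity) (by positivity)
      _ = _ := by push_cast; ring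

end AQK

namespace AQK

open Polynomial Finset

/-- The cofactor of `f ^ (c - k)` in the `k`-th derivative of `f ^ c * r`. -/
noncomputable def derivCofactor {F : Type*} [Field F] (f : F[X]) (c : F) : ℕ → (F[X] →ₗ[F] F[X])
  | 0 => LinearMap.id
  | k + 1 => (LinearMap.mulLeft F f ∘ₗ derivative +
      (c - k) • LinearMap.mulLeft F (derivative f)) ∘ₗ derivCofactor f c k

lemma derivCofactor_succ {F : Type*} [Field F] (f : F[X]) (c : F) (k : ℕ) (r : F[X]) :
    derivCofactor f c (k + 1) r = f * derivative (derivCofactor f c k r) +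
      C (c - k) * (derivative f * derivCofactor f c k r) := by
  simp [derivCofactor, smul_eq_C_mul]

lemma iterate_derivative_pow_mul {F : Type*} [Field F] (f r w : F[X]) (hw : derivative w = 0)
    (c k : ℕ) (hk : k ≤ c) :
    derivative^[k] (f ^ c * r * w) = f ^ (c - k) * derivCofactor f (c : F) k r * w := by
  induction k with
  | zero => simp [derivCofactor]
  | succ k ih =>
    rw [Function.iterate_succ_apply', ih (by omega), derivCofactor_succ]
    obtain ⟨m, hm⟩ : ∃ m, c = k + 1 + m := ⟨c - (k + 1), by omega⟩
    have h1 : c - k = m + 1 := by omega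
    have h2 : c - (k + 1) = m := by omega
    have h3 : ((c : F) - k) = (m : F) + 1 := by rw [hm]; push_cast; ring
    rw [h1, h2, h3]
    simp only [derivative_mul, derivative_pow, hw, map_add, map_natCast, map_one]
    simp only [Nat.cast_add, Nat.cast_one, Nat.add_sub_cancel]
    ring

lemma natDegree_derivCofactor_le {F : Type*} [Field F] (f : F[X]) (hf : f.natDegree ≤ 4) (c : F)
    (k : ℕ) (r : F[X]) : (derivCofactor f c k r).natDegree ≤ r.natDegree + 3 * k := by
  induction k with
  | zero => simp [derivCofactor]
  | succ k ih =>
    rw [derivCofactor_succ]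
    have hf' : (derivative f).natDegree ≤ 3 := (natDegree_derivative_le f).trans (by omega)
    apply natDegree_add_le_of_degree_le
    · by_cases h0 : (derivCofactor f c k r).natDegree = 0
      · rw [natDegree_eq_zero] at h0
        obtain ⟨x, hx⟩ := h0
        rw [← hx]; simp
      · refine natDegree_mul_le.trans ?_
        have := natDegree_derivative_le (derivCofactor f c k r)
        omega
    · refine (natDegree_C_mul_le _ _).trans (natDegree_mul_le.trans ?_)
      omega

lemma X_pow_dvd_pow_char_sub {p : ℕ} [Fact p.Prime] (f : (ZMod p)[X]) :
    X ^ p ∣ f ^ p - C (f.coeff 0) := by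
  have h1 : f ^ p - C (f.coeff 0) = (f - C (f.coeff 0)) ^ p := by
    rw [sub_pow_char, ← C_pow, ZMod.pow_card]
  rw [h1]
  apply pow_dvd_pow_of_dvd
  rw [X_dvd_iff]
  simp

lemma pair_eq_zero_of_dvd {p n : ℕ} [Fact p.Prime] (hp : p = 2 * n + 1) (hn : 2 ≤ n)
    (f : (ZMod p)[X]) (hf : f.natDegree ≤ 4) (h0 : f.coeff 0 ≠ 0)
    (hsq : ∀ r s : (ZMod p)[X], f * r ^ 2 = C (f.coeff 0) * s ^ 2 → s = 0)
    (r s : (ZMod p)[X]) (hr : r.natDegree ≤ n - 2) (hs : s.natDegree ≤ n - 2)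
    (hd : X ^ p ∣ r + f ^ n * s) : r = 0 ∧ s = 0 := by
  have hfne : f ≠ 0 := by rintro rfl; simp at h0
  have h1 : X ^ p ∣ f * r ^ 2 - C (f.coeff 0) * s ^ 2 := by
    have e : f * r ^ 2 - C (f.coeff 0) * s ^ 2 =
        (r + f ^ n * s) * (f * (r - f ^ n * s)) + (f ^ p - C (f.coeff 0)) * s ^ 2 := by
      have hfp : f ^ p = f * f ^ n * f ^ n := by
        calc f ^ p = f ^ (2 * n + 1) := congrArg _ hp
          _ = _ := by ring
      rw [hfp]; ring
    rw [e]
    exact dvd_add (dvd_mul_of_dvd_left hd _)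
      (dvd_mul_of_dvd_left (X_pow_dvd_pow_char_sub f) _)
  have h2 : f * r ^ 2 - C (f.coeff 0) * s ^ 2 = 0 := by
    by_contra hne
    have h3 := natDegree_le_of_dvd h1 hne
    rw [natDegree_X_pow] at h3
    have h4 : (f * r ^ 2 - C (f.coeff 0) * s ^ 2).natDegree ≤ 2 * n := by
      refine (natDegree_sub_le_of_le (m := 2 * n) (n := 2 * n) ?_ ?_).trans (max_self _).le
      · refine natDegree_mul_le.trans ?_
        have := natDegree_pow_le (p := r) (n := 2)
        omega
      · refine (natDegree_C_mul_le _ _).trans ?_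
        have := natDegree_pow_le (p := s) (n := 2)
        omega
    omega
  have h3 := sub_eq_zero.1 h2
  have hs0 := hsq r s h3
  refine ⟨?_, hs0⟩
  rw [hs0] at h3
  simp only [ne_eq, OfNat.ofNat_ne_zero, not_false_eq_true, zero_pow, mul_zero, mul_eq_zero,
    pow_eq_zero_iff] at h3
  tauto

lemma derivative_X_pow_char_mul {p : ℕ} [Fact p.Prime] (j : ℕ) :
    derivative (X ^ (p * j) : (ZMod p)[X]) = 0 := by
  rw [derivative_X_pow]
  simp

/-- The auxiliary polynomial in Stepanov's method. -/
noncomputable def stepanovPoly {p : ℕ} [Fact p.Prime] (f : (ZMod p)[X]) (n l J : ℕ)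
    (r s : Fin J → (ZMod p)[X]) : (ZMod p)[X] :=
  ∑ j : Fin J, (f ^ l * r j * X ^ (p * (j : ℕ)) + f ^ (l + n) * s j * X ^ (p * (j : ℕ)))

lemma stepanovPoly_ne_zero {p n : ℕ} [Fact p.Prime] (hp : p = 2 * n + 1) (hn : 2 ≤ n)
    (f : (ZMod p)[X]) (hf : f.natDegree ≤ 4) (h0 : f.coeff 0 ≠ 0)
    (hsq : ∀ r s : (ZMod p)[X], f * r ^ 2 = C (f.coeff 0) * s ^ 2 → s = 0)
    (l J : ℕ) (r s : Fin J → (ZMod p)[X])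
    (hr : ∀ j, (r j).natDegree ≤ n - 2) (hs : ∀ j, (s j).natDegree ≤ n - 2)
    (hz : stepanovPoly f n l J r s = 0) : ∀ j, r j = 0 ∧ s j = 0 := by
  have hfne : f ≠ 0 := by rintro rfl; simp at h0
  have h1 : ∑ j : Fin J, (r j + f ^ n * s j) * X ^ (p * (j : ℕ)) = 0 := by
    have : f ^ l * ∑ j : Fin J, (r j + f ^ n * s j) * X ^ (p * (j : ℕ)) = 0 := by
      rw [← hz, stepanovPoly, mul_sum]
      apply sum_congr rfl
      intro j _
      rw [pow_add]; ring
    exact (mul_eq_zero.1 this).resolve_left (pow_ne_zero _ hfne)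
  suffices H : ∀ m : ℕ, ∀ j : Fin J, (j : ℕ) = m → r j = 0 ∧ s j = 0 from fun j => H j j rfl
  intro m
  induction m using Nat.strong_induction_on with
  | _ m ih =>
    intro j hj
    apply pair_eq_zero_of_dvd hp hn f hf h0 hsq _ _ (hr j) (hs j)
    have h2 : (r j + f ^ n * s j) * X ^ (p * (j : ℕ)) =
        - ∑ i ∈ univ.erase j, (r i + f ^ n * s i) * X ^ (p * (i : ℕ)) := by
      rw [← add_sum_erase _ _ (mem_univ j)] at h1
      exact eq_neg_of_add_eq_zero_left h1
    have h3 : X ^ (p * (j : ℕ)) * X ^ p ∣ X ^ (p * (j : ℕ)) * (r j + f ^ n * s j) := by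
      rw [mul_comm _ (r j + f ^ n * s j), h2]
      apply (dvd_neg).2
      apply dvd_sum
      intro i hi
      rcases lt_or_ge (i : ℕ) (j : ℕ) with hij | hij
      · obtain ⟨a, b⟩ := ih i (hj ▸ hij) i rfl
        rw [a, b]; simp
      · have hij' : (j : ℕ) < i := lt_of_le_of_ne hij (fun h => (mem_erase.1 hi).1 (Fin.ext h.symm))
        apply dvd_mul_of_dvd_right
        rw [← pow_add]
        apply pow_dvd_pow
        calc p * (j : ℕ) + p = p * ((j : ℕ) + 1) := by ring
          _ ≤ p * i := Nat.mul_le_mul_left _ hij'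
    exact (mul_dvd_mul_iff_left (pow_ne_zero _ X_ne_zero)).1 h3

lemma iterate_derivative_stepanovPoly {p n : ℕ} [Fact p.Prime] (f : (ZMod p)[X]) (l J : ℕ)
    (r s : Fin J → (ZMod p)[X]) (k : ℕ) (hk : k ≤ l) :
    derivative^[k] (stepanovPoly f n l J r s) =
      ∑ j : Fin J, (f ^ (l - k) * derivCofactor f (l : ZMod p) k (r j) * X ^ (p * (j : ℕ)) +
        f ^ (l + n - k) * derivCofactor f ((l + n : ℕ) : ZMod p) k (s j) * X ^ (p * (j : ℕ))) := by
  rw [stepanovPoly, iterate_derivative_sum]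
  apply sum_congr rfl
  intro j _
  rw [iterate_map_add, iterate_derivative_pow_mul _ _ _ (derivative_X_pow_char_mul j) _ _ hk,
    iterate_derivative_pow_mul _ _ _ (derivative_X_pow_char_mul j) _ _ (by omega)]

lemma natDegree_stepanovPoly_le {p n : ℕ} [Fact p.Prime] (f : (ZMod p)[X]) (hf : f.natDegree ≤ 4)
    (l J : ℕ) (r s : Fin J → (ZMod p)[X]) 
    (hr : ∀ j, (r j).natDegree ≤ n - 2) (hs : ∀ j, (s j).natDegree ≤ n - 2) :
    (stepanovPoly f n l J r s).natDegree ≤ 4 * l + 5 * n + p * (J - 1) := by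
  apply natDegree_sum_le_of_forall_le
  intro j _
  have hX : (X ^ (p * (j : ℕ)) : (ZMod p)[X]).natDegree ≤ p * (J - 1) := by
    rw [natDegree_X_pow]
    exact Nat.mul_le_mul_left _ (by omega)
  have hpow : ∀ c : ℕ, (f ^ c).natDegree ≤ 4 * c := fun c =>
    natDegree_pow_le.trans (by rw [mul_comm]; exact Nat.mul_le_mul_right _ hf)
  apply natDegree_add_le_of_degree_le
  · refine (natDegree_mul_le.trans (Nat.add_le_add_right natDegree_mul_le _)).trans ?_
    have := hr j
    have := hpow l
    omega
  · refine (natDegree_mul_le.trans (Nat.add_le_add_right natDegree_mul_le _)).trans ?_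
    have := hs j
    have := hpow (l + n)
    omega

/-- Stepanov's upper bound for the number of points where `f ^ ((p - 1) / 2)` takes a given
nonzero value. -/
lemma stepanov_upper {p n : ℕ} [Fact p.Prime] (hp : p = 2 * n + 1) (hn : 20 ≤ n)
    (f : (ZMod p)[X]) (hf : f.natDegree ≤ 4) (h0 : f.coeff 0 ≠ 0)
    (hsq : ∀ r s : (ZMod p)[X], f * r ^ 2 = C (f.coeff 0) * s ^ 2 → s = 0)
    (a : ZMod p) (t : ℕ) (ht : 1 ≤ t) (htn : 4 * t ^ 2 ≤ n) :
    (univ.filter (fun x : ZMod p => f.eval x ≠ 0 ∧ (f.eval x) ^ n = a)).card * (2 * t) ≤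
      4 * (2 * t) + 5 * n + p * (t + 3) := by
  set l := 2 * t with hl
  set J := t + 4 with hJ
  set d := n - 1 with hd
  set M := n + 3 * l + J with hM
  let E : (Fin J × Fin d ⊕ Fin J × Fin d → ZMod p) → Fin J → (Fin d → ZMod p) :=
    fun v j e => v (Sum.inl (j, e))
  let R : Fin J → ((Fin J × Fin d ⊕ Fin J × Fin d → ZMod p) →ₗ[ZMod p] (ZMod p)[X]) :=
    fun j => polyOf d ∘ₗ LinearMap.funLeft (ZMod p) (ZMod p) (fun e => Sum.inl (j, e))
  let S : Fin J → ((Fin J × Fin d ⊕ Fin J × Fin d → ZMod p) →ₗ[ZMod p] (ZMod p)[X]) :=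
    fun j => polyOf d ∘ₗ LinearMap.funLeft (ZMod p) (ZMod p) (fun e => Sum.inr (j, e))
  let Q : ℕ → ((Fin J × Fin d ⊕ Fin J × Fin d → ZMod p) →ₗ[ZMod p] (ZMod p)[X]) :=
    fun k => ∑ j : Fin J, LinearMap.mulLeft (ZMod p) (X ^ (j : ℕ)) ∘ₗ
      (derivCofactor f (l : ZMod p) k ∘ₗ R j +
        a • derivCofactor f ((l + n : ℕ) : ZMod p) k ∘ₗ S j)
  have hQ : ∀ k v, Q k v = ∑ j : Fin J, X ^ (j : ℕ) * (derivCofactor f (l : ZMod p) k (R j v) +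
      C a * derivCofactor f ((l + n : ℕ) : ZMod p) k (S j v)) := by
    intro k v
    simp [Q, smul_eq_C_mul]
  have hRd : ∀ j v, (R j v).natDegree ≤ n - 2 := fun j v => (polyOf_natDegree _).trans (by omega)
  have hSd : ∀ j v, (S j v).natDegree ≤ n - 2 := fun j v => (polyOf_natDegree _).trans (by omega)
  have hQd : ∀ k v, k < l → (Q k v).natDegree < M := by
    intro k v hk
    have : (Q k v).natDegree ≤ M - 1 := by
      rw [hQ]
      apply natDegree_sum_le_of_forall_le
      intro j _
      refine natDegree_mul_le.trans ?_
      rw [natDegree_X_pow]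
      have h1 : (derivCofactor f (l : ZMod p) k (R j v) +
        C a * derivCofactor f ((l + n : ℕ) : ZMod p) k (S j v)).natDegree ≤ n - 2 + 3 * k := by
        apply natDegree_add_le_of_degree_le
        · exact (natDegree_derivCofactor_le f hf _ _ _).trans (by have := hRd j v; omega)
        · exact (natDegree_C_mul_le _ _).trans
            ((natDegree_derivCofactor_le f hf _ _ _).trans (by have := hSd j v; omega))
      have := j.2
      omega
    omega
  obtain ⟨v, hv0, hv⟩ := exists_ne_zero_of_card_lt
    (κ := Fin l × Fin M) (fun ki => Polynomial.lcoeff (ZMod p) ki.2 ∘ₗ Q ki.1) (by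
      simp only [Fintype.card_prod, Fintype.card_sum, Fintype.card_fin]
      obtain ⟨m, rfl⟩ : ∃ m, n = m + 1 := ⟨n - 1, by omega⟩
      simp only [hl, hJ, hd, hM, Nat.add_sub_cancel]
      nlinarith)
  have hQ0 : ∀ k < l, Q k v = 0 := by
    intro k hk
    ext i
    by_cases hi : i < M
    · simpa using hv (⟨k, hk⟩, ⟨i, hi⟩)
    · rw [coeff_eq_zero_of_natDegree_lt (by have := hQd k v hk; omega)]
      simp
  set φ := stepanovPoly f n l J (fun j => R j v) (fun j => S j v) with hφ
  have hφ0 : φ ≠ 0 := by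
    intro h
    have := stepanovPoly_ne_zero hp (by omega) f hf h0 hsq l J _ _ (fun j => hRd j v)
      (fun j => hSd j v) h
    apply hv0
    ext x
    rcases x with ⟨j, e⟩ | ⟨j, e⟩
    · exact congrFun (polyOf_eq_zero (this j).1) e
    · exact congrFun (polyOf_eq_zero (this j).2) e
  have hlp : l < p := by nlinarith
  have hmult : ∀ x ∈ univ.filter (fun x : ZMod p => f.eval x ≠ 0 ∧ (f.eval x) ^ n = a),
      l ≤ φ.rootMultiplicity x := by
    intro x hx
    obtain ⟨-, hx0, hxa⟩ := mem_filter.1 hx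
    have key := lt_rootMultiplicity_of_isRoot_iterate_derivative_of_mem_nonZeroDivisors
      (p := φ) (t := x) (n := l - 1) hφ0 ?_ ?_
    · omega
    · intro k hk
      have hk' : k < l := by omega
      rw [IsRoot, hφ, iterate_derivative_stepanovPoly _ _ _ _ _ _ hk'.le]
      have h1 := congrArg (fun g => (f.eval x) ^ (l - k) * eval x g) (hQ0 k hk')
      simp only [hQ, eval_finsetSum, eval_zero, mul_zero] at h1
      rw [← h1, eval_finsetSum, mul_sum]
      apply sum_congr rfl
      intro j _
      have e1 : l + n - k = (l - k) + n := by omega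
      rw [e1]
      simp only [eval_add, eval_mul, eval_pow, eval_X, eval_C, pow_add, pow_mul, ZMod.pow_card, hxa]
      ring
    · rw [mem_nonZeroDivisors_iff_ne_zero, Ne, ZMod.natCast_eq_zero_iff,
        (Fact.out : p.Prime).dvd_factorial]
      omega
  refine (card_mul_le_natDegree hφ0 _ l hmult).trans ?_
  refine (natDegree_stepanovPoly_le f hf l J _ _ (fun j => hRd j v) (fun j => hSd j v)).trans ?_
  rfl

end AQK

namespace AQK

open Polynomial Finset

lemma two_mul_card_le {p n : ℕ} [Fact p.Prime] (hp : p = 2 * n + 1) (hn : 20 ≤ n)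
    (f : (ZMod p)[X]) (hf : f.natDegree ≤ 4) (h0 : f.coeff 0 ≠ 0)
    (hsq : ∀ r s : (ZMod p)[X], f * r ^ 2 = C (f.coeff 0) * s ^ 2 → s = 0) (a : ZMod p) :
    2 * ((univ.filter (fun x : ZMod p => f.eval x ≠ 0 ∧ (f.eval x) ^ n = a)).card : ℝ) ≤
      p + 24 * √p + 8 := by
  set N := (univ.filter (fun x : ZMod p => f.eval x ≠ 0 ∧ (f.eval x) ^ n = a)).card with hN
  set t := Nat.sqrt (n / 4) with ht
  have ht2 : 2 ≤ t := by
    rw [ht, Nat.le_sqrt]; omega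
  have h1 : 4 * t ^ 2 ≤ n := by
    have : t ^ 2 ≤ n / 4 := Nat.sqrt_le' _
    omega
  have h2 : n < 4 * (t + 1) ^ 2 := by
    have : n / 4 < (t + 1) ^ 2 := Nat.lt_succ_sqrt' _
    omega
  have h3 := stepanov_upper hp hn f hf h0 hsq a t (by omega) h1
  rw [← hN] at h3
  have h4 : (N : ℝ) * (2 * t) ≤ 4 * (2 * t) + 5 * n + p * (t + 3) := by exact_mod_cast h3
  have hpn : (p : ℝ) = 2 * n + 1 := by exact_mod_cast hp
  have ht2' : (2 : ℝ) ≤ t := by exact_mod_cast ht2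
  have hp18 : (p : ℝ) ≤ 18 * (t : ℝ) ^ 2 := by
    have : (n : ℝ) + 1 ≤ 4 * ((t : ℝ) + 1) ^ 2 := by exact_mod_cast h2
    nlinarith
  have hs : √(p : ℝ) ≤ 4.25 * t := by
    rw [Real.sqrt_le_left (by positivity)]
    nlinarith
  have hsp : √(p : ℝ) * √p = p := Real.mul_self_sqrt (by positivity)
  have hs0 : 0 ≤ √(p : ℝ) := Real.sqrt_nonneg _
  have h5 : (p : ℝ) ≤ 4.25 * t * √p := by nlinarith
  have h6 : (2 * (N : ℝ)) * t ≤ (p + 24 * √p + 8) * t := by nlinarith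
  exact le_of_mul_le_mul_right h6 (by linarith)

lemma abs_sum_quadraticChar_le_aux {p : ℕ} [Fact p.Prime] (hp2 : p ≠ 2)
    (f : (ZMod p)[X]) (hf : f.natDegree ≤ 4) (h0 : f.coeff 0 ≠ 0)
    (hsq : ∀ r s : (ZMod p)[X], f * r ^ 2 = C (f.coeff 0) * s ^ 2 → s = 0) :
    |((∑ u : ZMod p, quadraticChar (ZMod p) (f.eval u) : ℤ) : ℝ)| ≤ 30 * √p := by
  obtain ⟨n, hn⟩ := (Fact.out : p.Prime).odd_of_ne_two hp2
  have hsp : √(p : ℝ) * √p = p := Real.mul_self_sqrt (by positivity)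
  have hs0 : 0 ≤ √(p : ℝ) := Real.sqrt_nonneg _
  have hchar : ringChar (ZMod p) ≠ 2 := by rwa [ZMod.ringChar_zmod_n]
  have hhalf : Fintype.card (ZMod p) / 2 = n := by rw [ZMod.card]; omega
  by_cases hbig : 20 ≤ n
  · set P := univ.filter (fun x : ZMod p => f.eval x ≠ 0 ∧ (f.eval x) ^ n = 1) with hP
    set Q := univ.filter (fun x : ZMod p => f.eval x ≠ 0 ∧ (f.eval x) ^ n = -1) with hQ
    set Z := univ.filter (fun x : ZMod p => f.eval x = 0) with hZ
    have hfne : f ≠ 0 := by rintro rfl; simp at h0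
    have hone : (1 : ZMod p) ≠ -1 := by
      intro h
      exact (Ring.neg_one_ne_one_of_char_ne_two hchar) h.symm
    have hdich : ∀ u, f.eval u ≠ 0 → (f.eval u) ^ n = 1 ∨ (f.eval u) ^ n = -1 := by
      intro u hu
      have h := FiniteField.pow_card_sub_one_eq_one (f.eval u) hu
      have h2 : p - 1 = n * 2 := by omega
      rw [ZMod.card, h2, pow_mul, sq] at h
      exact mul_self_eq_one_iff.1 h
    have hchi : ∀ u, (quadraticChar (ZMod p) (f.eval u) : ℤ) =
        (if u ∈ P then 1 else 0) - (if u ∈ Q then 1 else 0) := by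
      intro u
      simp only [hP, hQ, mem_filter, mem_univ, true_and]
      by_cases hu : f.eval u = 0
      · simp [hu]
      · have h1 := quadraticChar_eq_pow_of_char_ne_two hchar hu
        rw [hhalf] at h1
        rw [h1]
        rcases hdich u hu with h | h
        · simp [h, hu, hone]
        · simp [h, hu, hone.symm]
    have hcnt : ∀ u, (1 : ℤ) = (if u ∈ P then 1 else 0) + (if u ∈ Q then 1 else 0) +
        (if u ∈ Z then 1 else 0) := by
      intro u
      simp only [hP, hQ, hZ, mem_filter, mem_univ, true_and]
      by_cases hu : f.eval u = 0
      · simp [hu]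
      · rcases hdich u hu with h | h
        · simp [h, hu, hone]
        · simp [h, hu, hone.symm]
    have hS : (∑ u : ZMod p, quadraticChar (ZMod p) (f.eval u) : ℤ) = (P.card : ℤ) - Q.card := by
      rw [sum_congr rfl (fun u _ => hchi u), sum_sub_distrib]
      simp
    have hT : (p : ℤ) = P.card + Q.card + Z.card := by
      have h1 : (∑ _u : ZMod p, (1 : ℤ)) = p := by simp [ZMod.card]
      rw [← h1, sum_congr rfl (fun u _ => hcnt u), sum_add_distrib, sum_add_distrib]
      simp
    have hZ4 : Z.card ≤ 4 := by
      have h1 : Z ⊆ f.roots.toFinset := by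
        intro x hx
        rw [Multiset.mem_toFinset, mem_roots hfne]
        exact (mem_filter.1 hx).2
      exact (card_le_card h1).trans ((Multiset.toFinset_card_le _).trans ((card_roots' f).trans hf))
    have h1 := two_mul_card_le hn hbig f hf h0 hsq 1
    have h2 := two_mul_card_le hn hbig f hf h0 hsq (-1)
    rw [← hP] at h1
    rw [← hQ] at h2
    have hT' : (p : ℝ) = P.card + Q.card + Z.card := by exact_mod_cast hT
    have hZ4' : (Z.card : ℝ) ≤ 4 := by exact_mod_cast hZ4
    have h6 : 6 ≤ √(p : ℝ) := by
      apply Real.le_sqrt_of_sq_le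
      have : 36 ≤ p := by omega
      norm_num
      exact_mod_cast this
    rw [hS]
    push_cast
    rw [abs_le]
    constructor <;> linarith
  · have h1 : |((∑ u : ZMod p, quadraticChar (ZMod p) (f.eval u) : ℤ) : ℝ)| ≤ p := by
      push_cast
      refine (abs_sum_le_sum_abs _ _).trans ?_
      calc ∑ u : ZMod p, |((quadraticChar (ZMod p) (f.eval u) : ℤ) : ℝ)|
          ≤ ∑ _u : ZMod p, (1 : ℝ) := by
            apply sum_le_sum
            intro u _
            by_cases hu : f.eval u = 0
            · simp [hu]
            · rcases quadraticChar_dichotomy hu with h | h <;> simp [h]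
        _ = p := by simp [ZMod.card]
    refine h1.trans ?_
    have h2 : √(p : ℝ) ≤ 30 := by
      rw [Real.sqrt_le_left (by norm_num)]
      have : p ≤ 30 ^ 2 := by omega
      exact_mod_cast this
    nlinarith

lemma abs_sum_quadraticChar_le {p : ℕ} [Fact p.Prime] (hp2 : p ≠ 2)
    (f : (ZMod p)[X]) (hf : f.natDegree ≤ 4)
    (hsq : ∀ c ≠ 0, ∀ r s : (ZMod p)[X], f * r ^ 2 = C c * s ^ 2 → s = 0) :
    |((∑ u : ZMod p, quadraticChar (ZMod p) (f.eval u) : ℤ) : ℝ)| ≤ 30 * √p := by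
  by_cases h : ∃ u0, f.eval u0 ≠ 0
  · obtain ⟨u0, hu0⟩ := h
    have h1 := abs_sum_quadraticChar_le_aux hp2 (f.comp (X + C u0)) ?_ ?_ ?_
    · have h2 : (∑ u : ZMod p, quadraticChar (ZMod p) ((f.comp (X + C u0)).eval u)) =
          ∑ u : ZMod p, quadraticChar (ZMod p) (f.eval u) := by
        rw [← Equiv.sum_comp (Equiv.addRight u0) (fun u => quadraticChar (ZMod p) (f.eval u))]
        apply sum_congr rfl
        intro u _
        simp
      rwa [h2] at h1
    · refine natDegree_comp_le.trans ?_
      rw [natDegree_X_add_C, mul_one]; exact hf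
    · rw [coeff_zero_eq_eval_zero]; simpa using hu0
    · intro r s hrs
      have h3 := congrArg (fun g => g.comp (X - C u0)) hrs
      simp only [mul_comp, pow_comp, C_comp, comp_assoc, add_comp, X_comp, sub_add_cancel,
        comp_X] at h3
      have h4 := hsq _ (by rw [coeff_zero_eq_eval_zero]; simpa using hu0) _ _ h3
      have h5 := congrArg (fun g => g.comp (X + C u0)) h4
      simpa [comp_assoc] using h5
  · push Not at h
    have : (∑ u : ZMod p, quadraticChar (ZMod p) (f.eval u)) = 0 := by
      apply sum_eq_zero
      intro u _
      simp [h u]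
    rw [this]
    simp

end AQK

namespace AQK

open Polynomial Finset

/-- The discriminant of `u y² + (b - a - u) y + a`, as a polynomial in `u`. -/
noncomputable def discPoly {F : Type*} [Field F] (a b : F) : F[X] :=
  X ^ 2 - C (2 * (a + b)) * X + C ((a - b) ^ 2)

lemma discPoly_natDegree_le {F : Type*} [Field F] (a b : F) : (discPoly a b).natDegree ≤ 2 := by
  unfold discPoly
  compute_degree

lemma discPoly_factor {F : Type*} [Field F] (α β : F) :
    discPoly (α * α) (β * β) = (X - C ((α + β) ^ 2)) * (X - C ((α - β) ^ 2)) := by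
  simp only [discPoly, C_mul, C_add, C_pow, C_sub]
  have : (C 2 : F[X]) = 2 := rfl
  rw [this]
  ring

lemma even_rootMultiplicity {K : Type*} [Field K] [DecidableEq K] {u₁ u₂ v₁ v₂ c : K} (hc : c ≠ 0) {R S : K[X]}
    (hS : S ≠ 0)
    (h : (X - C u₁) * (X - C u₂) * ((X - C v₁) * (X - C v₂)) * R ^ 2 = C c * S ^ 2) (θ : K) :
    Even ((if θ = u₁ then 1 else 0) + (if θ = u₂ then 1 else 0) +
      ((if θ = v₁ then 1 else 0) + (if θ = v₂ then 1 else 0))) := by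
  have hR : R ≠ 0 := by
    rintro rfl
    have h2 : C c * S ^ 2 ≠ 0 := mul_ne_zero (C_ne_zero.2 hc) (pow_ne_zero _ hS)
    apply h2
    rw [← h]; simp
  have h1 := congrArg (rootMultiplicity θ) h
  have hx : ∀ u : K, (X - C u) ≠ 0 := fun u => X_sub_C_ne_zero u
  rw [rootMultiplicity_mul (by simp [hx, hR]), rootMultiplicity_mul (by simp [hx]),
    rootMultiplicity_mul (by simp [hx]), rootMultiplicity_mul (by simp [hx]),
    rootMultiplicity_mul (by simp [hc, hS]), sq, sq,
    rootMultiplicity_mul (mul_ne_zero hR hR), rootMultiplicity_mul (mul_ne_zero hS hS)] at h1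
  simp only [rootMultiplicity_X_sub_C, rootMultiplicity_C] at h1
  rw [Nat.even_iff]
  omega

lemma discPoly_mul_not_square {F : Type*} [Field F] (h2 : (2 : F) ≠ 0) {a b a' b' : F}
    (ha : a ≠ 0) (hb : b ≠ 0) (ha' : a' ≠ 0) (hb' : b' ≠ 0)
    (hne : ¬ ((a = a' ∧ b = b') ∨ (a = b' ∧ b = a'))) :
    ∀ c ≠ 0, ∀ r s : F[X], (discPoly a b * discPoly a' b') * r ^ 2 = C c * s ^ 2 → s = 0 := by
  classical
  intro c hc r s h
  by_contra hs
  apply hne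
  let K := AlgebraicClosure F
  let i : F →+* K := algebraMap F K
  obtain ⟨α, hα⟩ := IsAlgClosed.exists_eq_mul_self (i a)
  obtain ⟨β, hβ⟩ := IsAlgClosed.exists_eq_mul_self (i b)
  obtain ⟨γ, hγ⟩ := IsAlgClosed.exists_eq_mul_self (i a')
  obtain ⟨δ, hδ⟩ := IsAlgClosed.exists_eq_mul_self (i b')
  have hi2' : i 2 = 2 := map_ofNat i 2
  have hi2 : (2 : K) ≠ 0 := by
    rw [← hi2']
    exact (map_ne_zero i).2 h2
  have hi : ∀ {x : F}, x ≠ 0 → i x ≠ 0 := fun hx => (map_ne_zero i).2 hx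
  have hα0 : α ≠ 0 := by rintro rfl; simp at hα; exact ha hα
  have hβ0 : β ≠ 0 := by rintro rfl; simp at hβ; exact hb hβ
  have hγ0 : γ ≠ 0 := by rintro rfl; simp at hγ; exact ha' hγ
  have hδ0 : δ ≠ 0 := by rintro rfl; simp at hδ; exact hb' hδ
  have hmap : ∀ x y : F, (discPoly x y).map i = discPoly (i x) (i y) := by
    intro x y
    simp [discPoly, hi2']
  have h1 := congrArg (Polynomial.map i) h
  simp only [Polynomial.map_mul, Polynomial.map_pow, hmap, map_C, hα, hβ, hγ, hδ,
    discPoly_factor] at h1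
  have hs' : s.map i ≠ 0 := (Polynomial.map_ne_zero_iff i.injective).2 hs
  have hev := even_rootMultiplicity (hi hc) hs' h1
  have h4 : (4 : K) ≠ 0 := by
    have : (4 : K) = 2 * 2 := by norm_num
    rw [this]; exact mul_ne_zero hi2 hi2
  have hu : (α + β) ^ 2 ≠ (α - β) ^ 2 := by
    intro h
    have : 4 * (α * β) = 0 := by linear_combination h
    exact mul_ne_zero h4 (mul_ne_zero hα0 hβ0) this
  have hv : (γ + δ) ^ 2 ≠ (γ - δ) ^ 2 := by
    intro h
    have : 4 * (γ * δ) = 0 := by linear_combination h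
    exact mul_ne_zero h4 (mul_ne_zero hγ0 hδ0) this
  have e1 := hev ((α + β) ^ 2)
  have e2 := hev ((α - β) ^ 2)
  rw [if_pos rfl, if_neg hu] at e1
  rw [if_neg hu.symm, if_pos rfl] at e2
  have key : α * α + β * β = γ * γ + δ * δ ∧ (α * α) * (β * β) = (γ * γ) * (δ * δ) := by
    generalize hU1 : (α + β) ^ 2 = U1 at *
    generalize hU2 : (α - β) ^ 2 = U2 at *
    generalize hV1 : (γ + δ) ^ 2 = V1 at *
    generalize hV2 : (γ - δ) ^ 2 = V2 at *
    have hset : (U1 = V1 ∧ U2 = V2) ∨ (U1 = V2 ∧ U2 = V1) := by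
      by_cases c1 : U1 = V1 <;> by_cases c2 : U1 = V2 <;> by_cases c3 : U2 = V1 <;>
        by_cases c4 : U2 = V2 <;> simp_all
    have hsum : U1 + U2 = V1 + V2 := by
      rcases hset with ⟨h, h'⟩ | ⟨h, h'⟩ <;> rw [h, h']; ring
    have hprod : U1 * U2 = V1 * V2 := by
      rcases hset with ⟨h, h'⟩ | ⟨h, h'⟩ <;> rw [h, h']; ring
    have k1 : α * α + β * β = γ * γ + δ * δ := by
      apply mul_left_cancel₀ hi2
      rw [← hU1, ← hU2, ← hV1, ← hV2] at hsum
      linear_combination hsum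
    refine ⟨k1, ?_⟩
    apply mul_left_cancel₀ h4
    rw [← hU1, ← hU2, ← hV1, ← hV2] at hprod
    linear_combination (α * α + β * β + γ * γ + δ * δ) * k1 - hprod
  rw [← hα, ← hβ, ← hγ, ← hδ, ← map_add, ← map_add, ← map_mul, ← map_mul] at key
  have k1 : a + b = a' + b' := i.injective key.1
  have k2 : a * b = a' * b' := i.injective key.2
  have k3 : (a - a') * (a - b') = 0 := by linear_combination a * k1 - k2
  rcases mul_eq_zero.1 k3 with h | h
  · left
    have : a = a' := sub_eq_zero.1 h
    exact ⟨this, by subst this; exact add_left_cancel k1⟩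
  · right
    have : a = b' := sub_eq_zero.1 h
    refine ⟨this, ?_⟩
    subst this
    linear_combination k1

end AQK

namespace AQK

open Polynomial Finset

/-- The number of `y ≠ 0, 1` with `a / y + b / (1 - y) = u`. -/
def fiberCount {F : Type*} [Field F] [Fintype F] [DecidableEq F] (a b u : F) : ℕ :=
  (univ.filter (fun y : F => y ≠ 0 ∧ y ≠ 1 ∧ a * y⁻¹ + b * (1 - y)⁻¹ = u)).card

lemma fiberCount_eq_quadratic {F : Type*} [Field F] [Fintype F] [DecidableEq F] {a b : F}
    (ha : a ≠ 0) (hb : b ≠ 0) (u : F) : fiberCount a b u =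
      (univ.filter (fun y : F => u * y ^ 2 + (b - a - u) * y + a = 0)).card := by
  unfold fiberCount
  congr 1
  ext y
  simp only [mem_filter, mem_univ, true_and]
  constructor
  · rintro ⟨h0, h1, h⟩
    have h1' : 1 - y ≠ 0 := sub_ne_zero.2 (Ne.symm h1)
    field_simp at h
    linear_combination h
  · intro h
    have h0 : y ≠ 0 := by rintro rfl; simp at h; exact ha h
    have h1 : y ≠ 1 := by rintro rfl; apply hb; linear_combination h
    refine ⟨h0, h1, ?_⟩
    have h1' : 1 - y ≠ 0 := sub_ne_zero.2 (Ne.symm h1)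
    field_simp
    linear_combination h

lemma fiberCount_eq {F : Type*} [Field F] [Fintype F] [DecidableEq F] (h2 : ringChar F ≠ 2)
    {a b : F} (ha : a ≠ 0) (hb : b ≠ 0) (u : F) : (fiberCount a b u : ℤ) =
      1 + quadraticChar F ((discPoly a b).eval u) - if u = 0 then 1 else 0 := by
  rw [fiberCount_eq_quadratic ha hb]
  have h2' : (2 : F) ≠ 0 := Ring.two_ne_zero h2
  have hD : (discPoly a b).eval u = u ^ 2 - 2 * (a + b) * u + (a - b) ^ 2 := by
    simp [discPoly]
  by_cases hu : u = 0
  · subst hu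
    rw [hD]
    by_cases hab : a = b
    · subst hab
      simp [ha]
    · have h1 : (univ.filter (fun y : F => 0 * y ^ 2 + (b - a - 0) * y + a = 0)) =
          {-a / (b - a)} := by
        have : b - a ≠ 0 := sub_ne_zero.2 (Ne.symm hab)
        ext y
        simp only [mem_filter, mem_univ, true_and, mem_singleton]
        rw [eq_div_iff this]
        constructor <;> intro h <;> linear_combination h
      rw [h1]
      have h3 : (0 : F) ^ 2 - 2 * (a + b) * 0 + (a - b) ^ 2 = (a - b) ^ 2 := by ring
      rw [h3, quadraticChar_sq_one' (sub_ne_zero.2 hab)]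
      simp
  · have h1 : (univ.filter (fun y : F => u * y ^ 2 + (b - a - u) * y + a = 0)).card =
        {x : F | x ^ 2 = (discPoly a b).eval u}.toFinset.card := by
      apply card_nbij' (fun y => 2 * u * y + (b - a - u)) (fun x => (x - (b - a - u)) / (2 * u))
      · intro y hy
        simp only [coe_filter, mem_univ, true_and, Set.mem_ofPred_eq, Set.coe_toFinset] at hy ⊢
        rw [hD]
        linear_combination 4 * u * hy
      · intro x hx
        simp only [coe_filter, mem_univ, true_and, Set.mem_ofPred_eq, Set.coe_toFinset] at hx ⊢
        rw [hD] at hx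
        have h4 : (4 : F) * u ≠ 0 := by
          have : (4 : F) = 2 * 2 := by norm_num
          rw [this]; exact mul_ne_zero (mul_ne_zero h2' h2') hu
        apply mul_left_cancel₀ h4
        field_simp
        linear_combination 4 * hx
      · intro y _
        field_simp
        ring
      · intro x _
        field_simp
        ring
    rw [h1, quadraticChar_card_sqrts h2, if_neg hu]
    ring

lemma sum_fiberCount {F : Type*} [Field F] [Fintype F] [DecidableEq F] (a b : F) :
    ∑ u, fiberCount a b u = (univ.filter (fun y : F => y ≠ 0 ∧ y ≠ 1)).card := by
  rw [card_eq_sum_card_fiberwise (f := fun y : F => a * y⁻¹ + b * (1 - y)⁻¹) (t := univ)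
    (fun _ _ => by simp)]
  apply sum_congr rfl
  intro u _
  rw [fiberCount, filter_filter]
  simp only [and_assoc]

lemma card_ne_zero_one {F : Type*} [Field F] [Fintype F] [DecidableEq F] :
    ((univ.filter (fun y : F => y ≠ 0 ∧ y ≠ 1)).card : ℤ) = Fintype.card F - 2 := by
  have h1 : (univ.filter (fun y : F => y ≠ 0 ∧ y ≠ 1)) = univ \ {0, 1} := by
    ext y; simp
  have h2 : ({0, 1} : Finset F).card = 2 := card_pair zero_ne_one
  have h3 : 2 ≤ Fintype.card F := by
    rw [← h2]; exact card_le_univ _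
  rw [h1, card_univ_sdiff, h2]
  omega

lemma sum_quadraticChar_discPoly {F : Type*} [Field F] [Fintype F] [DecidableEq F]
    (h2 : ringChar F ≠ 2) {a b : F} (ha : a ≠ 0) (hb : b ≠ 0) :
    ∑ u : F, quadraticChar F ((discPoly a b).eval u) = -1 := by
  have h1 : (∑ u, fiberCount a b u : ℤ) = Fintype.card F - 2 := by
    rw [← card_ne_zero_one, ← sum_fiberCount a b]
    push_cast
    rfl
  rw [sum_congr rfl (fun u _ => fiberCount_eq h2 ha hb u), sum_sub_distrib, sum_add_distrib] at h1
  simp only [sum_const, card_univ, nsmul_eq_mul, mul_one, sum_ite_eq', mem_univ, if_true] at h1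
  linarith

lemma abs_quadraticChar_le {F : Type*} [Field F] [Fintype F] [DecidableEq F] (x : F) :
    |quadraticChar F x| ≤ 1 := by
  by_cases hu : x = 0
  · simp [hu]
  · rcases quadraticChar_dichotomy hu with h | h <;> simp [h]

lemma abs_sum_fiberCount_mul_sub {p : ℕ} [Fact p.Prime] (hp2 : p ≠ 2) {a b a' b' : ZMod p}
    (ha : a ≠ 0) (hb : b ≠ 0) (ha' : a' ≠ 0) (hb' : b' ≠ 0)
    (hne : ¬ ((a = a' ∧ b = b') ∨ (a = b' ∧ b = a'))) :
    |((∑ u, fiberCount a b u * fiberCount a' b' u : ℕ) : ℝ) - p| ≤ 30 * √p + 7 := by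
  have h2 : ringChar (ZMod p) ≠ 2 := by rwa [ZMod.ringChar_zmod_n]
  have h2' : (2 : ZMod p) ≠ 0 := Ring.two_ne_zero h2
  have hd : (discPoly a b * discPoly a' b').natDegree ≤ 4 := by
    refine natDegree_mul_le.trans ?_
    have := discPoly_natDegree_le a b
    have := discPoly_natDegree_le a' b'
    omega
  have hS := abs_sum_quadraticChar_le hp2 _ hd (discPoly_mul_not_square h2' ha hb ha' hb' hne)
  set S : ℤ := ∑ u : ZMod p, quadraticChar (ZMod p) ((discPoly a b * discPoly a' b').eval u)
    with hSdef
  have key : ((∑ u, fiberCount a b u * fiberCount a' b' u : ℕ) : ℤ) =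
      p - 2 + S + (- (1 + quadraticChar (ZMod p) ((discPoly a b).eval 0)) -
        (1 + quadraticChar (ZMod p) ((discPoly a' b').eval 0)) + 1) := by
    have e : ∀ u : ZMod p, ((fiberCount a b u * fiberCount a' b' u : ℕ) : ℤ) =
        1 + quadraticChar (ZMod p) ((discPoly a b).eval u) +
        quadraticChar (ZMod p) ((discPoly a' b').eval u) +
        quadraticChar (ZMod p) ((discPoly a b * discPoly a' b').eval u) +
        if u = 0 then (- (1 + quadraticChar (ZMod p) ((discPoly a b).eval u)) -
        (1 + quadraticChar (ZMod p) ((discPoly a' b').eval u)) + 1) else 0 := by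
      intro u
      push_cast
      rw [fiberCount_eq h2 ha hb, fiberCount_eq h2 ha' hb', eval_mul, map_mul]
      split_ifs <;> ring
    rw [Nat.cast_sum, sum_congr rfl (fun u _ => e u)]
    simp only [sum_add_distrib]
    rw [sum_quadraticChar_discPoly h2 ha hb, sum_quadraticChar_discPoly h2 ha' hb', ← hSdef]
    simp [ZMod.card]
    ring
  have q1 := abs_quadraticChar_le ((discPoly a b).eval 0)
  have q2 := abs_quadraticChar_le ((discPoly a' b').eval 0)
  rw [abs_le] at q1 q2
  have hS' : |((∑ u, fiberCount a b u * fiberCount a' b' u : ℕ) : ℤ) - p - S| ≤ 7 := by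
    rw [key, abs_le]
    constructor <;> linarith [q1.1, q1.2, q2.1, q2.2]
  have hS'' : |((∑ u, fiberCount a b u * fiberCount a' b' u : ℕ) : ℝ) - p - (S : ℝ)| ≤ 7 := by
    exact_mod_cast hS'
  rw [abs_le] at hS hS'' ⊢
  constructor <;> linarith [hS.1, hS.2, hS''.1, hS''.2]

lemma sum_fiberCount_mul_le {p : ℕ} [Fact p.Prime] (hp2 : p ≠ 2) {a b a' b' : ZMod p}
    (ha : a ≠ 0) (hb : b ≠ 0) (ha' : a' ≠ 0) (hb' : b' ≠ 0) :
    ((∑ u, fiberCount a b u * fiberCount a' b' u : ℕ) : ℝ) ≤ 4 * p := by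
  have h2 : ringChar (ZMod p) ≠ 2 := by rwa [ZMod.ringChar_zmod_n]
  have hle : ∀ {x y : ZMod p}, x ≠ 0 → y ≠ 0 → ∀ u, fiberCount x y u ≤ 2 := by
    intro x y hx hy u
    have h1 := fiberCount_eq h2 hx hy u
    have h3 := abs_quadraticChar_le ((discPoly x y).eval u)
    rw [abs_le] at h3
    have : (fiberCount x y u : ℤ) ≤ 2 := by
      rw [h1]; split_ifs <;> linarith [h3.2]
    exact_mod_cast this
  have : (∑ u, fiberCount a b u * fiberCount a' b' u) ≤ 4 * p := by
    calc (∑ u, fiberCount a b u * fiberCount a' b' u) ≤ ∑ _u : ZMod p, 2 * 2 :=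
          sum_le_sum fun u _ => Nat.mul_le_mul (hle ha hb u) (hle ha' hb' u)
      _ = 4 * p := by simp [ZMod.card]; ring
  exact_mod_cast this

end AQK

namespace AQK

open Finset

/-- The part of the complete sum coming from two of the variables, with sum `s`. -/
noncomputable def halfSum {F : Type*} [Field F] [Fintype F] [DecidableEq F] (ψ : AddChar F ℂ)
    (a b s : F) : ℂ :=
  ∑ x : F with x ≠ 0 ∧ s - x ≠ 0, ψ (a * x⁻¹ + b * (s - x)⁻¹)

lemma Sig_eq_sum_halfSum {F : Type*} [Field F] [Fintype F] [DecidableEq F] (ψ : AddChar F ℂ)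
    (c : Fin 4 → F) : Sig ψ c = ∑ s, halfSum ψ (c 0) (c 1) s * halfSum ψ (c 2) (c 3) (-s) := by
  have h1 : ∑ s, halfSum ψ (c 0) (c 1) s * halfSum ψ (c 2) (c 3) (-s) =
      ∑ t : F × F × F with (t.2.1 ≠ 0 ∧ t.1 - t.2.1 ≠ 0) ∧ (t.2.2 ≠ 0 ∧ -t.1 - t.2.2 ≠ 0),
        ψ (c 0 * t.2.1⁻¹ + c 1 * (t.1 - t.2.1)⁻¹) * ψ (c 2 * t.2.2⁻¹ + c 3 * (-t.1 - t.2.2)⁻¹) := by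
    rw [sum_filter, Fintype.sum_prod_type]
    apply sum_congr rfl
    intro s _
    rw [halfSum, halfSum, sum_mul_sum, Fintype.sum_prod_type, sum_filter]
    apply sum_congr rfl
    intro x _
    rw [sum_filter]
    split_ifs with h
    · apply sum_congr rfl
      intro z _
      simp [h]
    · symm
      apply sum_eq_zero
      intro z _
      simp [h]
  rw [h1, Sig]
  refine sum_bij' (fun (x : Fin 4 → Fˣ) _ => ((x 0 : F) + x 1, (x 0 : F), (x 2 : F)))
    (fun t ht => ![Units.mk0 t.2.1 (mem_filter.1 ht).2.1.1,
      Units.mk0 (t.1 - t.2.1) (mem_filter.1 ht).2.1.2,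
      Units.mk0 t.2.2 (mem_filter.1 ht).2.2.1,
      Units.mk0 (-t.1 - t.2.2) (mem_filter.1 ht).2.2.2]) ?_ ?_ ?_ ?_ ?_
  · intro x hx
    rw [mem_filter, Fin.sum_univ_four] at hx
    have h3 : -((x 0 : F) + x 1) - x 2 = x 3 := by linear_combination -hx.2
    rw [mem_filter]
    refine ⟨mem_univ _, ⟨(x 0).ne_zero, ?_⟩, (x 2).ne_zero, ?_⟩
    · simp
    · show -((x 0 : F) + x 1) - x 2 ≠ 0
      rw [h3]; exact (x 3).ne_zero
  · intro t ht
    rw [mem_filter, Fin.sum_univ_four]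
    simp
  · intro x hx
    rw [mem_filter, Fin.sum_univ_four] at hx
    have h3 : -((x 0 : F) + x 1) - x 2 = x 3 := by linear_combination -hx.2
    ext i
    fin_cases i <;> simp
    linear_combination h3
  · intro t ht
    simp
  · intro x hx
    rw [mem_filter, Fin.sum_univ_four] at hx
    have h3 : -((x 0 : F) + x 1) - x 2 = x 3 := by linear_combination -hx.2
    rw [← AddChar.map_add_eq_mul, Fin.sum_univ_four]
    simp only [h3, add_sub_cancel_left, Units.val_inv_eq_inv_val]
    congr 1
    ring

lemma halfSum_zero {F : Type*} [Field F] [Fintype F] [DecidableEq F] {ψ : AddChar F ℂ}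
    (hψ : ψ.IsPrimitive) (a b : F) :
    halfSum ψ a b 0 = (if a = b then (Fintype.card F : ℂ) else 0) - 1 := by
  have h1 : halfSum ψ a b 0 = ∑ x : F with x ≠ 0, ψ ((a - b) * x) := by
    rw [halfSum]
    apply sum_nbij' (fun x => x⁻¹) (fun x => x⁻¹)
    · intro x hx; simp at hx ⊢; exact hx
    · intro x hx; simp at hx ⊢; exact hx
    · intro x _; simp
    · intro x _; simp
    · intro x _
      congr 1
      rw [zero_sub, inv_neg]
      ring
  have h2 := sum_primitive' hψ (a - b)
  rw [← sum_filter_add_sum_filter_not univ (fun x : F => x = 0)] at h2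
  rw [h1, eq_sub_iff_add_eq, add_comm]
  simp only [sub_eq_zero] at h2
  rw [← h2, filter_eq']
  simp

lemma halfSum_eq {F : Type*} [Field F] [Fintype F] [DecidableEq F] (ψ : AddChar F ℂ)
    (a b : F) {s : F} (hs : s ≠ 0) :
    halfSum ψ a b s = ∑ u, (fiberCount a b u : ℂ) * ψ (s⁻¹ * u) := by
  have h1 : halfSum ψ a b s =
      ∑ y : F with y ≠ 0 ∧ y ≠ 1, ψ (s⁻¹ * (a * y⁻¹ + b * (1 - y)⁻¹)) := by
    rw [halfSum]
    apply sum_nbij' (fun x => x / s) (fun y => y * s)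
    · intro x hx
      simp only [mem_filter, mem_univ, true_and] at hx ⊢
      refine ⟨div_ne_zero hx.1 hs, ?_⟩
      intro h
      rw [div_eq_one_iff_eq hs] at h
      exact hx.2 (by rw [h, sub_self])
    · intro y hy
      simp only [mem_filter, mem_univ, true_and] at hy ⊢
      refine ⟨mul_ne_zero hy.1 hs, ?_⟩
      have : s - y * s = (1 - y) * s := by ring
      rw [this]
      exact mul_ne_zero (sub_ne_zero.2 (Ne.symm hy.2)) hs
    · intro x _; field_simp
    · intro x _; field_simp
    · intro x hx
      simp only [mem_filter, mem_univ, true_and] at hx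
      obtain ⟨h0, h2⟩ := hx
      have e : 1 - x / s = (s - x) / s := by field_simp
      rw [e]
      congr 1
      field_simp
  rw [h1, ← sum_fiberwise (s := univ.filter (fun y : F => y ≠ 0 ∧ y ≠ 1))
    (g := fun y : F => a * y⁻¹ + b * (1 - y)⁻¹)]
  apply sum_congr rfl
  intro u _
  rw [filter_filter, fiberCount, ← nsmul_eq_mul]
  simp only [and_assoc]
  rw [← sum_const]
  apply sum_congr rfl
  intro y hy
  rw [(mem_filter.1 hy).2.2.2]

lemma sum_ne_zero_inv {F : Type*} [Field F] [Fintype F] [DecidableEq F] {ψ : AddChar F ℂ}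
    (hψ : ψ.IsPrimitive) (w : F) :
    ∑ s : F with s ≠ 0, ψ (s⁻¹ * w) = (if w = 0 then (Fintype.card F : ℂ) else 0) - 1 := by
  have h1 : ∑ s : F with s ≠ 0, ψ (s⁻¹ * w) = ∑ x : F with x ≠ 0, ψ (x * w) := by
    apply sum_nbij' (fun x => x⁻¹) (fun x => x⁻¹)
    · intro x hx; simp at hx ⊢; exact hx
    · intro x hx; simp at hx ⊢; exact hx
    · intro x _; simp
    · intro x _; simp
    · intro x _; rfl
  have h2 := sum_primitive hψ w
  rw [← sum_filter_add_sum_filter_not univ (fun x : F => x = 0)] at h2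
  rw [h1, eq_sub_iff_add_eq, add_comm, ← h2, filter_eq']
  simp

lemma Sig_eq_of_field {F : Type*} [Field F] [Fintype F] [DecidableEq F] {ψ : AddChar F ℂ}
    (hψ : ψ.IsPrimitive) (c : Fin 4 → F) :
    Sig ψ c = ((if c 0 = c 1 then (Fintype.card F : ℂ) else 0) - 1) *
      ((if c 2 = c 3 then (Fintype.card F : ℂ) else 0) - 1) +
      Fintype.card F * ((∑ u, fiberCount (c 0) (c 1) u * fiberCount (c 2) (c 3) u : ℕ) : ℂ) -
      (Fintype.card F - 2) ^ 2 := by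
  have hN : ∀ a b : F, (∑ u, (fiberCount a b u : ℂ)) = Fintype.card F - 2 := by
    intro a b
    rw [← Nat.cast_sum, sum_fiberCount]
    exact_mod_cast congrArg (Int.cast (R := ℂ)) (card_ne_zero_one (F := F))
  rw [Sig_eq_sum_halfSum, ← sum_filter_add_sum_filter_not univ (fun x : F => x = 0), filter_eq',
    if_pos (mem_univ _), sum_singleton, neg_zero, halfSum_zero hψ, halfSum_zero hψ, add_sub_assoc]
  congr 1
  have h1 : ∀ s ∈ univ.filter (fun s : F => ¬ s = 0),
      halfSum ψ (c 0) (c 1) s * halfSum ψ (c 2) (c 3) (-s) =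
      ∑ u, ∑ v, (fiberCount (c 0) (c 1) u : ℂ) * fiberCount (c 2) (c 3) v *
        ψ (s⁻¹ * (u - v)) := by
    intro s hs
    have hs0 : s ≠ 0 := (mem_filter.1 hs).2
    rw [halfSum_eq ψ _ _ hs0, halfSum_eq ψ _ _ (neg_ne_zero.2 hs0), sum_mul_sum]
    apply sum_congr rfl
    intro u _
    apply sum_congr rfl
    intro v _
    have : s⁻¹ * (u - v) = s⁻¹ * u + (-s)⁻¹ * v := by rw [inv_neg]; ring
    rw [this, AddChar.map_add_eq_mul]
    ring
  rw [sum_congr rfl h1, sum_comm]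
  have h2 : ∀ u : F, ∑ s : F with ¬ s = 0, ∑ v, (fiberCount (c 0) (c 1) u : ℂ) *
      fiberCount (c 2) (c 3) v * ψ (s⁻¹ * (u - v)) =
      Fintype.card F * ((fiberCount (c 0) (c 1) u : ℂ) * fiberCount (c 2) (c 3) u) -
        fiberCount (c 0) (c 1) u * ∑ v, (fiberCount (c 2) (c 3) v : ℂ) := by
    intro u
    rw [sum_comm]
    have h3 : ∀ v : F, ∑ s : F with ¬ s = 0, (fiberCount (c 0) (c 1) u : ℂ) *
      fiberCount (c 2) (c 3) v * ψ (s⁻¹ * (u - v)) =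
      (if u = v then Fintype.card F * ((fiberCount (c 0) (c 1) u : ℂ) *
        fiberCount (c 2) (c 3) v) else 0) -
        fiberCount (c 0) (c 1) u * (fiberCount (c 2) (c 3) v : ℂ) := by
      intro v
      rw [← mul_sum, sum_ne_zero_inv hψ]
      simp only [sub_eq_zero]
      split_ifs <;> ring
    rw [sum_congr rfl (fun v _ => h3 v), sum_sub_distrib, mul_sum]
    simp
  rw [sum_congr rfl (fun u _ => h2 u), sum_sub_distrib, ← mul_sum, ← sum_mul, hN, hN]
  push_cast
  ring

lemma norm_ite_card_sub_one_le {p : ℕ} [Fact p.Prime] (P : Prop) [Decidable P] :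
    ‖((if P then (p : ℂ) else 0) - 1)‖ ≤ if P then (p : ℝ) else 1 := by
  have h1 : (1 : ℝ) ≤ p := by exact_mod_cast (Fact.out : p.Prime).one_lt.le
  split_ifs
  · have : ((p : ℂ) - 1) = ((p - 1 : ℝ) : ℂ) := by push_cast; ring
    rw [this, Complex.norm_real, Real.norm_eq_abs, abs_of_nonneg (by linarith)]
    linarith
  · simp

lemma norm_Sig_prime_le_aux {p : ℕ} [Fact p.Prime] {ψ : AddChar (ZMod p) ℂ}
    (hψ : ψ.IsPrimitive) (c : Fin 4 → ZMod p) {A : ℝ}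
    (hA : |((∑ u, fiberCount (c 0) (c 1) u * fiberCount (c 2) (c 3) u : ℕ) : ℝ) - p| ≤ A) :
    ‖Sig ψ c‖ ≤ (if c 0 = c 1 then (p : ℝ) else 1) * (if c 2 = c 3 then (p : ℝ) else 1) +
      p * A + 4 * p := by
  have hp1 : (2 : ℝ) ≤ p := by exact_mod_cast (Fact.out : p.Prime).two_le
  rw [Sig_eq_of_field hψ, ZMod.card]
  set N := ∑ u, fiberCount (c 0) (c 1) u * fiberCount (c 2) (c 3) u
  have e : ∀ z : ℂ, z + (p : ℂ) * (N : ℂ) - ((p : ℂ) - 2) ^ 2 =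
      z + ((p * ((N : ℝ) - p) + (4 * p - 4) : ℝ) : ℂ) := by
    intro z; push_cast; ring
  rw [e]
  refine (norm_add_le _ _).trans ?_
  rw [norm_mul, Complex.norm_real, Real.norm_eq_abs, add_assoc]
  apply add_le_add
  · exact mul_le_mul (norm_ite_card_sub_one_le _) (norm_ite_card_sub_one_le _) (norm_nonneg _)
      (by split_ifs <;> linarith)
  · refine (abs_add_le _ _).trans ?_
    rw [abs_mul, abs_of_nonneg (by linarith : (0 : ℝ) ≤ p),
      abs_of_nonneg (by linarith : (0 : ℝ) ≤ 4 * p - 4)]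
    apply add_le_add
    · exact mul_le_mul_of_nonneg_left hA (by linarith)
    · linarith

lemma units_zmod_two_val (x : ZMod 2) (hx : x ≠ 0) : x = 1 := by
  revert x; decide

lemma norm_Sig_prime_le {p : ℕ} [Fact p.Prime] {ψ : AddChar (ZMod p) ℂ}
    (hψ : ψ.IsPrimitive) (c : Fin 4 → ZMod p) (hc : ∀ i, c i ≠ 0) :
    ‖Sig ψ c‖ ≤ 8 * (p : ℝ) ^ 2 := by
  have hp1 : (2 : ℝ) ≤ p := by exact_mod_cast (Fact.out : p.Prime).two_le
  by_cases hp2 : p = 2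
  · subst hp2
    refine (norm_sum_addChar_le _ _ _).trans ?_
    have : (univ.filter (fun x : Fin 4 → (ZMod 2)ˣ => ∑ i, (x i : ZMod 2) = 0)).card ≤ 32 := by
      refine (card_le_univ _).trans ?_
      rw [Fintype.card_fun, ZMod.card_units_eq_totient]
      simp
    norm_num
    exact_mod_cast this
  · have h1 := sum_fiberCount_mul_le hp2 (hc 0) (hc 1) (hc 2) (hc 3)
    have h2 := norm_Sig_prime_le_aux hψ c (A := 4 * p) (by
      rw [abs_le]
      constructor
      · have : (0 : ℝ) ≤ ((∑ u, fiberCount (c 0) (c 1) u * fiberCount (c 2) (c 3) u : ℕ) : ℝ) :=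
          Nat.cast_nonneg _
        linarith
      · linarith)
    refine h2.trans ?_
    split_ifs <;> nlinarith

lemma norm_Sig_prime_le_of_not_paired {p : ℕ} [Fact p.Prime] {ψ : AddChar (ZMod p) ℂ}
    (hψ : ψ.IsPrimitive) (c : Fin 4 → ZMod p) (hc : ∀ i, c i ≠ 0) (hpair : ¬ Paired c) :
    ‖Sig ψ c‖ ≤ 42 * ((p : ℝ) * √p) := by
  have hp1 : (2 : ℝ) ≤ p := by exact_mod_cast (Fact.out : p.Prime).two_le
  by_cases hp2 : p = 2
  · subst hp2
    exfalso
    apply hpair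
    left
    simp [fun i => units_zmod_two_val (c i) (hc i)]
  · simp only [Paired, not_or] at hpair
    have h2 := norm_Sig_prime_le_aux hψ c
      (abs_sum_fiberCount_mul_sub hp2 (hc 0) (hc 1) (hc 2) (hc 3) (by tauto))
    have hs : 1 ≤ √(p : ℝ) := Real.one_le_sqrt.2 (by linarith)
    have h3 : (if c 0 = c 1 then (p : ℝ) else 1) * (if c 2 = c 3 then (p : ℝ) else 1) ≤ p := by
      split_ifs
      · tauto
      · linarith
      · linarith
      · linarith
    nlinarith

end AQK

namespace AQK

open Finset

section

variable {R R₁ R₂ : Type*} [CommRing R] [CommRing R₁] [CommRing R₂]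

lemma condB_prod (e : R ≃+* R₁ × R₂) {b : Fin 4 → R} (h₁ : CondB fun i => (e (b i)).1)
    (h₂ : CondB fun i => (e (b i)).2) : CondB b := by
  obtain ⟨x, hx0, hx⟩ := h₁
  obtain ⟨y, hy0, hy⟩ := h₂
  have h : ∀ i, e (((unitsProd e).symm (x i, y i) : Rˣ) : R) = ((x i : R₁), (y i : R₂)) := by
    intro i
    refine Prod.ext ?_ ?_
    · rw [← unitsProd_fst, MulEquiv.apply_symm_apply]
    · rw [← unitsProd_snd, MulEquiv.apply_symm_apply]
  refine ⟨fun i => (unitsProd e).symm (x i, y i), e.injective ?_, fun i => e.injective ?_⟩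
  · rw [map_sum, map_zero]
    simp only [h]
    exact Prod.ext (by simpa [Prod.fst_sum] using hx0) (by simpa [Prod.snd_sum] using hy0)
  · simp only [map_mul, map_pow, h]
    exact Prod.ext (hx i) (hy i)

end

lemma condB_natCast_prod {ι : Type*} (s : Finset ι) (f : ι → ℕ)
    (hf : (s : Set ι).Pairwise fun i j => (f i).Coprime (f j)) (b : Fin 4 → ℕ)
    (h : ∀ i ∈ s, CondB fun j => (b j : ZMod (f i))) :
    CondB fun j => (b j : ZMod (∏ i ∈ s, f i)) := by
  classical
  induction s using Finset.induction_on with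
  | empty =>
    rw [prod_empty]
    exact ⟨fun _ => 1, Subsingleton.elim _ _, fun _ => Subsingleton.elim _ _⟩
  | insert a s ha ih =>
    rw [prod_insert ha]
    have hc : (f a).Coprime (∏ i ∈ s, f i) := Nat.Coprime.prod_right fun i hi =>
      hf (mem_insert_self a s) (mem_insert_of_mem hi) (by rintro rfl; exact ha hi)
    refine condB_prod (ZMod.chineseRemainder hc) ?_ ?_
    · simp only [map_natCast, Prod.fst_natCast]
      exact h a (mem_insert_self a s)
    · simp only [map_natCast, Prod.snd_natCast]
      exact ih (hf.mono (by simp)) fun i hi => h i (mem_insert_of_mem hi)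

open Classical in
/-- The local factor at `p` of the bound for the fourfold sum, where `k` is the exponent. -/
noncomputable def sigLocal (b : Fin 4 → ℕ) (p k : ℕ) : ℝ :=
  if k = 0 then 1
  else if k = 1 then
    if Paired fun i => (b i : ZMod p) then 8 * (p : ℝ) ^ 2 else 42 * ((p : ℝ) * √p)
  else if CondB fun i => (b i : ZMod (p ^ halfExp p k)) then 32 * ((p : ℝ) ^ k) ^ 2 else 0

lemma sigLocal_nonneg (b : Fin 4 → ℕ) (p k : ℕ) : 0 ≤ sigLocal b p k := by
  unfold sigLocal
  split_ifs <;> positivity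

lemma paired_of_mul_eq_one {R : Type*} [CommRing R] {b c : Fin 4 → R} (h : ∀ i, c i * b i = 1)
    (hp : Paired c) : Paired b := by
  have h1 : ∀ i j, c i = c j → b i = b j := by
    intro i j hij
    calc b i = b i * (c j * b j) := by rw [h, mul_one]
      _ = (c i * b i) * b j := by rw [hij]; ring
      _ = b j := by rw [h, one_mul]
  exact Or.imp (And.imp (h1 _ _) (h1 _ _)) (Or.imp (And.imp (h1 _ _) (h1 _ _))
    (And.imp (h1 _ _) (h1 _ _))) hp

lemma norm_Sig_prime_le_sigLocal {p : ℕ} (hp : p.Prime) (N : ℕ) (hN : N = p) [NeZero N]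
    {ψ : AddChar (ZMod N) ℂ} (hψ : ψ.IsPrimitive) {b : Fin 4 → ℕ} {c : Fin 4 → ZMod N}
    (hc : ∀ i, c i * (b i : ZMod N) = 1) : ‖Sig ψ c‖ ≤ sigLocal b p 1 := by
  subst hN
  have := Fact.mk hp
  have h0 : ∀ i, c i ≠ 0 := by
    intro i h
    have := hc i
    rw [h, zero_mul] at this
    exact zero_ne_one this
  unfold sigLocal
  rw [if_neg one_ne_zero, if_pos rfl]
  split_ifs with h
  · exact norm_Sig_prime_le hψ c h0
  · exact norm_Sig_prime_le_of_not_paired hψ c h0 fun hpr => h (paired_of_mul_eq_one hc hpr)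

lemma norm_Sig_primePow_le_sigLocal {p k : ℕ} (hp : p.Prime) (hk : 0 < k) [NeZero (p ^ k)]
    {ψ : AddChar (ZMod (p ^ k)) ℂ} (hψ : ψ.IsPrimitive) {b : Fin 4 → ℕ}
    {c : Fin 4 → ZMod (p ^ k)} (hc : ∀ i, c i * (b i : ZMod (p ^ k)) = 1) :
    ‖Sig ψ c‖ ≤ sigLocal b p k := by
  have := Fact.mk hp
  rcases (Nat.succ_le_of_lt hk).eq_or_lt with h1 | h1
  · have h2 : k = 1 := by omega
    subst h2
    exact norm_Sig_prime_le_sigLocal hp _ (pow_one p) hψ hc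
  · unfold sigLocal
    rw [if_neg (by omega), if_neg (by omega)]
    split_ifs with h
    · convert norm_Sig_primePow_le h1 hψ hc
    · by_contra h2
      refine h (condB_of_Sig_ne_zero h1 hψ hc ?_)
      intro h3
      refine h2 (le_of_eq ?_)
      rw [norm_eq_zero]
      convert h3

theorem norm_Sig_le_prod (q : ℕ) (hq : 0 < q) : ∀ [NeZero q] (ψ : AddChar (ZMod q) ℂ),
    ψ.IsPrimitive → ∀ (b : Fin 4 → ℕ) (c : Fin 4 → ZMod q), (∀ i, c i * (b i : ZMod q) = 1) →
      ‖Sig ψ c‖ ≤ q.factorization.prod (sigLocal b) := by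
  induction q using Nat.recOnPosPrimePosCoprime with
  | zero => exact absurd hq (lt_irrefl 0)
  | one =>
    intro _ ψ _ b c _
    rw [Nat.factorization_one, Finsupp.prod_zero_index]
    unfold Sig
    refine (norm_sum_addChar_le ψ _ _).trans ?_
    have : Fintype.card (Fin 4 → (ZMod 1)ˣ) = 1 := by
      rw [Fintype.card_pi, prod_const, ZMod.card_units_eq_totient]
      simp
    exact_mod_cast (card_le_univ _).trans this.le
  | prime_pow p k hp hk =>
    intro _ ψ hψ b c hc
    rw [hp.factorization_pow, Finsupp.prod_single_index (by simp [sigLocal])]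
    exact norm_Sig_primePow_le_sigLocal hp hk hψ hc
  | coprime a b' ha hb hab iha ihb =>
    intro _ ψ hψ b c hc
    have : NeZero a := ⟨by omega⟩
    have : NeZero b' := ⟨by omega⟩
    rw [Sig_prod (ZMod.chineseRemainder hab), norm_mul, Nat.factorization_mul_of_coprime hab,
      Finsupp.prod_add_index_of_disjoint
        (by simpa only [Nat.support_factorization] using hab.disjoint_primeFactors)]
    have hc' : ∀ i, ZMod.chineseRemainder hab (c i) * ((b i : ZMod a), (b i : ZMod b')) = 1 := by
      intro i
      have := congrArg (ZMod.chineseRemainder hab) (hc i)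
      rwa [map_mul, map_one, map_natCast] at this
    have h1 := iha (by omega) _ (isPrimitive_charFst (ZMod.chineseRemainder hab) hψ) b
      (fun i => (ZMod.chineseRemainder hab (c i)).1) fun i => congrArg Prod.fst (hc' i)
    have h2 := ihb (by omega) _ (isPrimitive_charSnd (ZMod.chineseRemainder hab) hψ) b
      (fun i => (ZMod.chineseRemainder hab (c i)).2) fun i => congrArg Prod.snd (hc' i)
    exact mul_le_mul h1 h2 (norm_nonneg _) (prod_nonneg fun _ _ => sigLocal_nonneg _ _ _)

end AQK

namespace AQK

open Finset

/-- The primes that divide `q` exactly once. -/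
def simplePrimes (q : ℕ) : Finset ℕ := q.primeFactors.filter fun p => q.factorization p = 1

/-- The primes whose square divides `q`. -/
def squarePrimes (q : ℕ) : Finset ℕ := q.primeFactors.filter fun p => q.factorization p ≠ 1

/-- The part of `q` made of the primes that divide it exactly once. -/
def simplePart (q : ℕ) : ℕ := ∏ p ∈ simplePrimes q, p

/-- The powerful part of `q`. -/
def squarePart (q : ℕ) : ℕ := ∏ p ∈ squarePrimes q, p ^ q.factorization p

/-- The modulus of the square condition attached to `q`. -/
def halfPart (q : ℕ) : ℕ := ∏ p ∈ squarePrimes q, p ^ halfExp p (q.factorization p)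

lemma two_le_factorization {q p : ℕ} (hp : p ∈ squarePrimes q) : 2 ≤ q.factorization p := by
  obtain ⟨h1, h2⟩ := mem_filter.1 hp
  have := (Nat.prime_of_mem_primeFactors h1).factorization_pos_of_dvd
    (Nat.mem_primeFactors.1 h1).2.2 (Nat.dvd_of_mem_primeFactors h1)
  omega

lemma prime_of_mem_squarePrimes {q p : ℕ} (hp : p ∈ squarePrimes q) : p.Prime :=
  Nat.prime_of_mem_primeFactors (mem_filter.1 hp).1

lemma prime_of_mem_simplePrimes {q p : ℕ} (hp : p ∈ simplePrimes q) : p.Prime :=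
  Nat.prime_of_mem_primeFactors (mem_filter.1 hp).1

lemma simplePart_mul_squarePart {q : ℕ} (hq : q ≠ 0) : simplePart q * squarePart q = q := by
  conv_rhs => rw [← Nat.prod_factorization_pow_eq_self hq]
  rw [Finsupp.prod, Nat.support_factorization,
    ← prod_filter_mul_prod_filter_not q.primeFactors (fun p => q.factorization p = 1)]
  congr 1
  refine prod_congr rfl fun p hp => ?_
  rw [(mem_filter.1 hp).2, pow_one]

lemma halfExp_le {p k : ℕ} (hk : 2 ≤ k) : halfExp p k ≤ k := by
  unfold halfExp
  split_ifs <;> omega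

lemma halfPart_dvd {q : ℕ} (hq : q ≠ 0) : halfPart q ∣ q := by
  refine Dvd.dvd.trans ?_ (Dvd.intro_left _ (simplePart_mul_squarePart hq))
  exact prod_dvd_prod_of_dvd _ _ fun p hp => pow_dvd_pow _ (halfExp_le (two_le_factorization hp))

lemma qring_eq (q : ℕ) :
    qring q = ∏ p ∈ squarePrimes q, if Odd (q.factorization p) then p else 1 := by
  unfold qring
  rw [← prod_filter]
  congr 1
  ext p
  simp only [squarePrimes, mem_filter]
  constructor
  · rintro ⟨h1, h2, h3⟩
    exact ⟨⟨h1, by omega⟩, h2⟩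
  · rintro ⟨⟨h1, h2⟩, h3⟩
    have := two_le_factorization (mem_filter.2 ⟨h1, h2⟩)
    obtain ⟨m, hm⟩ := h3
    exact ⟨h1, ⟨m, hm⟩, by omega⟩

lemma halfPart_sq_le (q : ℕ) : halfPart q ^ 2 ≤ squarePart q * qring q := by
  rw [qring_eq, halfPart, squarePart, ← prod_pow, ← prod_mul_distrib]
  refine prod_le_prod' fun p hp => ?_
  have hp1 := (prime_of_mem_squarePrimes hp).one_le
  rw [← pow_mul]
  split_ifs with h
  · rw [← pow_succ]
    refine pow_le_pow_right₀ hp1 ?_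
    unfold halfExp
    split_ifs <;> omega
  · rw [mul_one]
    refine pow_le_pow_right₀ hp1 ?_
    rw [Nat.not_odd_iff_even] at h
    obtain ⟨m, hm⟩ := h
    unfold halfExp
    split_ifs <;> omega

lemma squarePart_mul_qring_le (q : ℕ) :
    squarePart q * qring q ≤ 4 ^ q.primeFactors.card * halfPart q ^ 2 := by
  have h1 : squarePart q * qring q ≤ 4 ^ (squarePrimes q).card * halfPart q ^ 2 := by
    rw [qring_eq, halfPart, squarePart, ← prod_pow, ← prod_mul_distrib, ← prod_const,
      ← prod_mul_distrib]
    refine prod_le_prod' fun p hp => ?_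
    have hp1 := (prime_of_mem_squarePrimes hp).one_le
    set k := q.factorization p
    by_cases h2 : p = 2
    · subst h2
      have h4 : (4 : ℕ) = 2 ^ 2 := rfl
      rw [← pow_mul, h4, ← pow_add]
      have h3 : (if Odd k then 2 else 1) = 2 ^ (if Odd k then 1 else 0) := by
        split_ifs <;> rfl
      rw [h3, ← pow_add]
      refine pow_le_pow_right₀ hp1 ?_
      unfold halfExp
      rw [if_pos rfl]
      split_ifs with h
      · omega
      · rw [Nat.not_odd_iff_even] at h
        obtain ⟨m, hm⟩ := h
        omega
    · refine le_trans ?_ (Nat.le_mul_of_pos_left _ (by norm_num))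
      rw [← pow_mul]
      unfold halfExp
      rw [if_neg h2]
      split_ifs with h
      · rw [← pow_succ]
        obtain ⟨m, hm⟩ := h
        exact pow_le_pow_right₀ hp1 (by omega)
      · rw [mul_one]
        exact pow_le_pow_right₀ hp1 (by omega)
  refine h1.trans (Nat.mul_le_mul_right _ (pow_le_pow_right₀ (by norm_num) ?_))
  exact card_le_card (filter_subset _ _)

/-- Representatives of the three ways of splitting four indices into two pairs. -/
def pairPerm : Fin 3 → Equiv.Perm (Fin 4) :=
  ![1, Equiv.swap 1 2, Equiv.swap 1 3 * Equiv.swap 2 3]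

lemma paired_iff {R : Type*} (c : Fin 4 → R) : Paired c ↔ ∃ k : Fin 3,
    c (pairPerm k 0) = c (pairPerm k 1) ∧ c (pairPerm k 2) = c (pairPerm k 3) := by
  have h : ∀ i, pairPerm 0 i = ![0, 1, 2, 3] i := by decide
  have h' : ∀ i, pairPerm 1 i = ![0, 2, 1, 3] i := by decide
  have h'' : ∀ i, pairPerm 2 i = ![0, 3, 1, 2] i := by decide
  rw [Fin.exists_fin_succ, Fin.exists_fin_two]
  change _ ↔ _ ∨ (c (pairPerm 1 0) = _ ∧ _) ∨ (c (pairPerm 2 0) = _ ∧ _)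
  simp only [Paired]
  rfl

/-- The primes exactly dividing `q` modulo which the entries of `b` agree in pairs. -/
def pairPrimes (q : ℕ) (b : Fin 4 → ℕ) (k : Fin 3) : Finset ℕ :=
  (simplePrimes q).filter fun p => (b (pairPerm k 0) : ZMod p) = b (pairPerm k 1) ∧
    (b (pairPerm k 2) : ZMod p) = b (pairPerm k 3)

/-- The weight attached to a set of primes exactly dividing `q`. -/
noncomputable def primeWeight (q : ℕ) (A : Finset ℕ) : ℝ :=
  min √(simplePart q) (((∏ p ∈ A, p : ℕ) : ℝ) * √((∏ p ∈ A, p : ℕ) : ℝ))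

lemma primeWeight_nonneg (q : ℕ) (A : Finset ℕ) : 0 ≤ primeWeight q A :=
  le_min (Real.sqrt_nonneg _) (by positivity)

open Classical in
lemma prod_paired_le (q : ℕ) (b : Fin 4 → ℕ) :
    ∏ p ∈ simplePrimes q, (if Paired (fun i => (b i : ZMod p)) then √(p : ℝ) else 1) ≤
      ∑ k, primeWeight q (pairPrimes q b k) := by
  set U : ℕ := ∏ p ∈ simplePrimes q, if Paired (fun i => (b i : ZMod p)) then p else 1 with hU
  set e : Fin 3 → ℕ := fun k => ∏ p ∈ pairPrimes q b k, p with he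
  have h1 : ∏ p ∈ simplePrimes q, (if Paired (fun i => (b i : ZMod p)) then √(p : ℝ) else 1) =
      √(U : ℝ) := by
    rw [hU, Nat.cast_prod, Real.sqrt_prod]
    · refine prod_congr rfl fun p _ => ?_
      split_ifs <;> simp
    · intro p _
      positivity
  have h2 : U ≤ simplePart q := by
    refine prod_le_prod' fun p hp => ?_
    have := (prime_of_mem_simplePrimes hp).one_le
    split_ifs <;> omega
  have h3 : U ≤ ∏ k, e k := by
    simp only [he, pairPrimes, prod_filter]
    rw [prod_comm]
    refine prod_le_prod' fun p hp => ?_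
    have hp1 := (prime_of_mem_simplePrimes hp).one_le
    have h4 : ∀ k ∈ (univ : Finset (Fin 3)), 1 ≤ if (b (pairPerm k 0) : ZMod p) = b (pairPerm k 1) ∧
        (b (pairPerm k 2) : ZMod p) = b (pairPerm k 3) then p else 1 := by
      intro k _
      split_ifs <;> omega
    split_ifs with h
    · obtain ⟨k, hk⟩ := (paired_iff _).1 h
      refine le_trans ?_ (single_le_prod' h4 (mem_univ k))
      rw [if_pos hk]
    · exact one_le_prod'' fun k => h4 k (mem_univ k)
  obtain ⟨K, -, hK⟩ := exists_max_image (univ : Finset (Fin 3)) e univ_nonempty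
  have h5 : U ≤ e K ^ 3 := by
    refine h3.trans ((prod_le_pow_card _ _ _ hK).trans ?_)
    simp
  rw [h1]
  refine le_trans ?_ (single_le_sum (fun k _ => primeWeight_nonneg q (pairPrimes q b k))
    (mem_univ K))
  refine le_min (Real.sqrt_le_sqrt (by exact_mod_cast h2)) ?_
  have h6 : (U : ℝ) ≤ (e K : ℝ) ^ 2 * e K := by
    have : (U : ℝ) ≤ (e K : ℝ) ^ 3 := by exact_mod_cast h5
    rwa [← pow_succ]
  refine (Real.sqrt_le_sqrt h6).trans (le_of_eq ?_)
  rw [Real.sqrt_mul (by positivity), Real.sqrt_sq (by positivity)]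

open Classical in
theorem prod_sigLocal_le (q : ℕ) (b : Fin 4 → ℕ) :
    q.factorization.prod (sigLocal b) ≤ 42 ^ q.primeFactors.card *
      ((simplePart q : ℝ) * √(simplePart q) * (squarePart q : ℝ) ^ 2) *
      (if CondB (fun i => (b i : ZMod (halfPart q))) then
        ∑ k, primeWeight q (pairPrimes q b k) else 0) := by
  rw [Finsupp.prod, Nat.support_factorization]
  split_ifs with h
  · have h1 : ∀ p ∈ q.primeFactors, sigLocal b p (q.factorization p) ≤ 42 *
        (if q.factorization p = 1 then
          ((p : ℝ) * √p) * (if Paired (fun i => (b i : ZMod p)) then √(p : ℝ) else 1)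
        else ((p : ℝ) ^ q.factorization p) ^ 2) := by
      intro p hp
      have hv : q.factorization p ≠ 0 := Finsupp.mem_support_iff.1 hp
      have hs : √(p : ℝ) * √p = p := Real.mul_self_sqrt (Nat.cast_nonneg p)
      unfold sigLocal
      rw [if_neg hv]
      split_ifs with h1 h2 h2
      · rw [mul_assoc (p : ℝ), hs]
        nlinarith [sq_nonneg (p : ℝ)]
      · rw [mul_one]
      · gcongr
        norm_num
      · positivity
    refine (prod_le_prod (fun p _ => sigLocal_nonneg _ _ _) h1).trans ?_
    rw [prod_mul_distrib, prod_const, mul_assoc]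
    refine mul_le_mul_of_nonneg_left ?_ (by positivity)
    rw [prod_ite]
    change (∏ p ∈ simplePrimes q, _) * (∏ p ∈ squarePrimes q, _) ≤ _
    rw [prod_mul_distrib]
    have h2 : ∏ p ∈ simplePrimes q, ((p : ℝ) * √p) = (simplePart q : ℝ) * √(simplePart q) := by
      rw [prod_mul_distrib, simplePart, Nat.cast_prod, Real.sqrt_prod _ fun p _ => by positivity]
    have h3 : ∏ p ∈ squarePrimes q, ((p : ℝ) ^ q.factorization p) ^ 2 = (squarePart q : ℝ) ^ 2 := by
      rw [prod_pow, squarePart, Nat.cast_prod]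
      simp only [Nat.cast_pow]
    rw [h2, h3]
    calc _ = ((simplePart q : ℝ) * √(simplePart q) * (squarePart q : ℝ) ^ 2) *
          ∏ p ∈ simplePrimes q, (if Paired (fun i => (b i : ZMod p)) then √(p : ℝ) else 1) := by
            ring
      _ ≤ _ := mul_le_mul_of_nonneg_left (prod_paired_le q b) (by positivity)
  · rw [mul_zero]
    have h1 : ∃ p ∈ squarePrimes q,
        ¬ CondB fun i => (b i : ZMod (p ^ halfExp p (q.factorization p))) := by
      by_contra! h2
      refine h (condB_natCast_prod _ _ (fun p hp p' hp' hpp => ?_) b h2)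
      exact Nat.Coprime.pow _ _ ((Nat.coprime_primes (prime_of_mem_squarePrimes hp)
        (prime_of_mem_squarePrimes hp')).2 hpp)
    obtain ⟨p, hp, h2⟩ := h1
    refine (prod_eq_zero (mem_filter.1 hp).1 ?_).le
    have := two_le_factorization hp
    unfold sigLocal
    rw [if_neg (by omega), if_neg (by omega), if_neg h2]

end AQK

namespace AQK

open Finset

section

variable {ι : Type*} {e d : ℕ} [NeZero e] [NeZero d]

/-- The mean over `u` of the squared exponential sums attached to two residue-valued maps. -/
noncomputable def energy (χ : AddChar (ZMod e) ℂ) (ψ : AddChar (ZMod d) ℂ) (P : Finset ι)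
    (a : ι → ZMod e) (x : ι → ZMod d) (h : ZMod d) : ℝ :=
  (∑ u : ZMod e, ‖∑ y ∈ P, χ (u * a y) * ψ (h * x y)‖ ^ 2) / e

variable {χ : AddChar (ZMod e) ℂ} {ψ : AddChar (ZMod d) ℂ} (P : Finset ι)
    (a : ι → ZMod e) (x : ι → ZMod d)

omit [NeZero d] in
lemma energy_nonneg (h : ZMod d) : 0 ≤ energy χ ψ P a x h := by
  unfold energy; positivity

lemma energy_eq (hχ : χ.IsPrimitive) (h : ZMod d) :
    (energy χ ψ P a x h : ℂ) =
      ∑ y ∈ P, ∑ z ∈ P, if a y = a z then ψ (h * (x y - x z)) else 0 := by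
  have he : (e : ℂ) ≠ 0 := by exact_mod_cast NeZero.ne e
  unfold energy
  push_cast
  rw [div_eq_iff he, sum_mul]
  have h1 : ∀ u : ZMod e, ((‖∑ y ∈ P, χ (u * a y) * ψ (h * x y)‖ : ℝ) : ℂ) ^ 2 =
      ∑ y ∈ P, ∑ z ∈ P, χ (u * (a y - a z)) * ψ (h * (x y - x z)) := by
    intro u
    rw [← Complex.mul_conj', map_sum, sum_mul_sum]
    refine sum_congr rfl fun y _ => sum_congr rfl fun z _ => ?_
    rw [map_mul (starRingEnd ℂ), ← AddChar.map_neg_eq_conj, ← AddChar.map_neg_eq_conj, mul_sub, mul_sub,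
      sub_eq_add_neg, sub_eq_add_neg, AddChar.map_add_eq_mul, AddChar.map_add_eq_mul]
    ring
  rw [sum_congr rfl fun u _ => h1 u, sum_comm]
  refine sum_congr rfl fun y _ => ?_
  rw [sum_comm, sum_mul]
  refine sum_congr rfl fun z _ => ?_
  rw [← sum_mul, sum_primitive hχ, ZMod.card]
  simp only [sub_eq_zero]
  split_ifs <;> ring

lemma energy_le (hχ : χ.IsPrimitive) (h : ZMod d) :
    energy χ ψ P a x h ≤ #{w ∈ P ×ˢ P | a w.1 = a w.2} := by
  have h1 : energy χ ψ P a x h = ‖(energy χ ψ P a x h : ℂ)‖ := by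
    rw [Complex.norm_real, Real.norm_of_nonneg (energy_nonneg P a x h)]
  rw [h1, energy_eq P a x hχ, ← sum_product', ← sum_filter (fun w : ι × ι => a w.1 = a w.2)
    (fun w => ψ (h * (x w.1 - x w.2)))]
  exact norm_sum_addChar_le ψ _ _

lemma sum_energy_sq (hχ : χ.IsPrimitive) (hψ : ψ.IsPrimitive) :
    ∑ h, energy χ ψ P a x h ^ 2 =
      d * #{w ∈ (P ×ˢ P) ×ˢ (P ×ˢ P) | a w.1.1 = a w.1.2 ∧ a w.2.1 = a w.2.2 ∧
        x w.1.1 - x w.1.2 + (x w.2.1 - x w.2.2) = 0} := by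
  apply Complex.ofReal_injective
  push_cast
  have h1 : ∀ h, (energy χ ψ P a x h : ℂ) ^ 2 = ∑ w ∈ (P ×ˢ P) ×ˢ (P ×ˢ P),
      if a w.1.1 = a w.1.2 ∧ a w.2.1 = a w.2.2 then
        ψ (h * (x w.1.1 - x w.1.2 + (x w.2.1 - x w.2.2))) else 0 := by
    intro h
    rw [energy_eq P a x hχ, ← sum_product', pow_two, sum_mul_sum, ← sum_product']
    refine sum_congr rfl fun w _ => ?_
    rw [mul_add, AddChar.map_add_eq_mul]
    by_cases h1 : a w.1.1 = a w.1.2 <;> by_cases h2 : a w.2.1 = a w.2.2 <;> simp [h1, h2]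
  rw [sum_congr rfl fun h _ => h1 h, sum_comm, card_filter]
  push_cast
  rw [mul_sum]
  refine sum_congr rfl fun w _ => ?_
  by_cases h2 : a w.1.1 = a w.1.2 ∧ a w.2.1 = a w.2.2
  · rw [sum_congr rfl fun h _ => if_pos h2, sum_primitive hψ, ZMod.card]
    by_cases h3 : x w.1.1 - x w.1.2 + (x w.2.1 - x w.2.2) = 0
    · rw [if_pos h3, if_pos ⟨h2.1, h2.2, h3⟩, mul_one]
    · rw [if_neg h3, if_neg fun h => h3 h.2.2, mul_zero]
  · rw [sum_congr rfl fun h _ => if_neg h2, sum_const_zero, if_neg fun h => h2 ⟨h.1, h.2.1⟩,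
      mul_zero]

lemma sum_energy_mulHom {g d' : ℕ} [NeZero d'] (hd : d = g * d') (hχ : χ.IsPrimitive)
    (hψ : ψ.IsPrimitive) : ∑ h : ZMod d', energy χ ψ P a x (mulHom hd h) =
      d' * #{w ∈ P ×ˢ P | a w.1 = a w.2 ∧ (g : ZMod d) * (x w.1 - x w.2) = 0} := by
  apply Complex.ofReal_injective
  have hdvd : d' ∣ d := ⟨g, by rw [hd, mul_comm]⟩
  have hmul : ∀ (h : ZMod d') (z : ZMod d), ψ (mulHom hd h * z) =
      ψ.compAddMonoidHom (mulHom hd) (h * ZMod.castHom hdvd (ZMod d') z) := by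
    intro h z
    obtain ⟨b, rfl⟩ := ZMod.castHom_surjective hdvd h
    rw [AddChar.compAddMonoidHom_apply, ← map_mul, mulHom_castHom, mulHom_castHom, mul_assoc]
  have hz : ∀ z : ZMod d, ZMod.castHom hdvd (ZMod d') z = 0 ↔ (g : ZMod d) * z = 0 := by
    intro z
    rw [← mulHom_castHom hd hdvd, map_eq_zero_iff _ (mulHom_injective hd)]
  push_cast
  rw [sum_congr rfl fun h _ => (energy_eq P a x hχ (mulHom hd h)).trans (sum_product' ..).symm,
    sum_comm, card_filter]
  push_cast
  rw [mul_sum]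
  refine sum_congr rfl fun w _ => ?_
  by_cases h2 : a w.1 = a w.2
  · rw [sum_congr rfl fun h _ => (if_pos h2).trans (hmul h _),
      sum_primitive (isPrimitive_mulHom hd hψ), ZMod.card]
    by_cases h3 : (g : ZMod d) * (x w.1 - x w.2) = 0
    · rw [if_pos ((hz _).2 h3), if_pos ⟨h2, h3⟩, mul_one]
    · rw [if_neg fun h => h3 ((hz _).1 h), if_neg fun h => h3 h.2, mul_zero]
  · rw [sum_congr rfl fun h _ => if_neg h2, sum_const_zero, if_neg fun h => h2 h.1, mul_zero]

end

lemma sum_dvd_val_le {g d d' : ℕ} [NeZero d] [NeZero d'] (hd : d = g * d') {f : ZMod d → ℝ}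
    (hf : ∀ h, 0 ≤ f h) (s : Finset (ZMod d)) (hs : ∀ h ∈ s, g ∣ h.val) :
    ∑ h ∈ s, f h ≤ ∑ y : ZMod d', f (mulHom hd y) := by
  rw [← sum_image (s := univ) (g := mulHom hd) (fun _ _ _ _ h => mulHom_injective hd h)]
  refine sum_le_sum_of_subset_of_nonneg (fun h hh => ?_) fun _ _ _ => hf _
  obtain ⟨k, hk⟩ := hs h hh
  refine mem_image.2 ⟨(k : ZMod d'), mem_univ _, ?_⟩
  rw [mulHom_natCast, ← Nat.cast_mul, ← hk, ZMod.natCast_val, ZMod.cast_id]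

lemma card_range_cast_eq_le {m : ℕ} [NeZero m] (L : ℕ) (c : ZMod m) :
    (#{i ∈ range L | ((i : ℕ) : ZMod m) = c} : ℝ) ≤ L / m + 1 := by
  have hm : 0 < m := NeZero.pos m
  have h1 : #{i ∈ range L | ((i : ℕ) : ZMod m) = c} = L.count (· ≡ c.val [MOD m]) := by
    rw [Nat.count_eq_card_filter_range]
    congr 1
    refine filter_congr fun i _ => ?_
    rw [← ZMod.natCast_eq_natCast_iff, ZMod.natCast_val, ZMod.cast_id]
  rw [h1, Nat.count_modEq_card L hm]
  have h2 : ((L / m : ℕ) : ℝ) ≤ L / m := Nat.cast_div_le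
  push_cast
  split_ifs <;> linarith

end AQK

namespace AQK

open Finset

/-- The difference of a pair of natural numbers in `ZMod m`. -/
def pairDiff (m : ℕ) (t : ℕ × ℕ) : ZMod m := (t.1 : ZMod m) - (t.2 : ZMod m)

/-- Pairs of natural numbers below `L`. -/
def pairBox (L : ℕ) : Finset (ℕ × ℕ) := range L ×ˢ range L

lemma card_pairBox_eq_le {m : ℕ} [NeZero m] (L : ℕ) :
    (#{w ∈ pairBox L ×ˢ pairBox L | pairDiff m w.1 = pairDiff m w.2} : ℝ) ≤
      L ^ 3 * (L / m + 1) := by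
  have h1 : #{w ∈ pairBox L ×ˢ pairBox L | pairDiff m w.1 = pairDiff m w.2} ≤
      ∑ v ∈ range L ×ˢ pairBox L,
        #{i ∈ range L | ((i : ℕ) : ZMod m) = v.1 + pairDiff m v.2} := by
    rw [← card_sigma]
    refine card_le_card_of_injOn (fun w => ⟨(w.1.2, w.2), w.1.1⟩) (fun w hw => ?_)
      (fun w _ w' _ h => ?_)
    · obtain ⟨h1, h2⟩ := mem_filter.1 hw
      obtain ⟨h3, h4⟩ := mem_product.1 h1
      obtain ⟨h5, h6⟩ := mem_product.1 h3
      refine mem_sigma.2 ⟨mem_product.2 ⟨h6, h4⟩, mem_filter.2 ⟨h5, ?_⟩⟩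
      rw [← h2, pairDiff]
      ring
    · simp only [Sigma.mk.injEq, Prod.mk.injEq, heq_eq_eq] at h
      obtain ⟨⟨h1, h2⟩, h3⟩ := h
      exact Prod.ext (Prod.ext h3 h1) h2
  calc (_ : ℝ) ≤ ((∑ v ∈ range L ×ˢ pairBox L,
        #{i ∈ range L | ((i : ℕ) : ZMod m) = v.1 + pairDiff m v.2} : ℕ) : ℝ) := by exact_mod_cast h1
    _ ≤ ∑ v ∈ range L ×ˢ pairBox L, ((L : ℝ) / m + 1) := by
      push_cast
      exact sum_le_sum fun v _ => card_range_cast_eq_le L _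
    _ = _ := by
      rw [sum_const, card_product, pairBox, card_product, card_range, nsmul_eq_mul]
      push_cast
      ring

lemma intCast_eq_zero_of_coprime {e g d' : ℕ} {d : ℕ} [NeZero d] (hd : d = g * d')
    (hed : e.Coprime d) {z : ℤ} (h1 : (z : ZMod e) = 0) (h2 : (g : ZMod d) * z = 0) :
    (z : ZMod (e * d')) = 0 := by
  have hg : (g : ℤ) ≠ 0 := by
    rintro h
    have : g = 0 := by exact_mod_cast h
    exact NeZero.ne d (by rw [hd, this, zero_mul])
  rw [ZMod.intCast_zmod_eq_zero_iff_dvd] at h1 ⊢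
  have h3 : ((g * z : ℤ) : ZMod d) = 0 := by push_cast; exact h2
  rw [ZMod.intCast_zmod_eq_zero_iff_dvd, hd] at h3
  push_cast at h3 ⊢
  have h4 := (mul_dvd_mul_iff_left hg).1 h3
  refine IsCoprime.mul_dvd ?_ h1 h4
  exact Nat.isCoprime_iff_coprime.2 (hed.coprime_dvd_right ⟨g, by rw [hd, mul_comm]⟩)

lemma card_pairBox_eq_le' {e d g d' : ℕ} [NeZero e] [NeZero d] [NeZero d'] (hd : d = g * d')
    (hed : e.Coprime d) (L : ℕ) :
    (#{w ∈ pairBox L ×ˢ pairBox L | pairDiff e w.1 = pairDiff e w.2 ∧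
      (g : ZMod d) * (pairDiff d w.1 - pairDiff d w.2) = 0} : ℝ) ≤
      L ^ 3 * (L / (e * d') + 1) := by
  have h := card_pairBox_eq_le (m := e * d') L
  push_cast at h
  refine le_trans (Nat.cast_le.2 (card_le_card fun w hw => ?_)) h
  obtain ⟨h0, h1, h2⟩ := mem_filter.1 hw
  refine mem_filter.2 ⟨h0, ?_⟩
  have := intCast_eq_zero_of_coprime hd hed (z := (w.1.1 : ℤ) - w.1.2 - (w.2.1 - w.2.2))
    (by push_cast; rw [sub_eq_zero]; exact h1) (by push_cast; exact h2)
  push_cast at this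
  rw [sub_eq_zero] at this
  exact this

lemma card_range_eq_le' {e d g d' : ℕ} [NeZero e] [NeZero d] [NeZero d'] (hd : d = g * d')
    (hed : e.Coprime d) (L : ℕ) :
    (#{w ∈ range L ×ˢ range L | ((w.1 : ℕ) : ZMod e) = ((w.2 : ℕ) : ZMod e) ∧
      (g : ZMod d) * (-((w.1 : ℕ) : ZMod d) - -((w.2 : ℕ) : ZMod d)) = 0} : ℝ) ≤
      L * (L / (e * d') + 1) := by
  have h1 : #{w ∈ range L ×ˢ range L | ((w.1 : ℕ) : ZMod e) = ((w.2 : ℕ) : ZMod e) ∧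
      (g : ZMod d) * (-((w.1 : ℕ) : ZMod d) - -((w.2 : ℕ) : ZMod d)) = 0} ≤
      ∑ j ∈ range L, #{i ∈ range L | ((i : ℕ) : ZMod (e * d')) = j} := by
    rw [← card_sigma]
    refine card_le_card_of_injOn (fun w => ⟨w.2, w.1⟩) (fun w hw => ?_)
      (fun w _ w' _ h => ?_)
    · obtain ⟨h1, h2, h3⟩ := mem_filter.1 hw
      obtain ⟨h4, h5⟩ := mem_product.1 h1
      refine mem_sigma.2 ⟨h5, mem_filter.2 ⟨h4, ?_⟩⟩
      have := intCast_eq_zero_of_coprime hd hed (z := (w.1 : ℤ) - w.2)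
        (by push_cast; rw [sub_eq_zero]; exact h2) (by push_cast; linear_combination -h3)
      push_cast at this
      rw [sub_eq_zero] at this
      exact this
    · simp only [Sigma.mk.injEq, heq_eq_eq] at h
      exact Prod.ext h.2 h.1
  calc (_ : ℝ) ≤ ((∑ j ∈ range L, #{i ∈ range L | ((i : ℕ) : ZMod (e * d')) = j} : ℕ) : ℝ) := by
        exact_mod_cast h1
    _ ≤ ∑ j ∈ range L, ((L : ℝ) / (e * d' : ℕ) + 1) := by
      push_cast
      exact sum_le_sum fun v _ => by
        have := card_range_cast_eq_le (m := e * d') L (v : ZMod (e * d'))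
        push_cast at this
        exact this
    _ = _ := by
      rw [sum_const, card_range, nsmul_eq_mul]
      push_cast
      ring

section Solutions

variable {e d : ℕ} [NeZero e] [NeZero d]

/-- The number of square roots of `1` modulo `d`. -/
def sqrtOneCard (d : ℕ) [NeZero d] : ℕ := #{x : (ZMod d)ˣ | x ^ 2 = 1}

/-- The solutions of `b x² = κ` with `b` the difference of a pair in a box. -/
def solSet (L : ℕ) (κ : (ZMod d)ˣ) : Finset ((ℕ × ℕ) × (ZMod d)ˣ) :=
  (pairBox L ×ˢ univ).filter fun y => pairDiff d y.1 * (y.2 : ZMod d) ^ 2 = κ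

lemma card_sq_eq_le (b : ZMod d) (κ : (ZMod d)ˣ) :
    #{x : (ZMod d)ˣ | b * (x : ZMod d) ^ 2 = κ} ≤ sqrtOneCard d := by
  rcases (univ.filter fun x : (ZMod d)ˣ => b * (x : ZMod d) ^ 2 = κ).eq_empty_or_nonempty with
    h0 | ⟨x0, hx0⟩
  · rw [h0]; simp
  have hx0 := (mem_filter.1 hx0).2
  have hb : IsUnit b := isUnit_of_mul_isUnit_left (hx0 ▸ κ.isUnit)
  refine card_le_card_of_injOn (fun x => x * x0⁻¹) (fun x hx => ?_) (fun x _ y _ h => ?_)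
  · have hx := (mem_filter.1 hx).2
    refine mem_filter.2 ⟨mem_univ _, ?_⟩
    have h1 : (x : ZMod d) ^ 2 = (x0 : ZMod d) ^ 2 := hb.mul_left_cancel (hx.trans hx0.symm)
    have h2 : x ^ 2 = x0 ^ 2 := Units.ext (by push_cast; exact h1)
    rw [mul_pow, h2, inv_pow, mul_inv_cancel]
  · exact mul_right_cancel h

lemma energy_solSet_le {χ : AddChar (ZMod e) ℂ} {ψ : AddChar (ZMod d) ℂ} (hχ : χ.IsPrimitive)
    (L : ℕ) (κ : (ZMod d)ˣ) (h : ZMod d) :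
    energy χ ψ (solSet L κ) (fun y => pairDiff e y.1) (fun y => (y.2 : ZMod d)) h ≤
      L ^ 3 * (L / e + 1) * sqrtOneCard d ^ 2 := by
  classical
  refine (energy_le _ _ _ hχ h).trans ?_
  have h1 := card_le_mul_card_image
    (f := fun w : ((ℕ × ℕ) × (ZMod d)ˣ) × ((ℕ × ℕ) × (ZMod d)ˣ) => (w.1.1, w.2.1))
    ((solSet L κ ×ˢ solSet L κ).filter fun w => pairDiff e w.1.1 = pairDiff e w.2.1)
    (sqrtOneCard d ^ 2) (fun t _ => by
      have h2 := Nat.mul_le_mul (card_sq_eq_le (pairDiff d t.1) κ) (card_sq_eq_le (pairDiff d t.2) κ)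
      rw [← card_product, ← pow_two] at h2
      refine le_trans (card_le_card_of_injOn (fun w => (w.1.2, w.2.2)) (fun w hw => ?_)
        (fun w hw w' hw' h => ?_)) h2
      · obtain ⟨h3, rfl⟩ := mem_filter.1 hw
        obtain ⟨h4, h5⟩ := mem_product.1 (mem_filter.1 h3).1
        exact mem_product.2 ⟨mem_filter.2 ⟨mem_univ _, (mem_filter.1 h4).2⟩,
          mem_filter.2 ⟨mem_univ _, (mem_filter.1 h5).2⟩⟩
      · have h3 := (mem_filter.1 hw).2.trans (mem_filter.1 hw').2.symm
        simp only [Prod.mk.injEq] at h h3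
        exact Prod.ext (Prod.ext h3.1 h.1) (Prod.ext h3.2 h.2))
  have h2 : #(((solSet L κ ×ˢ solSet L κ).filter fun w => pairDiff e w.1.1 = pairDiff e w.2.1).image
      fun w => (w.1.1, w.2.1)) ≤
      #{w ∈ pairBox L ×ˢ pairBox L | pairDiff e w.1 = pairDiff e w.2} := by
    refine card_le_card fun t ht => ?_
    obtain ⟨w, hw, rfl⟩ := mem_image.1 ht
    obtain ⟨h3, h4⟩ := mem_filter.1 hw
    obtain ⟨h5, h6⟩ := mem_product.1 h3
    exact mem_filter.2 ⟨mem_product.2 ⟨(mem_product.1 (mem_filter.1 h5).1).1,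
      (mem_product.1 (mem_filter.1 h6).1).1⟩, h4⟩
  calc (_ : ℝ) ≤ ((sqrtOneCard d ^ 2 *
        #{w ∈ pairBox L ×ˢ pairBox L | pairDiff e w.1 = pairDiff e w.2} : ℕ) : ℝ) :=
        Nat.cast_le.2 (h1.trans (Nat.mul_le_mul_left _ h2))
    _ ≤ (sqrtOneCard d : ℝ) ^ 2 * (L ^ 3 * (L / e + 1)) := by
        push_cast
        exact mul_le_mul_of_nonneg_left (card_pairBox_eq_le L) (by positivity)
    _ = _ := by ring

lemma sum_card_solSet_le {g d' : ℕ} [NeZero d'] (hd : d = g * d') (hed : e.Coprime d) (L : ℕ) :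
    (∑ κ : (ZMod d)ˣ, (#{w ∈ solSet L κ ×ˢ solSet L κ | pairDiff e w.1.1 = pairDiff e w.2.1 ∧
      (g : ZMod d) * ((w.1.2 : ZMod d) - (w.2.2 : ZMod d)) = 0} : ℝ)) ≤
      sqrtOneCard d * (L ^ 3 * (L / (e * d') + 1) * d.totient) := by
  classical
  set T := univ.sigma fun κ : (ZMod d)ˣ => (solSet L κ ×ˢ solSet L κ).filter fun w =>
    pairDiff e w.1.1 = pairDiff e w.2.1 ∧
      (g : ZMod d) * ((w.1.2 : ZMod d) - (w.2.2 : ZMod d)) = 0 with hT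
  have hmem : ∀ s ∈ T, pairDiff d s.2.1.1 * (s.2.1.2 : ZMod d) ^ 2 = s.1 ∧
      pairDiff d s.2.2.1 * (s.2.2.2 : ZMod d) ^ 2 = s.1 ∧ s.2.1.1 ∈ pairBox L ∧
      s.2.2.1 ∈ pairBox L ∧ pairDiff e s.2.1.1 = pairDiff e s.2.2.1 ∧
      (g : ZMod d) * ((s.2.1.2 : ZMod d) - (s.2.2.2 : ZMod d)) = 0 := by
    intro s hs
    obtain ⟨h1, h2, h3⟩ := mem_filter.1 (mem_sigma.1 hs).2
    obtain ⟨h4, h5⟩ := mem_product.1 h1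
    obtain ⟨h6, h7⟩ := mem_filter.1 h4
    obtain ⟨h8, h9⟩ := mem_filter.1 h5
    exact ⟨h7, h9, (mem_product.1 h6).1, (mem_product.1 h8).1, h2, h3⟩
  have h1 := card_le_mul_card_image (f := fun s : (_ : (ZMod d)ˣ) ×
      (((ℕ × ℕ) × (ZMod d)ˣ) × ((ℕ × ℕ) × (ZMod d)ˣ)) => ((s.2.1.1, s.2.2.1), s.2.1.2)) T
    (sqrtOneCard d) (fun t ht => by
      obtain ⟨s0, hs0, rfl⟩ := mem_image.1 ht
      refine le_trans (card_le_card_of_injOn (fun s => s.2.2.2) (fun s hs => ?_)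
        (fun s hs s' hs' h => ?_)) (card_sq_eq_le (pairDiff d s0.2.2.1) s0.1)
      · obtain ⟨h2, h3⟩ := mem_filter.1 hs
        simp only [Prod.mk.injEq] at h3
        refine mem_filter.2 ⟨mem_univ _, ?_⟩
        rw [← h3.1.2, (hmem s h2).2.1, ← (hmem s h2).1, ← (hmem s0 hs0).1, h3.1.1, h3.2]
      · obtain ⟨h2, h3⟩ := mem_filter.1 hs
        obtain ⟨h4, h5⟩ := mem_filter.1 hs'
        have h6 := h3.trans h5.symm
        simp only [Prod.mk.injEq] at h6
        have e1 := hmem s h2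
        have e2 := hmem s' h4
        obtain ⟨κ, ⟨t1, x1⟩, ⟨t2, x2⟩⟩ := s
        obtain ⟨κ', ⟨t1', x1'⟩, ⟨t2', x2'⟩⟩ := s'
        simp only at h6 h e1 e2
        obtain ⟨⟨rfl, rfl⟩, rfl⟩ := h6
        subst h
        have : κ = κ' := Units.ext (e1.1.symm.trans e2.1)
        rw [this])
  have h2 : #(T.image fun s => ((s.2.1.1, s.2.2.1), s.2.1.2)) ≤
      #({w ∈ pairBox L ×ˢ pairBox L | pairDiff e w.1 = pairDiff e w.2 ∧
      (g : ZMod d) * (pairDiff d w.1 - pairDiff d w.2) = 0} ×ˢ (univ : Finset (ZMod d)ˣ)) := by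
    refine card_le_card fun t ht => ?_
    obtain ⟨s, hs, rfl⟩ := mem_image.1 ht
    obtain ⟨h1, h2, h3, h4, h5, h6⟩ := hmem s hs
    refine mem_product.2 ⟨mem_filter.2 ⟨mem_product.2 ⟨h3, h4⟩, h5, ?_⟩, mem_univ _⟩
    apply (s.2.1.2.isUnit.pow 2).mul_left_eq_zero.1
    linear_combination (g : ZMod d) * (h1 - h2) + (-pairDiff d s.2.2.1 *
      ((s.2.1.2 : ZMod d) + (s.2.2.2 : ZMod d))) * h6
  rw [card_product, card_univ, ZMod.card_units_eq_totient] at h2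
  have h3 : (∑ κ : (ZMod d)ˣ, (#{w ∈ solSet L κ ×ˢ solSet L κ | pairDiff e w.1.1 = pairDiff e w.2.1 ∧
      (g : ZMod d) * ((w.1.2 : ZMod d) - (w.2.2 : ZMod d)) = 0} : ℝ)) = (T.card : ℝ) := by
    rw [hT, card_sigma]; push_cast; rfl
  rw [h3]
  calc (T.card : ℝ) ≤ ((sqrtOneCard d * (_ * d.totient) : ℕ) : ℝ) :=
        Nat.cast_le.2 (h1.trans (Nat.mul_le_mul_left _ h2))
    _ ≤ _ := by
        push_cast
        have := card_pairBox_eq_le' hd hed L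
        gcongr

end Solutions

end AQK

namespace AQK

open Finset

section

variable {e d : ℕ} [NeZero e] [NeZero d]

/-- The squared modulus of a twisted geometric sum of length `L`. -/
noncomputable def fejer (χ : AddChar (ZMod e) ℂ) (ψ : AddChar (ZMod d) ℂ) (L : ℕ) (u : ZMod e)
    (n : ZMod d) : ℝ := ‖∑ i ∈ range L, χ (u * (i : ZMod e)) * ψ (n * -(i : ZMod d))‖ ^ 2

variable {χ : AddChar (ZMod e) ℂ} {ψ : AddChar (ZMod d) ℂ}

omit [NeZero e] [NeZero d] in
lemma fejer_nonneg (L : ℕ) (u : ZMod e) (n : ZMod d) : 0 ≤ fejer χ ψ L u n := by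
  unfold fejer; positivity

lemma fejer_eq (L : ℕ) (u : ZMod e) (n : ZMod d) : (fejer χ ψ L u n : ℂ) =
    ∑ t ∈ pairBox L, χ (u * pairDiff e t) * ψ (-(n * pairDiff d t)) := by
  unfold fejer
  push_cast
  rw [← Complex.mul_conj', map_sum, sum_mul_sum, ← sum_product']
  refine sum_congr rfl fun t _ => ?_
  rw [map_mul (starRingEnd ℂ), ← AddChar.map_neg_eq_conj, ← AddChar.map_neg_eq_conj,
    mul_mul_mul_comm, ← AddChar.map_add_eq_mul, ← AddChar.map_add_eq_mul, pairDiff, pairDiff]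
  congr 2 <;> ring

lemma sum_fejer_le (hψ : ψ.IsPrimitive) (L : ℕ) (u : ZMod e) :
    ∑ n, fejer χ ψ L u n ≤ L * (L + d) := by
  have hd : (0 : ℝ) < d := by exact_mod_cast NeZero.pos d
  have h1 := energy_le (χ := ψ) (ψ := χ) (range L) (fun i => -(i : ZMod d)) (fun i => (i : ZMod e))
    hψ u
  rw [energy, div_le_iff₀ hd] at h1
  have h2 : (#{w ∈ range L ×ˢ range L | -((w.1 : ℕ) : ZMod d) = -((w.2 : ℕ) : ZMod d)} : ℝ) ≤
      L * (L / d + 1) := by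
    have h3 := card_range_eq_le' (e := 1) (d := d) (g := 1) (d' := d) (one_mul d).symm
      (Nat.coprime_one_left d) L
    simp only [Nat.cast_one, one_mul] at h3
    refine le_trans (Nat.cast_le.2 (card_le_card fun w hw => ?_)) h3
    obtain ⟨h4, h5⟩ := mem_filter.1 hw
    exact mem_filter.2 ⟨h4, Subsingleton.elim _ _, by rw [h5, sub_self]⟩
  calc ∑ n, fejer χ ψ L u n = ∑ n : ZMod d, ‖∑ i ∈ range L, ψ (n * -(i : ZMod d)) *
        χ (u * (i : ZMod e))‖ ^ 2 := by
        refine sum_congr rfl fun n _ => ?_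
        rw [fejer]
        simp only [mul_comm (χ _)]
    _ ≤ L * (L / d + 1) * d := h1.trans (by gcongr)
    _ = _ := by field_simp

lemma sum_fejer_mulHom_le {g d' : ℕ} [NeZero d'] (hd : d = g * d') (hed : e.Coprime d)
    (hχ : χ.IsPrimitive) (hψ : ψ.IsPrimitive) (L : ℕ) :
    ∑ u, ∑ y : ZMod d', fejer χ ψ L u (mulHom hd y) ≤ L * (L + e * d') := by
  have he : (0 : ℝ) < e := by exact_mod_cast NeZero.pos e
  have hd' : (0 : ℝ) < d' := by exact_mod_cast NeZero.pos d'
  have h1 := sum_energy_mulHom (χ := χ) (ψ := ψ) (range L) (fun i => (i : ZMod e))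
    (fun i => -(i : ZMod d)) hd hχ hψ
  have h2 := card_range_eq_le' hd hed L
  rw [sum_comm]
  calc _ = e * ∑ y : ZMod d', energy χ ψ (range L) (fun i => (i : ZMod e))
          (fun i => -(i : ZMod d)) (mulHom hd y) := by
        rw [mul_sum]
        refine sum_congr rfl fun y _ => ?_
        rw [energy, mul_div_cancel₀ _ he.ne']
        rfl
    _ ≤ e * (d' * (L * (L / (e * d') + 1))) := by rw [h1]; gcongr
    _ = _ := by field_simp

lemma sum_solSet_eq (hψ : ψ.IsPrimitive) (L : ℕ) (κ : (ZMod d)ˣ) (h : ZMod d) (u : ZMod e) :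
    (d : ℂ) * ∑ y ∈ solSet L κ, χ (u * pairDiff e y.1) * ψ (h * (y.2 : ZMod d)) =
      ∑ n : ZMod d, unitSum ψ h (n * κ) * fejer χ ψ L u n := by
  have h1 : ∀ n : ZMod d, unitSum ψ h (n * κ) * fejer χ ψ L u n = ∑ y ∈ pairBox L ×ˢ (univ : Finset (ZMod d)ˣ),
      χ (u * pairDiff e y.1) * ψ (h * (y.2 : ZMod d)) *
        ψ (n * (κ * ((y.2⁻¹ : (ZMod d)ˣ) : ZMod d) ^ 2 - pairDiff d y.1)) := by
    intro n
    rw [fejer_eq, mul_comm, unitSum, sum_mul_sum, ← sum_product']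
    refine sum_congr rfl fun y _ => ?_
    rw [mul_sub, sub_eq_add_neg, AddChar.map_add_eq_mul, AddChar.map_add_eq_mul, ← mul_assoc n]
    ring
  rw [sum_congr rfl fun n _ => h1 n, sum_comm, solSet, sum_filter, mul_sum]
  refine sum_congr rfl fun y _ => ?_
  rw [← mul_sum, sum_primitive hψ, ZMod.card]
  have h2 : (κ : ZMod d) * ((y.2⁻¹ : (ZMod d)ˣ) : ZMod d) ^ 2 - pairDiff d y.1 = 0 ↔
      pairDiff d y.1 * (y.2 : ZMod d) ^ 2 = κ := by
    rw [sub_eq_zero]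
    have h3 : (y.2 : ZMod d) * ((y.2⁻¹ : (ZMod d)ˣ) : ZMod d) = 1 := y.2.mul_inv
    constructor
    · intro h
      rw [← h]
      linear_combination (κ : ZMod d) * ((y.2 : ZMod d) * ((y.2⁻¹ : (ZMod d)ˣ) : ZMod d) + 1) * h3
    · intro h
      rw [← h]
      linear_combination (pairDiff d y.1) *
        ((y.2 : ZMod d) * ((y.2⁻¹ : (ZMod d)ˣ) : ZMod d) + 1) * h3
  simp only [h2]
  split_ifs <;> ring

lemma norm_unitSum_sq_le_sum_divisors (hψ : ψ.IsPrimitive) (κ : (ZMod d)ˣ) (h n : ZMod d) :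
    ‖unitSum ψ h (n * κ)‖ ^ 2 ≤ 27 ^ d.primeFactors.card * d *
      ∑ δ ∈ (Nat.gcd h.val d).divisors with δ ∣ n.val, (δ : ℝ) := by
  have h1 := norm_unitSum_sq_le d (NeZero.pos d) ψ hψ h.val (n * κ).val
  rw [ZMod.natCast_val, ZMod.cast_id, ZMod.natCast_val, ZMod.cast_id] at h1
  refine h1.trans ?_
  rw [← mul_assoc]
  refine mul_le_mul_of_nonneg_left ?_ (by positivity)
  set G := Nat.gcd (h.val.gcd (n * κ : ZMod d).val) d with hG
  have hGd : G ∣ d := Nat.gcd_dvd_right _ _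
  have hGh : G ∣ h.val := (Nat.gcd_dvd_left _ _).trans (Nat.gcd_dvd_left _ _)
  have hGn : G ∣ (n * κ : ZMod d).val := (Nat.gcd_dvd_left _ _).trans (Nat.gcd_dvd_right _ _)
  have hcop : G.Coprime (κ : ZMod d).val :=
    ((ZMod.val_coe_unit_coprime κ).coprime_dvd_right hGd).symm
  have hGn' : G ∣ n.val := by
    rw [ZMod.val_mul, Nat.dvd_mod_iff hGd] at hGn
    exact hcop.dvd_of_dvd_mul_right hGn
  refine single_le_sum (f := fun δ : ℕ => (δ : ℝ)) (fun _ _ => Nat.cast_nonneg _)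
    (mem_filter.2 ⟨Nat.mem_divisors.2 ⟨Nat.dvd_gcd hGh hGd, ?_⟩, hGn'⟩)
  exact (Nat.gcd_pos_of_pos_right _ (NeZero.pos d)).ne'

lemma sum_fejer_unitSum_le (hed : e.Coprime d) (hχ : χ.IsPrimitive) (hψ : ψ.IsPrimitive) (L : ℕ)
    (κ : (ZMod d)ˣ) (h : ZMod d) :
    ∑ u, ∑ n, ‖unitSum ψ h (n * κ)‖ ^ 2 * fejer χ ψ L u n ≤ 27 ^ d.primeFactors.card * d *
      (d.divisors.card * (L * ((Nat.gcd h.val d : ℕ) * L + e * d))) := by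
  set g := Nat.gcd h.val d with hg
  have hgd : g ∣ d := Nat.gcd_dvd_right _ _
  have hg0 : 0 < g := Nat.gcd_pos_of_pos_right _ (NeZero.pos d)
  have h1 : ∀ δ ∈ g.divisors, (δ : ℝ) * ∑ u, ∑ n with δ ∣ n.val, fejer χ ψ L u n ≤
      L * (g * L + e * d) := by
    intro δ hδ
    have hδg := Nat.dvd_of_mem_divisors hδ
    obtain ⟨d', hd⟩ := hδg.trans hgd
    have : NeZero d' := ⟨by rintro rfl; exact NeZero.ne d (by rw [hd, mul_zero])⟩
    have h2 := sum_fejer_mulHom_le hd hed hχ hψ L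
    have h3 : ∑ u, ∑ n with δ ∣ n.val, fejer χ ψ L u n ≤ L * (L + e * d') :=
      le_trans (sum_le_sum fun u _ => sum_dvd_val_le hd (fun n => fejer_nonneg L u n) _
        fun n hn => (mem_filter.1 hn).2) h2
    have hδ' : (δ : ℝ) ≤ g := by exact_mod_cast Nat.le_of_dvd hg0 hδg
    have hdr : (d : ℝ) = δ * d' := by exact_mod_cast hd
    calc _ ≤ (δ : ℝ) * (L * (L + e * d')) := by gcongr
      _ = L * (δ * L + e * d) := by rw [hdr]; ring
      _ ≤ _ := by gcongr
  calc _ ≤ ∑ u, ∑ n, (27 ^ d.primeFactors.card * d *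
        ∑ δ ∈ g.divisors with δ ∣ n.val, (δ : ℝ)) * fejer χ ψ L u n := by
        gcongr with u _ n _
        · exact fejer_nonneg L u n
        · exact norm_unitSum_sq_le_sum_divisors hψ κ h n
    _ = 27 ^ d.primeFactors.card * d *
        ∑ δ ∈ g.divisors, (δ : ℝ) * ∑ u, ∑ n with δ ∣ n.val, fejer χ ψ L u n := by
        have e1 : ∀ δ : ℕ, (δ : ℝ) * ∑ u, ∑ n with δ ∣ n.val, fejer χ ψ L u n =
            ∑ u, ∑ n, if δ ∣ n.val then δ * fejer χ ψ L u n else 0 := by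
          intro δ
          simp only [sum_filter, mul_sum, mul_ite, mul_zero]
        conv_rhs => rw [sum_congr rfl fun δ _ => e1 δ, sum_comm, mul_sum]
        refine sum_congr rfl fun u _ => ?_
        conv_rhs => rw [sum_comm, mul_sum]
        refine sum_congr rfl fun n _ => ?_
        rw [mul_assoc, sum_filter, sum_mul]
        congr 1
        refine sum_congr rfl fun δ _ => ?_
        split_ifs <;> ring
    _ ≤ 27 ^ d.primeFactors.card * d * ∑ δ ∈ g.divisors, (L * (g * L + e * d) : ℝ) := by
        exact mul_le_mul_of_nonneg_left (sum_le_sum h1) (by positivity)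
    _ ≤ _ := by
        rw [sum_const, nsmul_eq_mul]
        gcongr
        exact (NeZero.ne d)

lemma energy_solSet_le' (hed : e.Coprime d) (hχ : χ.IsPrimitive) (hψ : ψ.IsPrimitive) (L : ℕ)
    (κ : (ZMod d)ˣ) (h : ZMod d) :
    energy χ ψ (solSet L κ) (fun y => pairDiff e y.1) (fun y => (y.2 : ZMod d)) h ≤
      27 ^ d.primeFactors.card * d.divisors.card * (L ^ 2 * (L + d)) *
        ((Nat.gcd h.val d : ℕ) * L / (e * d) + 1) := by
  have he : (0 : ℝ) < e := by exact_mod_cast NeZero.pos e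
  have hd : (0 : ℝ) < d := by exact_mod_cast NeZero.pos d
  have h1 : ∀ u : ZMod e, (d : ℝ) ^ 2 * ‖∑ y ∈ solSet L κ, χ (u * pairDiff e y.1) *
      ψ (h * (y.2 : ZMod d))‖ ^ 2 ≤ (L * (L + d)) *
        ∑ n, ‖unitSum ψ h (n * κ)‖ ^ 2 * fejer χ ψ L u n := by
    intro u
    have h2 : (d : ℝ) * ‖∑ y ∈ solSet L κ, χ (u * pairDiff e y.1) * ψ (h * (y.2 : ZMod d))‖ ≤
        ∑ n, ‖unitSum ψ h (n * κ)‖ * fejer χ ψ L u n := by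
      rw [← Complex.norm_natCast, ← norm_mul, sum_solSet_eq hψ]
      refine (norm_sum_le _ _).trans (sum_le_sum fun n _ => ?_)
      rw [norm_mul, Complex.norm_real, Real.norm_of_nonneg (fejer_nonneg L u n)]
    rw [← mul_pow]
    refine (pow_le_pow_left₀ (by positivity) h2 2).trans ?_
    refine (sum_sq_le_sum_mul_sum_of_sq_le_mul univ (f := fun n => fejer χ ψ L u n)
      (g := fun n => ‖unitSum ψ h (n * κ)‖ ^ 2 * fejer χ ψ L u n)
      (fun n _ => fejer_nonneg L u n)
      (fun n _ => mul_nonneg (by positivity) (fejer_nonneg L u n)) (fun n _ => le_of_eq (by ring))).trans ?_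
    refine mul_le_mul_of_nonneg_right (sum_fejer_le hψ L u) ?_
    exact sum_nonneg fun n _ => mul_nonneg (by positivity) (fejer_nonneg L u n)
  have h2 := sum_le_sum fun u (_ : u ∈ (univ : Finset (ZMod e))) => h1 u
  rw [← mul_sum, ← mul_sum] at h2
  have h3 := h2.trans (mul_le_mul_of_nonneg_left (sum_fejer_unitSum_le hed hχ hψ L κ h)
    (by positivity))
  rw [energy, div_le_iff₀ he]
  refine le_of_mul_le_mul_left (h3.trans_eq ?_) (pow_pos hd 2)
  field_simp

end

end AQK

namespace AQK

open Finset

section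

variable {e d : ℕ} [NeZero e] [NeZero d]

open Classical in
/-- Quadruples of pairs in a box whose differences satisfy the pairing congruences modulo `e` and
the square condition modulo `d`. -/
noncomputable def boxQuads (e d L : ℕ) : Finset (((ℕ × ℕ) × (ℕ × ℕ)) × ((ℕ × ℕ) × (ℕ × ℕ))) :=
  ((pairBox L ×ˢ pairBox L) ×ˢ (pairBox L ×ˢ pairBox L)).filter fun t =>
    pairDiff e t.1.1 = pairDiff e t.1.2 ∧ pairDiff e t.2.1 = pairDiff e t.2.2 ∧
    IsUnit (pairDiff d t.1.1) ∧
    CondB ![pairDiff d t.1.1, pairDiff d t.1.2, pairDiff d t.2.1, pairDiff d t.2.2]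

/-- Quadruples of solutions with vanishing alternating sum. -/
def solQuads (e d L : ℕ) [NeZero d] (κ : (ZMod d)ˣ) :=
  ((solSet L κ ×ˢ solSet L κ) ×ˢ (solSet L κ ×ˢ solSet L κ)).filter fun w =>
    pairDiff e w.1.1.1 = pairDiff e w.1.2.1 ∧ pairDiff e w.2.1.1 = pairDiff e w.2.2.1 ∧
    (w.1.1.2 : ZMod d) - (w.1.2.2 : ZMod d) + ((w.2.1.2 : ZMod d) - (w.2.2.2 : ZMod d)) = 0

omit [NeZero e] [NeZero d] in
lemma mem_boxQuads {L : ℕ} {t : ((ℕ × ℕ) × (ℕ × ℕ)) × ((ℕ × ℕ) × (ℕ × ℕ))} :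
    t ∈ boxQuads e d L ↔
      ((t.1.1 ∈ pairBox L ∧ t.1.2 ∈ pairBox L) ∧ (t.2.1 ∈ pairBox L ∧ t.2.2 ∈ pairBox L)) ∧
      pairDiff e t.1.1 = pairDiff e t.1.2 ∧ pairDiff e t.2.1 = pairDiff e t.2.2 ∧
      IsUnit (pairDiff d t.1.1) ∧
      CondB ![pairDiff d t.1.1, pairDiff d t.1.2, pairDiff d t.2.1, pairDiff d t.2.2] := by
  simp only [boxQuads, mem_filter, mem_product]

omit [NeZero e] in
lemma mem_solQuads {L : ℕ} {κ : (ZMod d)ˣ}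
    {w : (((ℕ × ℕ) × (ZMod d)ˣ) × ((ℕ × ℕ) × (ZMod d)ˣ)) ×
      (((ℕ × ℕ) × (ZMod d)ˣ) × ((ℕ × ℕ) × (ZMod d)ˣ))} :
    w ∈ solQuads e d L κ ↔
      ((w.1.1 ∈ solSet L κ ∧ w.1.2 ∈ solSet L κ) ∧ (w.2.1 ∈ solSet L κ ∧ w.2.2 ∈ solSet L κ)) ∧
      pairDiff e w.1.1.1 = pairDiff e w.1.2.1 ∧ pairDiff e w.2.1.1 = pairDiff e w.2.2.1 ∧
      (w.1.1.2 : ZMod d) - (w.1.2.2 : ZMod d) +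
        ((w.2.1.2 : ZMod d) - (w.2.2.2 : ZMod d)) = 0 := by
  simp only [solQuads, mem_filter, mem_product]

lemma mem_solSet {L : ℕ} {κ : (ZMod d)ˣ} {y : (ℕ × ℕ) × (ZMod d)ˣ} :
    y ∈ solSet L κ ↔ y.1 ∈ pairBox L ∧ pairDiff d y.1 * (y.2 : ZMod d) ^ 2 = κ := by
  simp [solSet]

omit [NeZero e] in
lemma totient_mul_card_boxQuads_le (L : ℕ) :
    d.totient * #(boxQuads e d L) ≤ ∑ κ : (ZMod d)ˣ, #(solQuads e d L κ) := by
  classical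
  have h1 : ∀ t ∈ boxQuads e d L, ∃ x : (ZMod d)ˣ × (ZMod d)ˣ × (ZMod d)ˣ × (ZMod d)ˣ,
      ∃ κ : (ZMod d)ˣ, pairDiff d t.1.1 * (x.1 : ZMod d) ^ 2 = κ ∧
      pairDiff d t.1.2 * (x.2.1 : ZMod d) ^ 2 = κ ∧
      pairDiff d t.2.1 * (x.2.2.1 : ZMod d) ^ 2 = κ ∧
      pairDiff d t.2.2 * (x.2.2.2 : ZMod d) ^ 2 = κ ∧
      (x.1 : ZMod d) - (x.2.1 : ZMod d) + ((x.2.2.1 : ZMod d) - (x.2.2.2 : ZMod d)) = 0 := by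
    intro t ht
    obtain ⟨-, -, -, ⟨b, hb⟩, x, hx0, hx⟩ := mem_boxQuads.1 ht
    have e1 := hx 1
    have e2 := hx 2
    have e3 := hx 3
    simp only [Fin.sum_univ_four, Matrix.cons_val] at hx0 e1 e2 e3
    refine ⟨(x 0, -x 1, x 2, -x 3), b * x 0 ^ 2, ?_⟩
    push_cast
    rw [hb]
    exact ⟨rfl, by rw [neg_sq, e1], e2, by rw [neg_sq, e3], by linear_combination hx0⟩
  choose! x κ h2 h3 h4 h5 h6 using h1
  rw [← card_sigma, ← ZMod.card_units_eq_totient, ← card_univ, ← card_product]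
  refine card_le_card_of_injOn (fun s => ⟨κ s.2 * s.1 ^ 2, (((s.2.1.1, (x s.2).1 * s.1),
    (s.2.1.2, (x s.2).2.1 * s.1)), ((s.2.2.1, (x s.2).2.2.1 * s.1),
    (s.2.2.2, (x s.2).2.2.2 * s.1)))⟩) (fun s hs => ?_) (fun s hs s' hs' h => ?_)
  · obtain ⟨v, t⟩ := s
    have ht : t ∈ boxQuads e d L := (mem_product.1 hs).2
    obtain ⟨⟨⟨h12, h13⟩, h14, h15⟩, h8, h9, -⟩ := mem_boxQuads.1 ht
    refine mem_sigma.2 ⟨mem_univ _, mem_solQuads.2 ⟨⟨⟨mem_solSet.2 ⟨h12, ?_⟩,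
      mem_solSet.2 ⟨h13, ?_⟩⟩, mem_solSet.2 ⟨h14, ?_⟩, mem_solSet.2 ⟨h15, ?_⟩⟩, h8, h9, ?_⟩⟩
    · push_cast
      rw [← h2 t ht]; ring
    · push_cast
      rw [← h3 t ht]; ring
    · push_cast
      rw [← h4 t ht]; ring
    · push_cast
      rw [← h5 t ht]; ring
    · push_cast
      linear_combination (v : ZMod d) * h6 t ht
  · obtain ⟨v, t⟩ := s
    obtain ⟨v', t'⟩ := s'
    simp only [Sigma.mk.injEq, heq_eq_eq, Prod.mk.injEq] at h
    obtain ⟨-, ⟨⟨h7, h8⟩, ⟨h9, -⟩⟩, ⟨h10, -⟩, ⟨h11, -⟩⟩ := h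
    have : t = t' := Prod.ext (Prod.ext h7 h9) (Prod.ext h10 h11)
    subst this
    rw [mul_left_cancel h8]

lemma card_boxQuads_le (hed : e.Coprime d) (L : ℕ) :
    (#(boxQuads e d L) : ℝ) ≤ d.divisors.card * (sqrtOneCard d * L ^ 3 *
      (L / (e * d) * (L ^ 3 * (L / e + 1) * sqrtOneCard d ^ 2) +
        27 ^ d.primeFactors.card * d.divisors.card * (L ^ 2 * (L + d)) * (L / (e * d) + 1))) := by
  have hχ := ZMod.isPrimitive_stdAddChar e
  have hψ := ZMod.isPrimitive_stdAddChar d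
  have he : (0 : ℝ) < e := by exact_mod_cast NeZero.pos e
  have hd : (0 : ℝ) < d := by exact_mod_cast NeZero.pos d
  have hφ : (0 : ℝ) < d.totient := by exact_mod_cast Nat.totient_pos.2 (NeZero.pos d)
  set E : (ZMod d)ˣ → ZMod d → ℝ := fun κ h => energy ZMod.stdAddChar ZMod.stdAddChar (solSet L κ)
    (fun y => pairDiff e y.1) (fun y => (y.2 : ZMod d)) h with hE
  have hE0 : ∀ κ h, 0 ≤ E κ h := fun κ h => energy_nonneg _ _ _ h
  set B₁ : ℝ := L ^ 3 * (L / e + 1) * sqrtOneCard d ^ 2 with hB₁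
  set B₂ : ℝ := 27 ^ d.primeFactors.card * d.divisors.card * (L ^ 2 * (L + d)) with hB₂
  have hB₁0 : 0 ≤ B₁ := by positivity
  have hB₂0 : 0 ≤ B₂ := by positivity
  have h1 : (d : ℝ) * ∑ κ : (ZMod d)ˣ, (#(solQuads e d L κ) : ℝ) = ∑ κ, ∑ h, E κ h ^ 2 := by
    rw [mul_sum]
    refine sum_congr rfl fun κ _ => ?_
    rw [hE]
    simp only
    rw [sum_energy_sq _ _ _ hχ hψ]
    rfl
  have h2 : ∀ g ∈ d.divisors, ∑ κ, ∑ h with Nat.gcd h.val d = g, E κ h ^ 2 ≤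
      d * (d.totient * (sqrtOneCard d * L ^ 3 * (L / (e * d) * B₁ + B₂ * (L / (e * d) + 1)))) := by
    intro g hg
    obtain ⟨d', hdg⟩ := Nat.dvd_of_mem_divisors hg
    have : NeZero d' := ⟨by rintro rfl; exact NeZero.ne d (by rw [hdg, mul_zero])⟩
    have hg0 : 0 < g := Nat.pos_of_mem_divisors hg
    have hg1 : (1 : ℝ) ≤ g := by exact_mod_cast hg0
    have hd' : (0 : ℝ) < d' := by exact_mod_cast NeZero.pos d'
    have hdr : (d : ℝ) = g * d' := by exact_mod_cast hdg
    set M : ℝ := min B₁ (B₂ * (g * L / (e * d) + 1)) with hM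
    have hM0 : 0 ≤ M := le_min hB₁0 (by positivity)
    have h3 : ∑ κ, ∑ h with Nat.gcd h.val d = g, E κ h ≤
        d' * (sqrtOneCard d * (L ^ 3 * (L / (e * d') + 1) * d.totient)) := by
      refine (sum_le_sum fun κ _ => sum_dvd_val_le hdg (hE0 κ) _ fun h hh => ?_).trans ?_
      · rw [← (mem_filter.1 hh).2]
        exact Nat.gcd_dvd_left _ _
      · rw [hE]
        simp only
        rw [sum_congr rfl fun κ _ => sum_energy_mulHom _ _ _ hdg hχ hψ, ← mul_sum]
        exact mul_le_mul_of_nonneg_left (sum_card_solSet_le hdg hed L) hd'.le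
    have h4 : ∀ κ, ∀ h ∈ univ.filter (fun h : ZMod d => Nat.gcd h.val d = g), E κ h ^ 2 ≤ M * E κ h := by
      intro κ h hh
      rw [pow_two]
      refine mul_le_mul_of_nonneg_right (le_min (energy_solSet_le hχ L κ h) ?_) (hE0 κ h)
      have := energy_solSet_le' hed hχ hψ L κ h
      rwa [(mem_filter.1 hh).2] at this
    calc _ ≤ ∑ κ, ∑ h with Nat.gcd h.val d = g, M * E κ h :=
          sum_le_sum fun κ _ => sum_le_sum (h4 κ)
      _ = M * ∑ κ, ∑ h with Nat.gcd h.val d = g, E κ h := by simp only [mul_sum]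
      _ ≤ M * (d' * (sqrtOneCard d * (L ^ 3 * (L / (e * d') + 1) * d.totient))) := by gcongr
      _ = d * (d.totient * (sqrtOneCard d * L ^ 3 * (L / (e * d) * M + M / g))) := by
          rw [hdr]; field_simp
      _ ≤ _ := by
          have h5 : M / g ≤ B₂ * (L / (e * d) + 1) := by
            rw [div_le_iff₀ (by linarith)]
            refine (min_le_right _ _).trans ?_
            have h7 : (g : ℝ) * L / (e * d) = L / (e * d) * g := by ring
            calc B₂ * (g * L / (e * d) + 1) ≤ B₂ * ((L / (e * d) + 1) * g) :=
                  mul_le_mul_of_nonneg_left (by rw [h7]; nlinarith) hB₂0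
              _ = B₂ * (L / (e * d) + 1) * g := (mul_assoc _ _ _).symm
          have h6 : M ≤ B₁ := min_le_left _ _
          gcongr
  have h3 : ∑ κ, ∑ h, E κ h ^ 2 = ∑ g ∈ d.divisors, ∑ κ, ∑ h with Nat.gcd h.val d = g, E κ h ^ 2 := by
    conv_rhs => rw [sum_comm]
    refine sum_congr rfl fun κ _ => ?_
    refine (sum_fiberwise_of_maps_to (fun h _ => ?_) _).symm
    exact Nat.mem_divisors.2 ⟨Nat.gcd_dvd_right _ _, NeZero.ne d⟩
  have h4 := sum_le_sum h2
  rw [← h3, ← h1, sum_const, nsmul_eq_mul] at h4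
  have h5 : (d.totient : ℝ) * #(boxQuads e d L) ≤ ∑ κ : (ZMod d)ˣ, (#(solQuads e d L κ) : ℝ) := by
    exact_mod_cast totient_mul_card_boxQuads_le L
  refine le_of_mul_le_mul_left ?_ (mul_pos hd hφ)
  calc (d * d.totient : ℝ) * #(boxQuads e d L) = d * (d.totient * #(boxQuads e d L)) := by ring
    _ ≤ _ := (mul_le_mul_of_nonneg_left h5 hd.le).trans h4
    _ = _ := by ring

end

end AQK

namespace AQK

open Finset

section

variable {e d : ℕ} [NeZero e] [NeZero d]

/-- Quadruples from a set that satisfy the pairing congruences modulo `e` and the square condition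
modulo `d`. -/
def PairCond (e d : ℕ) (t : (ℕ × ℕ) × (ℕ × ℕ)) : Prop :=
  (t.1.1 : ZMod e) = t.1.2 ∧ (t.2.1 : ZMod e) = t.2.2 ∧
    CondB ![(t.1.1 : ZMod d), (t.1.2 : ZMod d), (t.2.1 : ZMod d), (t.2.2 : ZMod d)]

omit [NeZero e] [NeZero d] in
lemma pow_mul_card_pairCond_le {N : ℕ} {S : Finset ℕ} (hS : ∀ b ∈ S, b ≤ N ∧ b.Coprime d)
    {P : Finset ((ℕ × ℕ) × (ℕ × ℕ))} (hP : ∀ t ∈ P, t ∈ (S ×ˢ S) ×ˢ (S ×ˢ S) ∧ PairCond e d t) :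
    N ^ 4 * #P ≤ #(boxQuads e d (2 * N)) := by
  have h0 : #(((range N ×ˢ range N) ×ˢ (range N ×ˢ range N)) ×ˢ P) = N ^ 4 * #P := by
    simp only [card_product, card_range]
    ring
  have h1 : ∀ (m b j : ℕ), pairDiff m (b + j, j) = b := by
    intro m b j
    simp [pairDiff]
  have h2 : ∀ b j, b ∈ S → j < N → (b + j, j) ∈ pairBox (2 * N) := by
    intro b j hb hj
    have := (hS b hb).1
    simp only [pairBox, mem_product, mem_range]
    omega
  rw [← h0]
  refine card_le_card_of_injOn (fun s => (((s.2.1.1 + s.1.1.1, s.1.1.1),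
    (s.2.1.2 + s.1.1.2, s.1.1.2)), ((s.2.2.1 + s.1.2.1, s.1.2.1),
    (s.2.2.2 + s.1.2.2, s.1.2.2)))) (fun s hs => ?_) (fun s hs s' hs' h => ?_)
  · obtain ⟨hj, ht⟩ := mem_product.1 hs
    obtain ⟨hS', h3, h4, h5⟩ := hP _ ht
    simp only [mem_product, mem_range] at hj hS'
    refine mem_boxQuads.2 ⟨⟨⟨h2 _ _ hS'.1.1 hj.1.1, h2 _ _ hS'.1.2 hj.1.2⟩,
      h2 _ _ hS'.2.1 hj.2.1, h2 _ _ hS'.2.2 hj.2.2⟩, ?_⟩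
    simp only [h1]
    exact ⟨h3, h4, (ZMod.isUnit_iff_coprime _ _).2 (hS _ hS'.1.1).2, h5⟩
  · obtain ⟨⟨⟨a, b⟩, c, f⟩, ⟨x, y⟩, z, w⟩ := s
    obtain ⟨⟨⟨a', b'⟩, c', f'⟩, ⟨x', y'⟩, z', w'⟩ := s'
    simp only [Prod.mk.injEq] at h ⊢
    omega

lemma one_le_sqrtOneCard (d : ℕ) [NeZero d] : 1 ≤ sqrtOneCard d :=
  card_pos.2 ⟨1, by simp⟩

lemma count_arith {τ ρ W L e d : ℝ} (hτ : 1 ≤ τ) (hρ : 1 ≤ ρ) (hW : 1 ≤ W) (hL : 0 ≤ L)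
    (he : 1 ≤ e) (hd : 1 ≤ d) :
    τ * (ρ * L ^ 3 * (L / (e * d) * (L ^ 3 * (L / e + 1) * ρ ^ 2) +
        W * τ * (L ^ 2 * (L + d)) * (L / (e * d) + 1))) ≤
      3 * (ρ ^ 3 * τ ^ 2 * W) * L ^ 4 * (L ^ 4 / (e ^ 2 * d) + L ^ 2 + L * d) := by
  have hWτ : 1 ≤ W * τ := one_le_mul_of_one_le_of_one_le hW hτ
  have hρ2 : 1 ≤ ρ ^ 2 := one_le_pow₀ hρ
  have h1 : L / (e * d) * (L ^ 3 * (L / e + 1) * ρ ^ 2) ≤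
      (W * τ * ρ ^ 2) * (L / (e * d) * (L ^ 3 * (L / e + 1))) := by
    have : 0 ≤ L / (e * d) * (L ^ 3 * (L / e + 1)) * ρ ^ 2 := by positivity
    nlinarith
  have h2 : W * τ * (L ^ 2 * (L + d)) * (L / (e * d) + 1) ≤
      (W * τ * ρ ^ 2) * ((L ^ 2 * (L + d)) * (L / (e * d) + 1)) := by
    have : 0 ≤ W * τ * (L ^ 2 * (L + d)) * (L / (e * d) + 1) := by positivity
    nlinarith
  have h3 : L / (e * d) * (L ^ 3 * (L / e + 1)) + (L ^ 2 * (L + d)) * (L / (e * d) + 1) =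
      L * (L ^ 4 / (e ^ 2 * d) + 2 * (L ^ 3 / (e * d)) + L ^ 2 + L ^ 2 / e + L * d) := by
    field_simp
    ring
  have h4 : 2 * (L ^ 3 / (e * d)) ≤ L ^ 4 / (e ^ 2 * d) + L ^ 2 / d := by
    have : 0 ≤ (L ^ 2 / e - L) ^ 2 / d := by positivity
    have h : (L ^ 2 / e - L) ^ 2 / d = L ^ 4 / (e ^ 2 * d) + L ^ 2 / d - 2 * (L ^ 3 / (e * d)) := by
      field_simp
      ring
    linarith
  have h5 : L ^ 2 / d ≤ L ^ 2 := div_le_self (by positivity) hd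
  have h6 : L ^ 2 / e ≤ L ^ 2 := div_le_self (by positivity) he
  have h7 : 0 ≤ L ^ 4 / (e ^ 2 * d) := by positivity
  have h8 : 0 ≤ L * d := by positivity
  have hτ0 : 0 ≤ τ := by linarith
  have hρ0 : 0 ≤ ρ := by linarith
  have hW0 : 0 ≤ W := by linarith
  calc _ ≤ τ * (ρ * L ^ 3 * ((W * τ * ρ ^ 2) * (L / (e * d) * (L ^ 3 * (L / e + 1))) +
        (W * τ * ρ ^ 2) * ((L ^ 2 * (L + d)) * (L / (e * d) + 1)))) := by gcongr
    _ = (ρ ^ 3 * τ ^ 2 * W) * L ^ 4 *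
        (L ^ 4 / (e ^ 2 * d) + 2 * (L ^ 3 / (e * d)) + L ^ 2 + L ^ 2 / e + L * d) := by
      rw [← mul_add, h3]
      ring
    _ ≤ (ρ ^ 3 * τ ^ 2 * W) * L ^ 4 * (3 * (L ^ 4 / (e ^ 2 * d) + L ^ 2 + L * d)) := by
      refine mul_le_mul_of_nonneg_left ?_ (by positivity)
      linarith
    _ = _ := by ring

lemma card_pairCond_le (hed : e.Coprime d) {N : ℕ} (hN : 0 < N) {S : Finset ℕ}
    (hS : ∀ b ∈ S, b ≤ N ∧ b.Coprime d) {P : Finset ((ℕ × ℕ) × (ℕ × ℕ))}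
    (hP : ∀ t ∈ P, t ∈ (S ×ˢ S) ×ˢ (S ×ˢ S) ∧ PairCond e d t) :
    (#P : ℝ) ≤ 768 * ((sqrtOneCard d : ℝ) ^ 3 * (d.divisors.card : ℝ) ^ 2 *
      27 ^ d.primeFactors.card) * (N ^ 4 / (e ^ 2 * d) + N ^ 2 + N * d) := by
  have he : (1 : ℝ) ≤ e := by exact_mod_cast NeZero.one_le
  have hd : (1 : ℝ) ≤ d := by exact_mod_cast NeZero.one_le
  have hN' : (0 : ℝ) < N := by exact_mod_cast hN
  have hτ : (1 : ℝ) ≤ d.divisors.card := by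
    exact_mod_cast card_pos.2 ⟨1, Nat.one_mem_divisors.2 (NeZero.ne d)⟩
  have hρ : (1 : ℝ) ≤ sqrtOneCard d := by exact_mod_cast one_le_sqrtOneCard d
  have hW : (1 : ℝ) ≤ 27 ^ d.primeFactors.card := one_le_pow₀ (by norm_num)
  have h1 : ((N : ℝ) ^ 4 * #P) ≤ #(boxQuads e d (2 * N)) := by
    exact_mod_cast pow_mul_card_pairCond_le hS hP
  have h2 := h1.trans (card_boxQuads_le hed (2 * N))
  have h3 := h2.trans (count_arith hτ hρ hW (Nat.cast_nonneg _) he hd)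
  push_cast at h3
  set K : ℝ := (sqrtOneCard d : ℝ) ^ 3 * (d.divisors.card : ℝ) ^ 2 * 27 ^ d.primeFactors.card
  have hK : 0 ≤ K := by positivity
  refine le_of_mul_le_mul_left (h3.trans ?_) (pow_pos hN' 4)
  have h4 : (2 * N : ℝ) ^ 4 / (e ^ 2 * d) + (2 * N) ^ 2 + 2 * N * d ≤
      16 * (N ^ 4 / (e ^ 2 * d) + N ^ 2 + N * d) := by
    have : (2 * N : ℝ) ^ 4 / (e ^ 2 * d) = 16 * (N ^ 4 / (e ^ 2 * d)) := by ring
    rw [this]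
    have : 0 ≤ (N : ℝ) * d := by positivity
    nlinarith
  calc _ ≤ 3 * K * (2 * N : ℝ) ^ 4 * (16 * (N ^ 4 / (e ^ 2 * d) + N ^ 2 + N * d)) := by gcongr
    _ = _ := by ring

end

end AQK

namespace AQK

open Finset

lemma sqrtOneCard_le (d : ℕ) (hd : 0 < d) : ∀ [NeZero d], sqrtOneCard d ≤ 4 ^ d.primeFactors.card := by
  induction d using Nat.recOnPosPrimePosCoprime with
  | zero => exact absurd hd (lt_irrefl 0)
  | one =>
    intro _
    refine (card_le_univ _).trans ?_
    rw [ZMod.card_units_eq_totient]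
    simp
  | prime_pow p k hp hk =>
    intro _
    have := Fact.mk hp
    rw [Nat.primeFactors_prime_pow hk.ne' hp, card_singleton, pow_one]
    refine (card_le_card_of_injOn (fun x => x) (fun x hx => ?_) fun _ _ _ _ h => h).trans
      (card_unit_sq_le (k := k) 0 1 1)
    have hx' := (mem_filter.1 hx).2
    refine mem_filter.2 ⟨mem_univ _, ?_⟩
    rw [Units.val_one, one_mul, ← Units.val_pow_eq_pow_val, inv_pow, hx', inv_one, Units.val_one,
      sub_self, mul_zero]
  | coprime a b ha hb hab iha ihb =>
    intro _
    have : NeZero a := ⟨by omega⟩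
    have : NeZero b := ⟨by omega⟩
    rw [card_primeFactors_mul hab, pow_add]
    refine le_trans ?_ (Nat.mul_le_mul (iha (by omega)) (ihb (by omega)))
    unfold sqrtOneCard
    rw [← card_product]
    refine card_le_card_of_injOn (unitsProd (ZMod.chineseRemainder hab)) (fun x hx => ?_)
      (unitsProd (ZMod.chineseRemainder hab)).injective.injOn
    have h := congrArg (unitsProd (ZMod.chineseRemainder hab)) (mem_filter.1 hx).2
    rw [map_pow, map_one] at h
    exact mem_product.2 ⟨mem_filter.2 ⟨mem_univ _, congrArg Prod.fst h⟩,
      mem_filter.2 ⟨mem_univ _, congrArg Prod.snd h⟩⟩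

end AQK

namespace AQK

open Finset

/-- A quadruple given as a pair of pairs, as a function on `Fin 4`. -/
def quadFun (t : (ℕ × ℕ) × (ℕ × ℕ)) : Fin 4 → ℕ := ![t.1.1, t.1.2, t.2.1, t.2.2]

/-- The entries of a quadruple arranged according to one of the three pairings. -/
def quadPerm (k : Fin 3) (t : (ℕ × ℕ) × (ℕ × ℕ)) : (ℕ × ℕ) × (ℕ × ℕ) :=
  ((quadFun t (pairPerm k 0), quadFun t (pairPerm k 1)),
    (quadFun t (pairPerm k 2), quadFun t (pairPerm k 3)))

lemma quadFun_quadPerm (k : Fin 3) (t : (ℕ × ℕ) × (ℕ × ℕ)) :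
    quadFun (quadPerm k t) = quadFun t ∘ pairPerm k := by
  ext i
  fin_cases i <;> rfl

lemma quadFun_injective : Function.Injective quadFun := by
  rintro ⟨⟨a, b⟩, c, d⟩ ⟨⟨a', b'⟩, c', d'⟩ h
  have h0 : a = a' := congrFun h 0
  have h1 : b = b' := congrFun h 1
  have h2 : c = c' := congrFun h 2
  have h3 : d = d' := congrFun h 3
  rw [h0, h1, h2, h3]

lemma quadPerm_injective (k : Fin 3) : Function.Injective (quadPerm k) := by
  intro t t' h
  refine quadFun_injective ((pairPerm k).surjective.injective_comp_right ?_)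
  simpa only [quadFun_quadPerm] using congrArg quadFun h

lemma quadFun_mem {S : Finset ℕ} {t : (ℕ × ℕ) × (ℕ × ℕ)} (ht : t ∈ (S ×ˢ S) ×ˢ (S ×ˢ S))
    (i : Fin 4) : quadFun t i ∈ S := by
  simp only [mem_product] at ht
  fin_cases i
  exacts [ht.1.1, ht.1.2, ht.2.1, ht.2.2]

lemma quadPerm_mem (k : Fin 3) {S : Finset ℕ} {t : (ℕ × ℕ) × (ℕ × ℕ)}
    (ht : t ∈ (S ×ˢ S) ×ˢ (S ×ˢ S)) : quadPerm k t ∈ (S ×ˢ S) ×ˢ (S ×ˢ S) := by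
  simp only [quadPerm, mem_product]
  exact ⟨⟨quadFun_mem ht _, quadFun_mem ht _⟩, quadFun_mem ht _, quadFun_mem ht _⟩

lemma CondB.comp_perm {A : Type*} [CommRing A] {b : Fin 4 → A} (h : CondB b)
    (σ : Equiv.Perm (Fin 4)) : CondB (b ∘ σ) := by
  obtain ⟨x, hx0, hx⟩ := h
  refine ⟨x ∘ σ, ?_, fun i => ?_⟩
  · rw [← hx0]
    exact Equiv.sum_comp σ fun i => (x i : A)
  · exact (hx _).trans (hx _).symm

lemma natCast_eq_prod {A : Finset ℕ} (hA : ∀ p ∈ A, p.Prime) {a b : ℕ}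
    (h : ∀ p ∈ A, (a : ZMod p) = b) : (a : ZMod (∏ p ∈ A, p)) = b := by
  rw [ZMod.natCast_eq_natCast_iff, Nat.modEq_iff_dvd, Nat.cast_prod]
  refine prod_dvd_of_coprime (fun p hp p' hp' hpp => ?_) fun p hp => ?_
  · exact Nat.isCoprime_iff_coprime.2 ((Nat.coprime_primes (hA p hp) (hA p' hp')).2 hpp)
  · exact Nat.modEq_iff_dvd.1 ((ZMod.natCast_eq_natCast_iff _ _ _).1 (h p hp))

lemma coprime_halfPart {q : ℕ} {A : Finset ℕ} (hA : A ⊆ simplePrimes q) :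
    (∏ p ∈ A, p).Coprime (halfPart q) := by
  refine Nat.Coprime.prod_left fun p hp => Nat.Coprime.prod_right fun p' hp' => ?_
  refine Nat.Coprime.pow_right _ ((Nat.coprime_primes (prime_of_mem_simplePrimes (hA hp))
    (prime_of_mem_squarePrimes hp')).2 ?_)
  rintro rfl
  exact (mem_filter.1 hp').2 (mem_filter.1 (hA hp)).2

/-- The arithmetic constant of the counting bound. -/
noncomputable def countConst (q : ℕ) : ℝ :=
  768 * (1728 ^ q.primeFactors.card * (q.divisors.card : ℝ) ^ 2)

lemma countConst_nonneg (q : ℕ) : 0 ≤ countConst q := by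
  unfold countConst
  positivity

lemma count_le_countConst {q d : ℕ} (hq : q ≠ 0) (hd : d ∣ q) [NeZero d] :
    768 * ((sqrtOneCard d : ℝ) ^ 3 * (d.divisors.card : ℝ) ^ 2 * 27 ^ d.primeFactors.card) ≤
      countConst q := by
  have h1 : (sqrtOneCard d : ℝ) ≤ 4 ^ q.primeFactors.card := by
    have h := sqrtOneCard_le d (NeZero.pos d)
    have h' := pow_le_pow_right₀ (show 1 ≤ 4 by norm_num)
      (card_le_card (Nat.primeFactors_mono hd hq))
    exact_mod_cast h.trans h'
  have h2 : (d.divisors.card : ℝ) ≤ q.divisors.card := by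
    exact_mod_cast card_le_card (Nat.divisors_subset_of_dvd hq hd)
  have h3 : (27 : ℝ) ^ d.primeFactors.card ≤ 27 ^ q.primeFactors.card :=
    pow_le_pow_right₀ (by norm_num) (card_le_card (Nat.primeFactors_mono hd hq))
  have h4 : (1728 : ℝ) ^ q.primeFactors.card =
      (4 ^ q.primeFactors.card) ^ 3 * 27 ^ q.primeFactors.card := by
    rw [← pow_mul, mul_comm _ 3, pow_mul, ← mul_pow]
    norm_num
  rw [countConst, h4]
  calc _ ≤ 768 * (((4 : ℝ) ^ q.primeFactors.card) ^ 3 * (q.divisors.card : ℝ) ^ 2 *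
        27 ^ q.primeFactors.card) := by gcongr
    _ = _ := by ring

open Classical in
lemma weight_mul_card_le {q N : ℕ} (hq : q ≠ 0) (hN : 0 < N) {S : Finset ℕ}
    (hS : ∀ b ∈ S, b ≤ N ∧ b.Coprime q) (k : Fin 3) {A : Finset ℕ} (hA : A ⊆ simplePrimes q) :
    primeWeight q A * #{t ∈ (S ×ˢ S) ×ˢ (S ×ˢ S) |
      CondB (fun i => (quadFun t i : ZMod (halfPart q))) ∧ pairPrimes q (quadFun t) k = A} ≤
      countConst q * (N ^ 4 / halfPart q + N ^ 2 * √(simplePart q) +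
        N * halfPart q * √(simplePart q)) := by
  set F := {t ∈ (S ×ˢ S) ×ˢ (S ×ˢ S) |
      CondB (fun i => (quadFun t i : ZMod (halfPart q))) ∧ pairPrimes q (quadFun t) k = A} with hF
  set e := ∏ p ∈ A, p with he
  set d := halfPart q with hd
  have hAp : ∀ p ∈ A, p.Prime := fun p hp => prime_of_mem_simplePrimes (hA hp)
  have hdq : d ∣ q := halfPart_dvd hq
  have he0 : NeZero e := ⟨prod_ne_zero_iff.2 fun p hp => (hAp p hp).ne_zero⟩
  have hd0 : NeZero d := ⟨fun h => hq (by rw [h] at hdq; exact zero_dvd_iff.1 hdq)⟩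
  have h1 : ∀ t ∈ F.image (quadPerm k), t ∈ (S ×ˢ S) ×ˢ (S ×ˢ S) ∧ PairCond e d t := by
    intro t' ht'
    obtain ⟨t, ht, rfl⟩ := mem_image.1 ht'
    obtain ⟨h2, h3, h4⟩ := mem_filter.1 ht
    have h5 : ∀ p ∈ A, (quadFun t (pairPerm k 0) : ZMod p) = quadFun t (pairPerm k 1) ∧
        (quadFun t (pairPerm k 2) : ZMod p) = quadFun t (pairPerm k 3) := by
      intro p hp
      rw [← h4] at hp
      exact (mem_filter.1 hp).2
    refine ⟨quadPerm_mem k h2, natCast_eq_prod hAp fun p hp => (h5 p hp).1,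
      natCast_eq_prod hAp fun p hp => (h5 p hp).2, ?_⟩
    convert h3.comp_perm (pairPerm k) using 1
    ext i
    fin_cases i <;> rfl
  have h2 := card_pairCond_le (coprime_halfPart hA) hN
    (fun b hb => ⟨(hS b hb).1, (hS b hb).2.coprime_dvd_right hdq⟩) h1
  rw [card_image_of_injective _ (quadPerm_injective k)] at h2
  have h3 := h2.trans (mul_le_mul_of_nonneg_right (count_le_countConst hq hdq) (by positivity))
  have he1 : (1 : ℝ) ≤ e := by exact_mod_cast NeZero.one_le
  have hd1 : (1 : ℝ) ≤ d := by exact_mod_cast NeZero.one_le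
  set w := primeWeight q A with hw
  have hw0 : 0 ≤ w := primeWeight_nonneg q A
  have hw1 : w ≤ √(simplePart q) := min_le_left _ _
  have hw2 : w ≤ (e : ℝ) ^ 2 := by
    refine (min_le_right _ _).trans ?_
    rw [pow_two]
    refine mul_le_mul_of_nonneg_left ?_ (Nat.cast_nonneg _)
    rw [Real.sqrt_le_left (Nat.cast_nonneg _)]
    nlinarith
  calc w * #F ≤ w * (countConst q * (N ^ 4 / (e ^ 2 * d) + N ^ 2 + N * d)) := by gcongr
    _ = countConst q * (w / e ^ 2 * (N ^ 4 / d) + N ^ 2 * w + N * d * w) := by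
      field_simp
    _ ≤ countConst q * (1 * (N ^ 4 / d) + N ^ 2 * √(simplePart q) +
          N * d * √(simplePart q)) := by
      have hw3 : w / e ^ 2 ≤ 1 := by
        rw [div_le_one (by positivity)]
        exact hw2
      have := countConst_nonneg q
      gcongr
    _ = _ := by rw [one_mul]

open Classical in
theorem sum_weights_le {q N : ℕ} (hq : q ≠ 0) (hN : 0 < N) {S : Finset ℕ}
    (hS : ∀ b ∈ S, b ≤ N ∧ b.Coprime q) :
    ∑ t ∈ (S ×ˢ S) ×ˢ (S ×ˢ S), (if CondB (fun i => (quadFun t i : ZMod (halfPart q))) then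
      ∑ k, primeWeight q (pairPrimes q (quadFun t) k) else 0) ≤
      3 * 2 ^ q.primeFactors.card * (countConst q * (N ^ 4 / halfPart q +
        N ^ 2 * √(simplePart q) + N * halfPart q * √(simplePart q))) := by
  set X : ℝ := countConst q * (N ^ 4 / halfPart q +
        N ^ 2 * √(simplePart q) + N * halfPart q * √(simplePart q)) with hX
  have hX0 : 0 ≤ X := mul_nonneg (countConst_nonneg q) (by positivity)
  rw [← sum_filter, sum_comm]
  have h1 : ∀ k ∈ (univ : Finset (Fin 3)), ∑ t ∈ (S ×ˢ S) ×ˢ (S ×ˢ S) with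
      CondB (fun i => (quadFun t i : ZMod (halfPart q))),
        primeWeight q (pairPrimes q (quadFun t) k) ≤ 2 ^ q.primeFactors.card * X := by
    intro k _
    rw [← sum_fiberwise_of_maps_to (t := (simplePrimes q).powerset)
      (g := fun t => pairPrimes q (quadFun t) k)
      fun t _ => mem_powerset.2 (filter_subset _ _)]
    have h2 : ∀ A ∈ (simplePrimes q).powerset, ∑ t ∈ ((S ×ˢ S) ×ˢ (S ×ˢ S)).filter
        (fun t => CondB (fun i => (quadFun t i : ZMod (halfPart q)))) with
          pairPrimes q (quadFun t) k = A, primeWeight q (pairPrimes q (quadFun t) k) ≤ X := by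
      intro A hA
      rw [sum_congr rfl fun t ht => by rw [(mem_filter.1 ht).2], sum_const, nsmul_eq_mul, mul_comm,
        filter_filter]
      exact weight_mul_card_le hq hN hS k (mem_powerset.1 hA)
    refine (sum_le_card_nsmul _ _ _ h2).trans ?_
    rw [nsmul_eq_mul, card_powerset]
    refine mul_le_mul_of_nonneg_right ?_ hX0
    push_cast
    exact pow_le_pow_right₀ (by norm_num) (card_le_card (filter_subset _ _))
  refine (sum_le_card_nsmul _ _ _ h1).trans (le_of_eq ?_)
  rw [card_univ, Fintype.card_fin, nsmul_eq_mul]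
  push_cast
  ring

end AQK

namespace AQK

open Finset

variable {q : ℕ} [NeZero q]

lemma eInt_eq (x : ℤ) : eInt q x = ZMod.stdAddChar (x : ZMod q) := (ZMod.stdAddChar_coe x).symm

lemma natCast_invMod (b : ℤ) : (invMod q b : ZMod q) = (b : ZMod q)⁻¹ := by
  rw [invMod, ZMod.natCast_zmod_val]

lemma Kloos_eq (a b : ℤ) : Kloos q a b = ∑ x : (ZMod q)ˣ, ZMod.stdAddChar
    ((a : ZMod q) * (x : ZMod q) + (b : ZMod q) * ((x⁻¹ : (ZMod q)ˣ) : ZMod q)) := by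
  unfold Kloos
  refine sum_bij' (fun x hx => ZMod.unitOfCoprime x (mem_filter.1 hx).2)
    (fun u _ => (u : ZMod q).val) (fun x _ => mem_univ _) (fun u _ => ?_) (fun x hx => ?_)
    (fun u _ => ?_) (fun x hx => ?_)
  · exact mem_filter.2 ⟨mem_range.2 (ZMod.val_lt _), ZMod.val_coe_unit_coprime u⟩
  · rw [ZMod.coe_unitOfCoprime, ZMod.val_natCast,
      Nat.mod_eq_of_lt (mem_range.1 (mem_filter.1 hx).1)]
  · ext
    rw [ZMod.coe_unitOfCoprime, ZMod.natCast_zmod_val]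
  · rw [eInt_eq]
    push_cast
    rw [natCast_invMod, Int.cast_natCast, ← ZMod.inv_coe_unit, ZMod.coe_unitOfCoprime]

lemma sum_range_eq_sum_zmod (f : ZMod q → ℂ) : ∑ h ∈ range q, f (h : ZMod q) = ∑ h, f h :=
  sum_bij' (fun h _ => (h : ZMod q)) (fun h _ => h.val) (fun _ _ => mem_univ _)
    (fun h _ => mem_range.2 (ZMod.val_lt h))
    (fun h hh => by rw [ZMod.val_natCast, Nat.mod_eq_of_lt (mem_range.1 hh)])
    (fun h _ => ZMod.natCast_zmod_val h) (fun _ _ => rfl)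

lemma Gquad_eq (b : Fin 4 → ℕ) : Gquad q (b 0) (b 1) (b 2) (b 3) =
    q * Sig ZMod.stdAddChar fun i => ((b i : ZMod q))⁻¹ := by
  classical
  set ψ : AddChar (ZMod q) ℂ := ZMod.stdAddChar with hψ
  have hP : ψ.IsPrimitive := ZMod.isPrimitive_stdAddChar q
  have h1 : Gquad q (b 0) (b 1) (b 2) (b 3) = ∑ h : ZMod q, ∏ i : Fin 4, ∑ x : (ZMod q)ˣ,
      ψ (h * (x : ZMod q) + (b i : ZMod q)⁻¹ * ((x⁻¹ : (ZMod q)ˣ) : ZMod q)) := by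
    rw [← sum_range_eq_sum_zmod]
    unfold Gquad
    refine sum_congr rfl fun h _ => ?_
    simp only [Kloos_eq, Int.cast_natCast, natCast_invMod, Fin.prod_univ_four, ← hψ]
  have h2 : ∀ (h : ZMod q) (x : Fin 4 → (ZMod q)ˣ),
      ∏ i, ψ (h * (x i : ZMod q) + (b i : ZMod q)⁻¹ * (((x i)⁻¹ : (ZMod q)ˣ) : ZMod q)) =
      ψ (h * ∑ i, (x i : ZMod q)) *
        ψ (∑ i, (b i : ZMod q)⁻¹ * (((x i)⁻¹ : (ZMod q)ˣ) : ZMod q)) := by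
    intro h x
    rw [← AddChar.map_add_eq_mul, mul_sum, ← sum_add_distrib]
    simp only [Fin.prod_univ_four, Fin.sum_univ_four, AddChar.map_add_eq_mul]
  rw [h1]
  simp only [prod_univ_sum, Fintype.piFinset_univ, h2]
  rw [sum_comm]
  simp only [← sum_mul, sum_primitive hP, ZMod.card]
  unfold Sig
  rw [mul_sum, sum_filter]
  refine sum_congr rfl fun x _ => ?_
  split_ifs <;> simp

end AQK

namespace AQK

open Finset

lemma exists_succ_sq_le {M r : ℝ} (hM : 0 ≤ M) (hr : 1 < r) :
    ∃ C : ℝ, 1 ≤ C ∧ ∀ k : ℕ, M * ((k : ℝ) + 1) ^ 2 ≤ C * r ^ k := by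
  have hr0 : 0 < r := by linarith
  have h1 := tendsto_pow_const_div_const_pow_of_one_lt 2 hr
  obtain ⟨A, hA⟩ := h1.bddAbove_range
  have hA' : ∀ k : ℕ, (k : ℝ) ^ 2 ≤ A * r ^ k := by
    intro k
    have := hA ⟨k, rfl⟩
    rwa [div_le_iff₀ (pow_pos hr0 k)] at this
  have hA0 : 0 ≤ A := by simpa using hA' 0
  refine ⟨M * (A * r) + 1, by nlinarith [mul_nonneg hM (mul_nonneg hA0 hr0.le)], fun k => ?_⟩
  have h2 := hA' (k + 1)
  push_cast at h2
  have h3 := mul_le_mul_of_nonneg_left h2 hM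
  have h4 : 0 ≤ r ^ k := by positivity
  rw [pow_succ r] at h3
  nlinarith

/-- The bound `M ^ ω(n) τ(n)² ≪ n ^ ε`. -/
theorem exists_pow_card_mul_divisors_sq_le {M ε : ℝ} (hM : 1 ≤ M) (hε : 0 < ε) :
    ∃ C : ℝ, 0 < C ∧ ∀ n : ℕ, n ≠ 0 →
      M ^ n.primeFactors.card * (n.divisors.card : ℝ) ^ 2 ≤ C * (n : ℝ) ^ ε := by
  obtain ⟨C, hC, hCk⟩ := exists_succ_sq_le (r := 2 ^ ε) (by linarith : 0 ≤ M)
    (Real.one_lt_rpow (by norm_num) hε)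
  obtain ⟨P, hP⟩ := exists_nat_ge ((4 * M) ^ ε⁻¹)
  refine ⟨C ^ P, by positivity, fun n hn => ?_⟩
  have hloc : ∀ p ∈ n.primeFactors, M * ((n.factorization p : ℝ) + 1) ^ 2 ≤
      (if p ∈ range P then C else 1) * ((p : ℝ) ^ n.factorization p) ^ ε := by
    intro p hp
    have hpp := Nat.prime_of_mem_primeFactors hp
    have hp0 : (0 : ℝ) ≤ p := Nat.cast_nonneg p
    set k := n.factorization p
    have hk : 1 ≤ k := (hpp.dvd_iff_one_le_factorization hn).1 (Nat.dvd_of_mem_primeFactors hp)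
    have h1 : ((p : ℝ) ^ k) ^ ε = ((p : ℝ) ^ ε) ^ k := by
      rw [← Real.rpow_natCast, ← Real.rpow_natCast, ← Real.rpow_mul hp0, ← Real.rpow_mul hp0,
        mul_comm]
    rw [h1]
    split_ifs with h
    · refine (hCk k).trans ?_
      have h2 : (2 : ℝ) ^ ε ≤ (p : ℝ) ^ ε :=
        Real.rpow_le_rpow (by norm_num) (by exact_mod_cast hpp.two_le) hε.le
      gcongr
    · have h2 : (P : ℝ) ≤ p := by exact_mod_cast not_lt.1 fun h' => h (mem_range.2 h')
      have h3 : 4 * M ≤ (p : ℝ) ^ ε := by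
        have := Real.rpow_le_rpow (by positivity) (hP.trans h2) hε.le
        rwa [← Real.rpow_mul (by linarith), inv_mul_cancel₀ hε.ne', Real.rpow_one] at this
      rw [one_mul]
      have h4 : ((k : ℝ) + 1) ≤ 2 ^ k := by exact_mod_cast Nat.lt_two_pow_self
      have h5 : M ≤ M ^ k := le_self_pow₀ hM (by omega)
      calc M * ((k : ℝ) + 1) ^ 2 ≤ M ^ k * (2 ^ k) ^ 2 := by gcongr
        _ = (4 * M) ^ k := by rw [← pow_mul, mul_comm k 2, pow_mul, ← mul_pow]; ring
        _ ≤ _ := by gcongr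
  have h1 : M ^ n.primeFactors.card * (n.divisors.card : ℝ) ^ 2 =
      ∏ p ∈ n.primeFactors, M * ((n.factorization p : ℝ) + 1) ^ 2 := by
    rw [prod_mul_distrib, prod_const, prod_pow, Nat.card_divisors hn]
    push_cast
    rfl
  have h2 : (n : ℝ) ^ ε = ∏ p ∈ n.primeFactors, ((p : ℝ) ^ n.factorization p) ^ ε := by
    rw [Real.finsetProd_rpow _ _ fun _ _ => by positivity]
    congr 1
    conv_lhs => rw [← Nat.prod_factorization_pow_eq_self hn]
    rw [Finsupp.prod]
    push_cast
    rfl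
  have h3 : ∏ p ∈ n.primeFactors, (if p ∈ range P then C else 1) ≤ C ^ P := by
    rw [prod_ite_mem, prod_const]
    refine pow_le_pow_right₀ hC ((card_le_card inter_subset_right).trans (card_range P).le)
  rw [h1, h2]
  refine (prod_le_prod (fun p _ => by positivity) hloc).trans ?_
  rw [prod_mul_distrib]
  exact mul_le_mul_of_nonneg_right h3 (prod_nonneg fun _ _ => by positivity)

end AQK

namespace AQK

open Finset

lemma norm_Gquad_le {q : ℕ} (hq : q ≠ 0) (b : Fin 4 → ℕ) (hb : ∀ i, (b i).Coprime q) :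
    ‖Gquad q (b 0) (b 1) (b 2) (b 3)‖ ≤ q * q.factorization.prod (sigLocal b) := by
  have : NeZero q := ⟨hq⟩
  rw [Gquad_eq, norm_mul, Complex.norm_natCast]
  refine mul_le_mul_of_nonneg_left ?_ (Nat.cast_nonneg q)
  refine norm_Sig_le_prod q (Nat.pos_of_ne_zero hq) _ (ZMod.isPrimitive_stdAddChar q) b _ fun i => ?_
  rw [mul_comm]
  exact ZMod.coe_mul_inv_eq_one _ (hb i)

theorem sum_norm_Gquad_le {q N : ℕ} (hq : q ≠ 0) (hN : 0 < N) {S : Finset ℕ}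
    (hS : ∀ b ∈ S, b ≤ N ∧ b.Coprime q) :
    ∑ b₁ ∈ S, ∑ b₂ ∈ S, ∑ b₃ ∈ S, ∑ b₄ ∈ S, ‖Gquad q b₁ b₂ b₃ b₄‖ ≤
      q * (42 ^ q.primeFactors.card *
        ((simplePart q : ℝ) * √(simplePart q) * (squarePart q : ℝ) ^ 2)) *
        (3 * 2 ^ q.primeFactors.card * (countConst q * (N ^ 4 / halfPart q +
          N ^ 2 * √(simplePart q) + N * halfPart q * √(simplePart q)))) := by
  classical
  have h1 : ∑ b₁ ∈ S, ∑ b₂ ∈ S, ∑ b₃ ∈ S, ∑ b₄ ∈ S, ‖Gquad q b₁ b₂ b₃ b₄‖ =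
      ∑ t ∈ (S ×ˢ S) ×ˢ (S ×ˢ S),
        ‖Gquad q (quadFun t 0) (quadFun t 1) (quadFun t 2) (quadFun t 3)‖ := by
    simp only [sum_product]
    rfl
  rw [h1]
  refine le_trans ?_ (mul_le_mul_of_nonneg_left (sum_weights_le hq hN hS) (by positivity))
  rw [mul_sum]
  refine sum_le_sum fun t ht => ?_
  refine (norm_Gquad_le hq (quadFun t) fun i => (hS _ (quadFun_mem ht i)).2).trans ?_
  rw [mul_assoc]
  exact mul_le_mul_of_nonneg_left (prod_sigLocal_le q _) (Nat.cast_nonneg q)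

lemma final_arith {a s d r W N B : ℝ} (ha : 1 ≤ a) (hs : 1 ≤ s) (hd : 1 ≤ d) (hr : 1 ≤ r)
    (hW : 1 ≤ W) (hN : 0 ≤ N) (hNB : N ≤ B) (h1 : d ^ 2 ≤ s * r) (h2 : s * r ≤ W ^ 2 * d ^ 2) :
    (a * s) * (a * √a * s ^ 2) * (N ^ 4 / d + N ^ 2 * √a + N * d * √a) ≤
      W * (B ^ 4 * ((a * s) ^ 2 * √(a * s)) * (√r)⁻¹ + B ^ 2 * (a * s) ^ 3 * r +
        B * ((a * s) ^ 3 * √(a * s)) * √r) := by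
  have ha0 : 0 ≤ a := by linarith
  have hs0 : 0 ≤ s := by linarith
  have hr0 : 0 < r := by linarith
  have hd0 : 0 < d := by linarith
  have hW0 : 0 ≤ W := by linarith
  have hB : 0 ≤ B := hN.trans hNB
  rw [Real.sqrt_mul ha0]
  have sa : √a * √a = a := Real.mul_self_sqrt ha0
  have ss : √s * √s = s := Real.mul_self_sqrt hs0
  have sr0 : 0 < √r := Real.sqrt_pos.2 hr0
  have sa1 : 1 ≤ √a := Real.one_le_sqrt.2 ha
  have h3 : d ≤ √s * √r := by
    rw [← Real.sqrt_mul hs0]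
    exact Real.le_sqrt_of_sq_le h1
  have h4 : √s * √r ≤ W * d := by
    rw [← Real.sqrt_mul hs0, ← mul_pow] at *
    exact Real.sqrt_le_iff.2 ⟨by positivity, h2⟩
  have t1 : (a * s) * (a * √a * s ^ 2) * (N ^ 4 / d) ≤
      W * (B ^ 4 * ((a * s) ^ 2 * (√a * √s)) * (√r)⁻¹) := by
    have h5 : s / d ≤ W * (√s * (√r)⁻¹) := by
      rw [← div_eq_mul_inv, div_le_iff₀ hd0, mul_div_assoc', div_mul_eq_mul_div, le_div_iff₀ sr0]
      calc s * √r = √s * (√s * √r) := by rw [← mul_assoc, ss]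
        _ ≤ √s * (W * d) := by gcongr
        _ = _ := by ring
    calc _ = N ^ 4 * ((a * s) ^ 2 * √a) * (s / d) := by field_simp
      _ ≤ B ^ 4 * ((a * s) ^ 2 * √a) * (W * (√s * (√r)⁻¹)) := by gcongr
      _ = _ := by ring
  have t2 : (a * s) * (a * √a * s ^ 2) * (N ^ 2 * √a) ≤ W * (B ^ 2 * (a * s) ^ 3 * r) := by
    calc _ = N ^ 2 * (a * s) ^ 3 := by linear_combination (a * s) * a * s ^ 2 * N ^ 2 * sa
      _ ≤ B ^ 2 * (a * s) ^ 3 := by gcongr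
      _ ≤ B ^ 2 * (a * s) ^ 3 * (W * r) :=
        le_mul_of_one_le_right (by positivity) (one_le_mul_of_one_le_of_one_le hW hr)
      _ = _ := by ring
  have t3 : (a * s) * (a * √a * s ^ 2) * (N * d * √a) ≤
      W * (B * ((a * s) ^ 3 * (√a * √s)) * √r) := by
    calc _ = N * (a * s) ^ 3 * d := by linear_combination (a * s) * a * s ^ 2 * N * d * sa
      _ ≤ B * (a * s) ^ 3 * (√s * √r) := by gcongr
      _ ≤ B * (a * s) ^ 3 * (√s * √r) * (W * √a) :=
        le_mul_of_one_le_right (by positivity) (one_le_mul_of_one_le_of_one_le hW sa1)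
      _ = _ := by ring
  linarith

lemma rpow_half_add {x : ℝ} (hx : 0 < x) (n : ℕ) : x ^ ((n : ℝ) + 1 / 2) = x ^ n * √x := by
  rw [Real.rpow_add hx, Real.rpow_natCast, Real.sqrt_eq_rpow]

end AQK

/-- For every `ε > 0` there is `C = C(ε) > 0` such that for `q ≥ 1` and `1 ≤ B ≤ q`,
`∑_{1 ≤ b₁,b₂,b₃,b₄ ≤ B, (bᵢ,q)=1} |G_q(b₁,b₂,b₃,b₄)|
  ≤ C q^ε (B⁴ q^{5/2} q̊^{-1/2} + B² q³ q̊ + B q^{7/2} q̊^{1/2})`. -/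
theorem average_quartic_kloosterman :
    ∀ ε : ℝ, 0 < ε → ∃ C : ℝ, 0 < C ∧ ∀ q : ℕ, 1 ≤ q → ∀ B : ℝ, 1 ≤ B → B ≤ q →
      ∑ b₁ ∈ bRange q B, ∑ b₂ ∈ bRange q B, ∑ b₃ ∈ bRange q B, ∑ b₄ ∈ bRange q B,
          ‖Gquad q b₁ b₂ b₃ b₄‖ ≤
        C * (q : ℝ) ^ (ε : ℝ) *
          (B ^ 4 * (q : ℝ) ^ ((5 : ℝ) / 2) * (qring q : ℝ) ^ (-(1 : ℝ) / 2)
            + B ^ 2 * (q : ℝ) ^ (3 : ℕ) * (qring q : ℝ)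
            + B * (q : ℝ) ^ ((7 : ℝ) / 2) * (qring q : ℝ) ^ ((1 : ℝ) / 2)) := by
  intro ε hε
  obtain ⟨C, hC, hCn⟩ := AQK.exists_pow_card_mul_divisors_sq_le
    (M := 42 * 2 * 1728 * 2) (by norm_num) hε
  refine ⟨2304 * C, by positivity, fun q hq B hB _ => ?_⟩
  have hq0 : q ≠ 0 := by omega
  have hN : 0 < ⌊B⌋₊ := Nat.floor_pos.2 hB
  have hNB : (⌊B⌋₊ : ℝ) ≤ B := Nat.floor_le (by linarith)
  have hS : ∀ b ∈ bRange q B, b ≤ ⌊B⌋₊ ∧ b.Coprime q := fun b hb =>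
    ⟨(Finset.mem_Icc.1 (Finset.mem_filter.1 hb).1).2, (Finset.mem_filter.1 hb).2⟩
  refine (AQK.sum_norm_Gquad_le hq0 hN hS).trans ?_
  have hqm := AQK.simplePart_mul_squarePart hq0
  have hqm' : (AQK.simplePart q : ℝ) * AQK.squarePart q = q := by exact_mod_cast hqm
  have ha : (1 : ℝ) ≤ AQK.simplePart q := by
    exact_mod_cast Nat.pos_of_ne_zero fun h => hq0 (by rw [← hqm, h, zero_mul])
  have hs : (1 : ℝ) ≤ AQK.squarePart q := by
    exact_mod_cast Nat.pos_of_ne_zero fun h => hq0 (by rw [← hqm, h, mul_zero])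
  have hd : (1 : ℝ) ≤ AQK.halfPart q := by
    exact_mod_cast Nat.pos_of_dvd_of_pos (AQK.halfPart_dvd hq0) hq
  have hr : (1 : ℝ) ≤ qring q := by
    exact_mod_cast Finset.prod_pos fun p hp =>
      (Nat.prime_of_mem_primeFactors (Finset.mem_filter.1 hp).1).pos
  have hW : (1 : ℝ) ≤ 2 ^ q.primeFactors.card := one_le_pow₀ (by norm_num)
  have h1 : (AQK.halfPart q : ℝ) ^ 2 ≤ AQK.squarePart q * qring q := by
    exact_mod_cast AQK.halfPart_sq_le q
  have h2 : (AQK.squarePart q : ℝ) * qring q ≤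
      (2 ^ q.primeFactors.card) ^ 2 * (AQK.halfPart q : ℝ) ^ 2 := by
    rw [← pow_mul, mul_comm _ 2, pow_mul]
    have := AQK.squarePart_mul_qring_le q
    norm_num
    exact_mod_cast this
  have h3 := AQK.final_arith ha hs hd hr hW (Nat.cast_nonneg ⌊B⌋₊) hNB h1 h2
  rw [hqm'] at h3
  have hqr : (0 : ℝ) < q := by exact_mod_cast hq
  have hr0 : (0 : ℝ) < qring q := by linarith
  have e1 : (q : ℝ) ^ ((5 : ℝ) / 2) = (q : ℝ) ^ 2 * √q := by
    rw [← AQK.rpow_half_add hqr]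
    norm_num
  have e2 : (q : ℝ) ^ ((7 : ℝ) / 2) = (q : ℝ) ^ 3 * √q := by
    rw [← AQK.rpow_half_add hqr]
    norm_num
  have e3 : (qring q : ℝ) ^ (-(1 : ℝ) / 2) = (√(qring q : ℝ))⁻¹ := by
    rw [neg_div, Real.rpow_neg hr0.le, Real.sqrt_eq_rpow]
  have e4 : (qring q : ℝ) ^ ((1 : ℝ) / 2) = √(qring q : ℝ) := (Real.sqrt_eq_rpow _).symm
  rw [e1, e2, e3, e4]
  set Y : ℝ := B ^ 4 * ((q : ℝ) ^ 2 * √q) * (√(qring q : ℝ))⁻¹ + B ^ 2 * (q : ℝ) ^ 3 * qring q +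
    B * ((q : ℝ) ^ 3 * √q) * √(qring q : ℝ) with hY
  have hY0 : 0 ≤ Y := by
    have : 0 ≤ B := by linarith
    positivity
  have hCq := hCn q hq0
  simp only [mul_pow] at hCq
  have hK := AQK.countConst_nonneg q
  calc _ = 42 ^ q.primeFactors.card * (3 * 2 ^ q.primeFactors.card * AQK.countConst q) *
        (q * ((AQK.simplePart q : ℝ) * √(AQK.simplePart q) * (AQK.squarePart q : ℝ) ^ 2) *
          ((⌊B⌋₊ : ℝ) ^ 4 / AQK.halfPart q + (⌊B⌋₊ : ℝ) ^ 2 * √(AQK.simplePart q) +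
            ⌊B⌋₊ * AQK.halfPart q * √(AQK.simplePart q))) := by ring
    _ ≤ 42 ^ q.primeFactors.card * (3 * 2 ^ q.primeFactors.card * AQK.countConst q) *
        (2 ^ q.primeFactors.card * Y) := mul_le_mul_of_nonneg_left h3 (by positivity)
    _ = 2304 * (42 ^ q.primeFactors.card * 2 ^ q.primeFactors.card * 1728 ^ q.primeFactors.card *
        2 ^ q.primeFactors.card * (q.divisors.card : ℝ) ^ 2) * Y := by
      rw [AQK.countConst]
      ring
    _ ≤ 2304 * (C * (q : ℝ) ^ ε) * Y := by gcongr
    _ = _ := by ring
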